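/- DS Coherence: the functor G from DS to Br is faithful; that is, for all arrow terms f, g : A ⊢ B of DS, if Gf = Gg in Br then f = g in DS. -/

import Mathlib

/-! ### The category Br of Brauerian split equivalences of finite ordinals

An arrow `m ⊢ n` of `Br` is represented as a relation on `ℕ ⊕ ℕ`, where
`Sum.inl i` (with `i < m`) is the source copy `i_s` and `Sum.inr j`
(with `j < n`) is the target copy `j_t`. -/

abbrev GRel : Type := (ℕ ⊕ ℕ) → (ℕ ⊕ ℕ) → Prop

/-- The identity arrow of `Br` on `n`: transversals `{i_s, i_t}` for `i < n`. -/
def gId (n : ℕ) : GRel := fun u v =>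
  ∃ i, i < n ∧ (u = Sum.inl i ∨ u = Sum.inr i) ∧ (v = Sum.inl i ∨ v = Sum.inr i)

/-- The Brauerian split equivalence whose transversals are `{i_s, (φ i)_t}` for `i < m`. -/
def gFun (m : ℕ) (φ : ℕ → ℕ) : GRel := fun u v =>
  ∃ i, i < m ∧ (u = Sum.inl i ∨ u = Sum.inr (φ i)) ∧ (v = Sum.inl i ∨ v = Sum.inr (φ i))

/-- The block transposition exchanging the first `a` and the last `b` elements. -/
def gSwap (a b : ℕ) : GRel :=
  gFun (a + b) (fun i => if i < a then i + b else i - a)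

/-- `G Δ̂∧_{B,A}` with `a = GA`, `b = GB`: identity transversals on the stem `A`
together with caps joining the two copies of each letter occurrence of `B` in
the crown `¬B ∨ B` of the target. -/
def gDelta (a b : ℕ) : GRel := fun u v =>
  (∃ i, i < a ∧ (u = Sum.inl i ∨ u = Sum.inr i) ∧ (v = Sum.inl i ∨ v = Sum.inr i)) ∨
  (∃ j, j < b ∧ (u = Sum.inr (a + j) ∨ u = Sum.inr (a + b + j)) ∧
                (v = Sum.inr (a + j) ∨ v = Sum.inr (a + b + j)))

/-- `G Σ̂∨_{B,A}` with `a = GA`, `b = GB`: identity transversals on the stem `A`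
together with cups joining the two copies of each letter occurrence of `B` in
the crown `B ∧ ¬B` of the source. -/
def gSigma (a b : ℕ) : GRel := fun u v =>
  (∃ i, i < a ∧ (u = Sum.inl (2*b + i) ∨ u = Sum.inr i) ∧
                (v = Sum.inl (2*b + i) ∨ v = Sum.inr i)) ∨
  (∃ j, j < b ∧ (u = Sum.inl j ∨ u = Sum.inl (b + j)) ∧
                (v = Sum.inl j ∨ v = Sum.inl (b + j)))

/-- Composition `P ∗ R` in `Br`: glue along the middle copy and take the
transitive closure, restricted to the outer copies. -/
def gComp (Pr R : GRel) : GRel := fun u v =>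
  Relation.TransGen
    (fun x y : ℕ ⊕ ℕ ⊕ ℕ =>
      (∃ x' y', Sum.map id Sum.inl x' = x ∧ Sum.map id Sum.inl y' = y ∧ R x' y') ∨
      (∃ x' y', Sum.inr x' = x ∧ Sum.inr y' = y ∧ Pr x' y'))
    (Sum.map id Sum.inr u) (Sum.map id Sum.inr v)

/-- Shift a split relation by `a` on the source side and by `d` on the target side. -/
def gShift (a d : ℕ) (R : GRel) : GRel := fun u v =>
  ∃ u' v', R u' v' ∧ u = Sum.map (· + a) (· + d) u' ∧ v = Sum.map (· + a) (· + d) v'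

/-- Disjoint union of split relations: `G(f ξ g) = Gf ∪ Gg_{+GD}^{+GA}`. -/
def gPar (a d : ℕ) (R S : GRel) : GRel := fun u v => R u v ∨ gShift a d S u v
/-! ### The language L∧,∨ generated from the set `P` of letters -/

inductive Form (P : Type) : Type
  | letter : P → Form P
  | conj : Form P → Form P → Form P
  | disj : Form P → Form P → Form P

infixr:70 " ⋏ " => Form.conj
infixr:66 " ⋎ " => Form.disj

/-- The number of occurrences of letters in a formula (the object map of `G`). -/
def Form.size {P : Type} : Form P → ℕ
  | .letter _ => 1
  | .conj A B => A.size + B.size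
  | .disj A B => A.size + B.size
/-! ### Arrow terms of the free symmetric net category DS -/

inductive Term (P : Type) : Form P → Form P → Type
  | id (A : Form P) : Term P A A
  | comp {A B C : Form P} : Term P B C → Term P A B → Term P A C
  | conj {A B D E : Form P} : Term P A D → Term P B E → Term P (A ⋏ B) (D ⋏ E)
  | disj {A B D E : Form P} : Term P A D → Term P B E → Term P (A ⋎ B) (D ⋎ E)
  | bConjTo (A B C : Form P) : Term P (A ⋏ (B ⋏ C)) ((A ⋏ B) ⋏ C)
  | bConjFrom (A B C : Form P) : Term P ((A ⋏ B) ⋏ C) (A ⋏ (B ⋏ C))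
  | bDisjTo (A B C : Form P) : Term P (A ⋎ (B ⋎ C)) ((A ⋎ B) ⋎ C)
  | bDisjFrom (A B C : Form P) : Term P ((A ⋎ B) ⋎ C) (A ⋎ (B ⋎ C))
  | cConj (A B : Form P) : Term P (A ⋏ B) (B ⋏ A)
  | cDisj (A B : Form P) : Term P (B ⋎ A) (A ⋎ B)
  | d (A B C : Form P) : Term P (A ⋏ (B ⋎ C)) ((A ⋏ B) ⋎ C)

infixr:80 " ⬝ " => Term.comp
infixr:70 " ⊼ " => Term.conj
infixr:66 " ⊽ " => Term.disj

/-- The arrow `d^R_{C,B,A} : (C∨B)∧A ⊢ C∨(B∧A)`. -/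
def dR {P : Type} (C B A : Form P) : Term P ((C ⋎ B) ⋏ A) (C ⋎ (B ⋏ A)) :=
  Term.cDisj C (B ⋏ A) ⬝ ((Term.cConj A B ⊽ Term.id C) ⬝
    (Term.d A B C ⬝ ((Term.id A ⊼ Term.cDisj B C) ⬝ Term.cConj (C ⋎ B) A)))
/-! ### The equations of DS, imposed on arrow terms -/

inductive Eqv {P : Type} : ∀ {A B : Form P}, Term P A B → Term P A B → Prop
  -- equivalence and congruence
  | refl {A B : Form P} (f : Term P A B) : Eqv f f
  | symm {A B : Form P} {f g : Term P A B} : Eqv f g → Eqv g f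
  | trans {A B : Form P} {f g h : Term P A B} : Eqv f g → Eqv g h → Eqv f h
  | congComp {A B C : Form P} {g g' : Term P B C} {f f' : Term P A B} :
      Eqv g g' → Eqv f f' → Eqv (g ⬝ f) (g' ⬝ f')
  | congConj {A B D E : Form P} {f f' : Term P A D} {g g' : Term P B E} :
      Eqv f f' → Eqv g g' → Eqv (f ⊼ g) (f' ⊼ g')
  | congDisj {A B D E : Form P} {f f' : Term P A D} {g g' : Term P B E} :
      Eqv f f' → Eqv g g' → Eqv (f ⊽ g) (f' ⊽ g')
  -- (cat 1), (cat 2)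
  | catIdR {A B : Form P} (f : Term P A B) : Eqv (f ⬝ Term.id A) f
  | catIdL {A B : Form P} (f : Term P A B) : Eqv (Term.id B ⬝ f) f
  | catAssoc {A B C D : Form P} (f : Term P A B) (g : Term P B C) (h : Term P C D) :
      Eqv (h ⬝ (g ⬝ f)) ((h ⬝ g) ⬝ f)
  -- bifunctorial equations (ξ 1), (ξ 2)
  | conjOne (A B : Form P) : Eqv (Term.id A ⊼ Term.id B) (Term.id (A ⋏ B))
  | disjOne (A B : Form P) : Eqv (Term.id A ⊽ Term.id B) (Term.id (A ⋎ B))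
  | conjTwo {A₁ B₁ C₁ A₂ B₂ C₂ : Form P} (g₁ : Term P B₁ C₁) (f₁ : Term P A₁ B₁)
      (g₂ : Term P B₂ C₂) (f₂ : Term P A₂ B₂) :
      Eqv ((g₁ ⬝ f₁) ⊼ (g₂ ⬝ f₂)) ((g₁ ⊼ g₂) ⬝ (f₁ ⊼ f₂))
  | disjTwo {A₁ B₁ C₁ A₂ B₂ C₂ : Form P} (g₁ : Term P B₁ C₁) (f₁ : Term P A₁ B₁)
      (g₂ : Term P B₂ C₂) (f₂ : Term P A₂ B₂) :
      Eqv ((g₁ ⬝ f₁) ⊽ (g₂ ⬝ f₂)) ((g₁ ⊽ g₂) ⬝ (f₁ ⊽ f₂))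
  -- naturality equations
  | bConjNat {A B C D E F : Form P} (f : Term P A D) (g : Term P B E) (h : Term P C F) :
      Eqv (((f ⊼ g) ⊼ h) ⬝ Term.bConjTo A B C) (Term.bConjTo D E F ⬝ (f ⊼ (g ⊼ h)))
  | bDisjNat {A B C D E F : Form P} (f : Term P A D) (g : Term P B E) (h : Term P C F) :
      Eqv (((f ⊽ g) ⊽ h) ⬝ Term.bDisjTo A B C) (Term.bDisjTo D E F ⬝ (f ⊽ (g ⊽ h)))
  | cConjNat {A B D E : Form P} (f : Term P A D) (g : Term P B E) :
      Eqv ((g ⊼ f) ⬝ Term.cConj A B) (Term.cConj D E ⬝ (f ⊼ g))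
  | cDisjNat {A B D E : Form P} (f : Term P A D) (g : Term P B E) :
      Eqv ((g ⊽ f) ⬝ Term.cDisj B A) (Term.cDisj E D ⬝ (f ⊽ g))
  | dNat {A B C D E F : Form P} (f : Term P A D) (g : Term P B E) (h : Term P C F) :
      Eqv (((f ⊼ g) ⊽ h) ⬝ Term.d A B C) (Term.d D E F ⬝ (f ⊼ (g ⊽ h)))
  -- (b̂ξ b̂ξ)
  | bConjIso₁ (A B C : Form P) :
      Eqv (Term.bConjFrom A B C ⬝ Term.bConjTo A B C) (Term.id (A ⋏ (B ⋏ C)))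
  | bConjIso₂ (A B C : Form P) :
      Eqv (Term.bConjTo A B C ⬝ Term.bConjFrom A B C) (Term.id ((A ⋏ B) ⋏ C))
  | bDisjIso₁ (A B C : Form P) :
      Eqv (Term.bDisjFrom A B C ⬝ Term.bDisjTo A B C) (Term.id (A ⋎ (B ⋎ C)))
  | bDisjIso₂ (A B C : Form P) :
      Eqv (Term.bDisjTo A B C ⬝ Term.bDisjFrom A B C) (Term.id ((A ⋎ B) ⋎ C))
  -- (b̂ξ 5)
  | bConjPent (A B C D : Form P) :
      Eqv (Term.bConjFrom A B (C ⋏ D) ⬝ Term.bConjFrom (A ⋏ B) C D)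
        ((Term.id A ⊼ Term.bConjFrom B C D) ⬝
          (Term.bConjFrom A (B ⋏ C) D ⬝ (Term.bConjFrom A B C ⊼ Term.id D)))
  | bDisjPent (A B C D : Form P) :
      Eqv (Term.bDisjFrom A B (C ⋎ D) ⬝ Term.bDisjFrom (A ⋎ B) C D)
        ((Term.id A ⊽ Term.bDisjFrom B C D) ⬝
          (Term.bDisjFrom A (B ⋎ C) D ⬝ (Term.bDisjFrom A B C ⊽ Term.id D)))
  -- (ĉ∧ ĉ∧), (ĉ∨ ĉ∨)
  | cConjIso (A B : Form P) : Eqv (Term.cConj B A ⬝ Term.cConj A B) (Term.id (A ⋏ B))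
  | cDisjIso (A B : Form P) : Eqv (Term.cDisj A B ⬝ Term.cDisj B A) (Term.id (A ⋎ B))
  -- (b̂∧ ĉ∧), (b̂∨ ĉ∨)
  | bcConj (A B C : Form P) :
      Eqv ((Term.id B ⊼ Term.cConj C A) ⬝ (Term.bConjFrom B C A ⬝
            (Term.cConj A (B ⋏ C) ⬝ (Term.bConjFrom A B C ⬝ (Term.cConj B A ⊼ Term.id C)))))
        (Term.bConjFrom B A C)
  | bcDisj (A B C : Form P) :
      Eqv ((Term.id B ⊽ Term.cDisj A C) ⬝ (Term.bDisjFrom B C A ⬝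
            (Term.cDisj (B ⋎ C) A ⬝ (Term.bDisjFrom A B C ⬝ (Term.cDisj A B ⊽ Term.id C)))))
        (Term.bDisjFrom B A C)
  -- (d ∧), (d ∨)
  | dConj (A B C D : Form P) :
      Eqv ((Term.bConjFrom A B C ⊽ Term.id D) ⬝ Term.d (A ⋏ B) C D)
        (Term.d A (B ⋏ C) D ⬝ ((Term.id A ⊼ Term.d B C D) ⬝ Term.bConjFrom A B (C ⋎ D)))
  | dDisj (D C B A : Form P) :
      Eqv (Term.d D C (B ⋎ A) ⬝ (Term.id D ⊼ Term.bDisjFrom C B A))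
        (Term.bDisjFrom (D ⋏ C) B A ⬝ ((Term.d D C B ⊽ Term.id A) ⬝ Term.d D (C ⋎ B) A))
  -- (d b̂∧), (d b̂∨)
  | dBConj (A B C D : Form P) :
      Eqv (dR (A ⋏ B) C D ⬝ (Term.d A B C ⊼ Term.id D))
        (Term.d A B (C ⋏ D) ⬝ ((Term.id A ⊼ dR B C D) ⬝ Term.bConjFrom A (B ⋎ C) D))
  | dBDisj (D C B A : Form P) :
      Eqv ((Term.id D ⊽ Term.d C B A) ⬝ dR D C (B ⋎ A))
        (Term.bDisjFrom D (C ⋏ B) A ⬝ ((dR D C B ⊽ Term.id A) ⬝ Term.d (D ⋎ C) B A))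
/-- The functor `G` from DS to Br on arrow terms. -/
def Term.G {P : Type} : ∀ {A B : Form P}, Term P A B → GRel
  | _, _, .id A => gId A.size
  | _, _, .comp g f => gComp (Term.G g) (Term.G f)
  | _, _, @Term.conj _ A _ D _ f g => gPar A.size D.size (Term.G f) (Term.G g)
  | _, _, @Term.disj _ A _ D _ f g => gPar A.size D.size (Term.G f) (Term.G g)
  | _, _, .bConjTo A B C => gId (A.size + (B.size + C.size))
  | _, _, .bConjFrom A B C => gId (A.size + B.size + C.size)
  | _, _, .bDisjTo A B C => gId (A.size + (B.size + C.size))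
  | _, _, .bDisjFrom A B C => gId (A.size + B.size + C.size)
  | _, _, .cConj A B => gSwap A.size B.size
  | _, _, .cDisj A B => gSwap B.size A.size
  | _, _, .d A B C => gId (A.size + (B.size + C.size))

open CategoryTheory

namespace DSC

/-! ### Part 1: the quotient category -/

/-- Setoid of provable equality. -/
def tSetoid {P : Type} (A B : Form P) : Setoid (Term P A B) where
  r := Eqv
  iseqv := ⟨Eqv.refl, Eqv.symm, Eqv.trans⟩

/-- Arrows of DS. -/
def Hm {P : Type} (A B : Form P) : Type := Quotient (tSetoid A B)

/-- The arrow of a term. -/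
def q {P : Type} {A B : Form P} (f : Term P A B) : Hm A B := Quotient.mk _ f

theorem q_eq {P : Type} {A B : Form P} {f g : Term P A B} : q f = q g ↔ Eqv f g := by
  constructor
  · intro h
    exact Quotient.exact h
  · intro h
    exact Quotient.sound h

instance {P : Type} : Category (Form P) where
  Hom A B := Hm A B
  id A := q (Term.id A)
  comp f g := Quotient.map₂ (fun f g => Term.comp g f)
    (fun _ _ hf _ _ hg => Eqv.congComp hg hf) f g
  id_comp f := by
    induction f using Quotient.ind
    exact Quotient.sound (Eqv.catIdR _)
  comp_id f := by
    induction f using Quotient.ind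
    exact Quotient.sound (Eqv.catIdL _)
  assoc f g h := by
    induction f using Quotient.ind
    induction g using Quotient.ind
    induction h using Quotient.ind
    exact Quotient.sound (Eqv.catAssoc _ _ _)

variable {P : Type}

/-- The arrow of a term, as a morphism. -/
def qm {A B : Form P} (f : Term P A B) : A ⟶ B := q f

theorem qm_eq {A B : Form P} {f g : Term P A B} : qm f = qm g ↔ Eqv f g := q_eq

theorem qm_comp {A B C : Form P} (f : Term P A B) (g : Term P B C) :
    qm (Term.comp g f) = qm f ≫ qm g := rfl

theorem qm_id (A : Form P) : qm (Term.id A) = 𝟙 A := rfl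

/-- Tagged connective: `true` is conjunction. -/
@[reducible] def opF (b : Bool) (A B : Form P) : Form P :=
  match b with
  | true => A ⋏ B
  | false => A ⋎ B

/-- Action of connectives on arrows. -/
def mConj {A B D E : Form P} (f : A ⟶ D) (g : B ⟶ E) : (A ⋏ B) ⟶ (D ⋏ E) :=
  Quotient.map₂ (fun f g => Term.conj f g) (fun _ _ hf _ _ hg => Eqv.congConj hf hg) f g

def mDisj {A B D E : Form P} (f : A ⟶ D) (g : B ⟶ E) : (A ⋎ B) ⟶ (D ⋎ E) :=
  Quotient.map₂ (fun f g => Term.disj f g) (fun _ _ hf _ _ hg => Eqv.congDisj hf hg) f g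

def mOp (b : Bool) {A B D E : Form P} (f : A ⟶ D) (g : B ⟶ E) : opF b A B ⟶ opF b D E :=
  match b with
  | true => mConj f g
  | false => mDisj f g

def asTo (b : Bool) (A B C : Form P) : opF b A (opF b B C) ⟶ opF b (opF b A B) C :=
  match b with
  | true => qm (Term.bConjTo A B C)
  | false => qm (Term.bDisjTo A B C)

def asFr (b : Bool) (A B C : Form P) : opF b (opF b A B) C ⟶ opF b A (opF b B C) :=
  match b with
  | true => qm (Term.bConjFrom A B C)
  | false => qm (Term.bDisjFrom A B C)

def cm (b : Bool) (A B : Form P) : opF b A B ⟶ opF b B A :=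
  match b with
  | true => qm (Term.cConj A B)
  | false => qm (Term.cDisj B A)

def md (A B C : Form P) : (A ⋏ (B ⋎ C)) ⟶ ((A ⋏ B) ⋎ C) := qm (Term.d A B C)

theorem ind_hom {A B : Form P} (f : A ⟶ B) : ∃ t : Term P A B, f = qm t := by
  obtain ⟨t, rfl⟩ := Quotient.exists_rep f
  exact ⟨t, rfl⟩

@[simp] theorem mOp_id (b : Bool) (A B : Form P) : mOp b (𝟙 A) (𝟙 B) = 𝟙 (opF b A B) := by
  cases b
  · exact Quotient.sound (Eqv.disjOne _ _)
  · exact Quotient.sound (Eqv.conjOne _ _)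

theorem mOp_comp (b : Bool) {A₁ B₁ C₁ A₂ B₂ C₂ : Form P} (f₁ : A₁ ⟶ B₁) (g₁ : B₁ ⟶ C₁)
    (f₂ : A₂ ⟶ B₂) (g₂ : B₂ ⟶ C₂) :
    mOp b (f₁ ≫ g₁) (f₂ ≫ g₂) = mOp b f₁ f₂ ≫ mOp b g₁ g₂ := by
  obtain ⟨f₁, rfl⟩ := ind_hom f₁
  obtain ⟨f₂, rfl⟩ := ind_hom f₂
  obtain ⟨g₁, rfl⟩ := ind_hom g₁
  obtain ⟨g₂, rfl⟩ := ind_hom g₂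
  cases b
  · exact Quotient.sound (Eqv.disjTwo _ _ _ _)
  · exact Quotient.sound (Eqv.conjTwo _ _ _ _)

theorem as_nat (b : Bool) {A B C D E F : Form P} (f : A ⟶ D) (g : B ⟶ E) (h : C ⟶ F) :
    asTo b A B C ≫ mOp b (mOp b f g) h = mOp b f (mOp b g h) ≫ asTo b D E F := by
  obtain ⟨f, rfl⟩ := ind_hom f
  obtain ⟨g, rfl⟩ := ind_hom g
  obtain ⟨h, rfl⟩ := ind_hom h
  cases b
  · exact Quotient.sound (Eqv.bDisjNat _ _ _)
  · exact Quotient.sound (Eqv.bConjNat _ _ _)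

theorem cm_nat (b : Bool) {A B D E : Form P} (f : A ⟶ D) (g : B ⟶ E) :
    cm b A B ≫ mOp b g f = mOp b f g ≫ cm b D E := by
  obtain ⟨f, rfl⟩ := ind_hom f
  obtain ⟨g, rfl⟩ := ind_hom g
  cases b
  · exact Quotient.sound (Eqv.cDisjNat _ _)
  · exact Quotient.sound (Eqv.cConjNat _ _)

theorem md_nat {A B C D E F : Form P} (f : A ⟶ D) (g : B ⟶ E) (h : C ⟶ F) :
    md A B C ≫ mOp false (mOp true f g) h = mOp true f (mOp false g h) ≫ md D E F := by
  obtain ⟨f, rfl⟩ := ind_hom f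
  obtain ⟨g, rfl⟩ := ind_hom g
  obtain ⟨h, rfl⟩ := ind_hom h
  exact Quotient.sound (Eqv.dNat _ _ _)

@[simp] theorem asTo_asFr (b : Bool) (A B C : Form P) : asTo b A B C ≫ asFr b A B C = 𝟙 _ := by
  cases b
  · exact Quotient.sound (Eqv.bDisjIso₁ _ _ _)
  · exact Quotient.sound (Eqv.bConjIso₁ _ _ _)

@[simp] theorem asFr_asTo (b : Bool) (A B C : Form P) : asFr b A B C ≫ asTo b A B C = 𝟙 _ := by
  cases b
  · exact Quotient.sound (Eqv.bDisjIso₂ _ _ _)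
  · exact Quotient.sound (Eqv.bConjIso₂ _ _ _)

@[simp] theorem cm_cm (b : Bool) (A B : Form P) : cm b A B ≫ cm b B A = 𝟙 _ := by
  cases b
  · exact Quotient.sound (Eqv.cDisjIso _ _)
  · exact Quotient.sound (Eqv.cConjIso _ _)

theorem pent (b : Bool) (A B C D : Form P) :
    asFr b (opF b A B) C D ≫ asFr b A B (opF b C D) =
      mOp b (asFr b A B C) (𝟙 D) ≫ asFr b A (opF b B C) D ≫ mOp b (𝟙 A) (asFr b B C D) := by
  rw [← Category.assoc]
  cases b
  · exact Quotient.sound ((Eqv.bDisjPent _ _ _ _))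
  · exact Quotient.sound ((Eqv.bConjPent _ _ _ _))

theorem hexa (b : Bool) (A B C : Form P) :
    mOp b (cm b B A) (𝟙 C) ≫ asFr b A B C ≫ cm b A (opF b B C) ≫ asFr b B C A ≫
      mOp b (𝟙 B) (cm b C A) = asFr b B A C := by
  simp only [← Category.assoc]
  cases b
  · exact Quotient.sound (Eqv.bcDisj _ _ _)
  · exact Quotient.sound (Eqv.bcConj _ _ _)

theorem e_dConj (A B C D : Form P) :
    md (A ⋏ B) C D ≫ mOp false (asFr true A B C) (𝟙 D) =
      (asFr true A B (C ⋎ D) ≫ mOp true (𝟙 A) (md B C D)) ≫ md A (B ⋏ C) D :=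
  Quotient.sound (Eqv.dConj _ _ _ _)

theorem e_dDisj (D C B A : Form P) :
    mOp true (𝟙 D) (asFr false C B A) ≫ md D C (B ⋎ A) =
      (md D (C ⋎ B) A ≫ mOp false (md D C B) (𝟙 A)) ≫ asFr false (D ⋏ C) B A :=
  Quotient.sound (Eqv.dDisj _ _ _ _)

/-- The arrow `d^R`. -/
def mdR (C B A : Form P) : ((C ⋎ B) ⋏ A) ⟶ (C ⋎ (B ⋏ A)) :=
  (((cm true (C ⋎ B) A ≫ mOp true (𝟙 A) (cm false C B)) ≫ md A B C) ≫
    mOp false (cm true A B) (𝟙 C)) ≫ cm false (B ⋏ A) C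

theorem e_dBConj (A B C D : Form P) :
    mOp true (md A B C) (𝟙 D) ≫ mdR (A ⋏ B) C D =
      (asFr true A (B ⋎ C) D ≫ mOp true (𝟙 A) (mdR B C D)) ≫ md A B (C ⋏ D) :=
  Quotient.sound (Eqv.dBConj _ _ _ _)

theorem e_dBDisj (D C B A : Form P) :
    mdR D C (B ⋎ A) ≫ mOp false (𝟙 D) (md C B A) =
      (md (D ⋎ C) B A ≫ mOp false (mdR D C B) (𝟙 A)) ≫ asFr false D (C ⋏ B) A :=
  Quotient.sound (Eqv.dBDisj _ _ _ _)

/-- Induction principle for arrows. -/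
theorem hom_ind (M : ∀ {A B : Form P}, (A ⟶ B) → Prop)
    (hid : ∀ A, M (𝟙 A))
    (hcomp : ∀ {A B C : Form P} (f : A ⟶ B) (g : B ⟶ C), M f → M g → M (f ≫ g))
    (hop : ∀ b {A B D E : Form P} (f : A ⟶ D) (g : B ⟶ E), M f → M g → M (mOp b f g))
    (hto : ∀ b (A B C : Form P), M (asTo b A B C))
    (hfr : ∀ b (A B C : Form P), M (asFr b A B C))
    (hc : ∀ b (A B : Form P), M (cm b A B))
    (hd : ∀ (A B C : Form P), M (md A B C)) {A B : Form P} (f : A ⟶ B) : M f := by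
  obtain ⟨t, rfl⟩ := ind_hom f
  induction t with
  | id A => exact hid A
  | comp g f ihg ihf => exact hcomp _ _ ihf ihg
  | conj f g ihf ihg => exact hop true _ _ ihf ihg
  | disj f g ihf ihg => exact hop false _ _ ihf ihg
  | bConjTo A B C => exact hto true A B C
  | bConjFrom A B C => exact hfr true A B C
  | bDisjTo A B C => exact hto false A B C
  | bDisjFrom A B C => exact hfr false A B C
  | cConj A B => exact hc true A B
  | cDisj A B => exact hc false B A
  | d A B C => exact hd A B C

end DSC

namespace DSC

/-! ### Part 3: graphs -/

/-- Finite simple graphs on natural numbers (finiteness comes later). -/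
structure Obj where
  V : Set ℕ
  E : ℕ → ℕ → Prop
  mem : ∀ {p q}, E p q → p ∈ V
  symm : ∀ {p q}, E p q → E q p
  irr : ∀ {p}, ¬ E p p

namespace Obj

theorem mem' (x : Obj) {p q : ℕ} (h : x.E p q) : q ∈ x.V := x.mem (x.symm h)

theorem ext' {x y : Obj} (hV : ∀ p, p ∈ x.V ↔ p ∈ y.V)
    (hE : ∀ p q, p ∈ x.V → q ∈ x.V → p ≠ q → (x.E p q ↔ y.E p q)) : x = y := by
  obtain ⟨V, E, m, s, i⟩ := x
  obtain ⟨V', E', m', s', i'⟩ := y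
  obtain rfl : V = V' := Set.ext hV
  have : E = E' := by
    funext p q
    by_cases hpq : p = q
    · subst hpq
      exact propext ⟨fun h => (i h).elim, fun h => (i' h).elim⟩
    · by_cases hp : p ∈ V
      · by_cases hq : q ∈ V
        · exact propext (hE p q hp hq hpq)
        · exact propext ⟨fun h => (hq (m (s h))).elim, fun h => (hq (m' (s' h))).elim⟩
      · exact propext ⟨fun h => (hp (m h)).elim, fun h => (hp (m' h)).elim⟩
  subst this
  rfl

/-- The empty graph. -/
def emp : Obj := ⟨∅, fun _ _ => False, fun h => h.elim, fun h => h.elim, fun h => h⟩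

/-- Join. -/
def conj (x y : Obj) : Obj where
  V := x.V ∪ y.V
  E p q := x.E p q ∨ y.E p q ∨ (p ≠ q ∧ ((p ∈ x.V ∧ q ∈ y.V) ∨ (p ∈ y.V ∧ q ∈ x.V)))
  mem := by
    rintro p q (h | h | ⟨_, ⟨h, _⟩ | ⟨h, _⟩⟩)
    · exact Or.inl (x.mem h)
    · exact Or.inr (y.mem h)
    · exact Or.inl h
    · exact Or.inr h
  symm := by
    rintro p q (h | h | ⟨_, ⟨h, _⟩ | ⟨h, _⟩⟩)
    · exact Or.inl (x.symm h)
    · exact Or.inr (Or.inl (y.symm h))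
    · exact Or.inr (Or.inr (by tauto))
    · exact Or.inr (Or.inr (by tauto))
  irr := by
    rintro p (h | h | ⟨h, _⟩)
    · exact x.irr h
    · exact y.irr h
    · exact h rfl

/-- Disjoint union. -/
def disj (x y : Obj) : Obj where
  V := x.V ∪ y.V
  E p q := x.E p q ∨ y.E p q
  mem := by
    rintro p q (h | h)
    · exact Or.inl (x.mem h)
    · exact Or.inr (y.mem h)
  symm := by
    rintro p q (h | h)
    · exact Or.inl (x.symm h)
    · exact Or.inr (y.symm h)
  irr := by
    rintro p (h | h)
    · exact x.irr h
    · exact y.irr h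

/-- Induced subgraph. -/
def r (x : Obj) (S : Set ℕ) : Obj where
  V := x.V ∩ S
  E p q := x.E p q ∧ p ∈ S ∧ q ∈ S
  mem h := ⟨x.mem h.1, h.2.1⟩
  symm h := ⟨x.symm h.1, h.2.2, h.2.1⟩
  irr h := x.irr h.1

/-- Complement graph. -/
def co (x : Obj) : Obj where
  V := x.V
  E p q := p ∈ x.V ∧ q ∈ x.V ∧ p ≠ q ∧ ¬ x.E p q
  mem h := h.1
  symm h := ⟨h.2.1, h.1, h.2.2.1.symm, fun k => h.2.2.2 (x.symm k)⟩
  irr h := h.2.2.1 rfl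

variable (x y z : Obj) (S : Set ℕ) (p q : ℕ)

@[simp] theorem emp_V : p ∈ emp.V ↔ False := Iff.rfl
@[simp] theorem emp_E : emp.E p q ↔ False := Iff.rfl
@[simp] theorem conj_V : p ∈ (x.conj y).V ↔ p ∈ x.V ∨ p ∈ y.V := Iff.rfl
@[simp] theorem disj_V : p ∈ (x.disj y).V ↔ p ∈ x.V ∨ p ∈ y.V := Iff.rfl
@[simp] theorem r_V : p ∈ (x.r S).V ↔ p ∈ x.V ∧ p ∈ S := Iff.rfl
@[simp] theorem co_V : p ∈ x.co.V ↔ p ∈ x.V := Iff.rfl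
@[simp] theorem co_V' : x.co.V = x.V := rfl
@[simp] theorem conj_E : (x.conj y).E p q ↔ x.E p q ∨ y.E p q ∨
    (p ≠ q ∧ ((p ∈ x.V ∧ q ∈ y.V) ∨ (p ∈ y.V ∧ q ∈ x.V))) := Iff.rfl
@[simp] theorem disj_E : (x.disj y).E p q ↔ x.E p q ∨ y.E p q := Iff.rfl
@[simp] theorem r_E : (x.r S).E p q ↔ x.E p q ∧ p ∈ S ∧ q ∈ S := Iff.rfl
@[simp] theorem co_E : x.co.E p q ↔ p ∈ x.V ∧ q ∈ x.V ∧ p ≠ q ∧ ¬ x.E p q := Iff.rfl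

theorem conj_comm : x.conj y = y.conj x := by
  apply ext' <;> simp <;> grind

theorem disj_comm : x.disj y = y.disj x := by
  apply ext' <;> simp <;> grind

theorem conj_assoc : (x.conj y).conj z = x.conj (y.conj z) := by
  apply ext' <;> simp <;> grind

theorem disj_assoc : (x.disj y).disj z = x.disj (y.disj z) := by
  apply ext' <;> simp <;> grind

@[simp] theorem conj_emp : x.conj emp = x := by
  apply ext' <;> simp
@[simp] theorem disj_emp : x.disj emp = x := by
  apply ext' <;> simp
@[simp] theorem emp_conj : emp.conj x = x := by
  apply ext' <;> simp
@[simp] theorem emp_disj : emp.disj x = x := by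
  apply ext' <;> simp

@[simp] theorem co_co : x.co.co = x := by
  apply ext' <;> simp <;> grind
@[simp] theorem co_emp : emp.co = emp := by
  apply ext' <;> simp
theorem co_r : (x.r S).co = x.co.r S := by
  apply ext' <;> simp <;> grind

theorem co_inj {x y : Obj} (h : x.co = y.co) : x = y := by
  rw [← co_co x, h, co_co]

/-- Disjointness. -/
def dj (x y : Obj) : Prop := ∀ p, p ∈ x.V → p ∈ y.V → False

variable {x y z}

theorem dj.symm (h : dj x y) : dj y x := fun p a b => h p b a

theorem dj_conj_left : dj (x.conj y) z ↔ dj x z ∧ dj y z := by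
  simp only [dj, conj_V]; grind
theorem dj_disj_left : dj (x.disj y) z ↔ dj x z ∧ dj y z := by
  simp only [dj, disj_V]; grind
theorem dj_conj_right : dj z (x.conj y) ↔ dj z x ∧ dj z y := by
  simp only [dj, conj_V]; grind
theorem dj_disj_right : dj z (x.disj y) ↔ dj z x ∧ dj z y := by
  simp only [dj, disj_V]; grind

theorem co_conj (h : dj x y) : (x.conj y).co = x.co.disj y.co := by
  have h1 := @x.mem
  have h2 := @x.mem'
  have h3 := @y.mem
  have h4 := @y.mem'
  have h5 : ∀ p, p ∈ x.V → p ∈ y.V → False := h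
  apply ext' <;> simp <;> grind

theorem co_disj (h : dj x y) : (x.disj y).co = x.co.conj y.co := by
  have h1 := @x.mem
  have h2 := @x.mem'
  have h3 := @y.mem
  have h4 := @y.mem'
  have h5 : ∀ p, p ∈ x.V → p ∈ y.V → False := h
  apply ext' <;> simp <;> grind

theorem r_conj : (x.conj y).r S = (x.r S).conj (y.r S) := by
  apply ext' <;> simp <;> grind
theorem r_disj : (x.disj y).r S = (x.r S).disj (y.r S) := by
  apply ext' <;> simp <;> grind
theorem r_r (T : Set ℕ) : (x.r S).r T = x.r (S ∩ T) := by
  apply ext' <;> simp <;> grind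
theorem emp_r : emp.r S = emp := by
  apply ext' <;> simp

theorem r_congr {S T : Set ℕ} (h : ∀ p ∈ x.V, p ∈ S ↔ p ∈ T) : x.r S = x.r T := by
  apply ext' <;> simp <;> grind

theorem r_self {S : Set ℕ} (h : ∀ p ∈ x.V, p ∈ S) : x.r S = x := by
  apply ext' <;> simp <;> grind

theorem r_none {S : Set ℕ} (h : ∀ p ∈ x.V, p ∉ S) : x.r S = emp := by
  apply ext' <;> simp <;> grind

theorem eq_emp (h : ∀ p, p ∉ x.V) : x = emp := by
  apply ext' <;> simp <;> grind

/-- Cographs. -/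
inductive Cog : Obj → Prop
  | emp : Cog emp
  | single (x : Obj) (p : ℕ) (h : x.V = {p}) : Cog x
  | conj {x y : Obj} : Cog x → Cog y → dj x y → Cog (x.conj y)
  | disj {x y : Obj} : Cog x → Cog y → dj x y → Cog (x.disj y)

theorem Cog.co {x : Obj} (h : Cog x) : Cog x.co := by
  induction h with
  | emp => rw [co_emp]; exact Cog.emp
  | single x p h => exact Cog.single _ p h
  | conj _ _ d h1 h2 => rw [co_conj d]; exact Cog.disj h1 h2 d
  | disj _ _ d h1 h2 => rw [co_disj d]; exact Cog.conj h1 h2 d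

theorem dj.r {x y : Obj} (h : dj x y) (S T : Set ℕ) : dj (x.r S) (y.r T) :=
  fun p a b => h p a.1 b.1

theorem Cog.r {x : Obj} (h : Cog x) (S : Set ℕ) : Cog (x.r S) := by
  induction h with
  | emp => rw [emp_r]; exact Cog.emp
  | single x p h =>
    by_cases hp : p ∈ S
    · refine Cog.single _ p ?_
      change x.V ∩ S = _
      rw [h]; ext; simp; grind
    · rw [r_none]
      · exact Cog.emp
      · rw [h]; simpa using hp
  | conj _ _ d h1 h2 => rw [r_conj]; exact Cog.conj h1 h2 (d.r _ _)
  | disj _ _ d h1 h2 => rw [r_disj]; exact Cog.disj h1 h2 (d.r _ _)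

theorem Cog.fin {x : Obj} (h : Cog x) : x.V.Finite := by
  induction h with
  | emp => exact Set.finite_empty
  | single x p h => rw [h]; exact Set.finite_singleton _
  | conj _ _ d h1 h2 => exact h1.union h2
  | disj _ _ d h1 h2 => exact h1.union h2

/-- All pairs across `S` are edges. -/
def flC (x : Obj) (S : Set ℕ) : Prop := ∀ p ∈ x.V, ∀ q ∈ x.V, p ∈ S → q ∉ S → x.E p q

/-- No pairs across `S` are edges. -/
def flD (x : Obj) (S : Set ℕ) : Prop := ∀ p ∈ x.V, ∀ q ∈ x.V, p ∈ S → q ∉ S → ¬ x.E p q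

theorem flC_co : x.co.flC S ↔ x.flD S := by
  simp only [flC, flD, co_V, co_E]; grind
theorem flD_co : x.co.flD S ↔ x.flC S := by
  simp only [flC, flD, co_V, co_E]; grind

theorem flC.eq {S : Set ℕ} (h : x.flC S) : (x.r S).conj (x.r Sᶜ) = x := by
  unfold flC at h
  have := @x.symm
  apply ext' <;> simp <;> grind

theorem flD.eq {S : Set ℕ} (h : x.flD S) : (x.r S).disj (x.r Sᶜ) = x := by
  unfold flD at h
  have := @x.symm
  apply ext' <;> simp <;> grind

theorem dj_r (x : Obj) (S : Set ℕ) : dj (x.r S) (x.r Sᶜ) := fun _ a b => b.2 a.2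

theorem Cog.split {x : Obj} (h : Cog x) {p q : ℕ} (hp : p ∈ x.V) (hq : q ∈ x.V) (hpq : p ≠ q) :
    ∃ S : Set ℕ, (∃ p ∈ x.V, p ∈ S) ∧ (∃ p ∈ x.V, p ∉ S) ∧ (x.flC S ∨ x.flD S) := by
  induction h generalizing p q with
  | emp => exact hp.elim
  | single x u h => rw [h] at hp hq; simp at hp hq; omega
  | @conj x y _ _ d h1 h2 =>
    by_cases hx : ∃ u, u ∈ x.V
    · by_cases hy : ∃ u, u ∈ y.V
      · obtain ⟨u, hu⟩ := hx
        obtain ⟨v, hv⟩ := hy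
        refine ⟨x.V, ⟨u, Or.inl hu, hu⟩, ⟨v, Or.inr hv, fun h => d _ h hv⟩, Or.inl ?_⟩
        intro p hp q hq h1 h2
        simp at hp hq ⊢
        grind
      · have : y = .emp := eq_emp (by grind)
        subst this
        rw [conj_emp] at *
        exact h1 hp hq hpq
    · have : x = .emp := eq_emp (by grind)
      subst this
      rw [emp_conj] at *
      exact h2 hp hq hpq
  | @disj x y _ _ d h1 h2 =>
    by_cases hx : ∃ u, u ∈ x.V
    · by_cases hy : ∃ u, u ∈ y.V
      · obtain ⟨u, hu⟩ := hx
        obtain ⟨v, hv⟩ := hy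
        refine ⟨x.V, ⟨u, Or.inl hu, hu⟩, ⟨v, Or.inr hv, fun h => d _ h hv⟩, Or.inr ?_⟩
        intro p hp q hq h1 h2
        have := @x.mem'
        have := @y.mem
        have := d p
        simp at hp hq ⊢
        grind
      · have : y = .emp := eq_emp (by grind)
        subst this
        rw [disj_emp] at *
        exact h1 hp hq hpq
    · have : x = .emp := eq_emp (by grind)
      subst this
      rw [emp_disj] at *
      exact h2 hp hq hpq

end Obj
end DSC

namespace DSC
open Obj

/-! ### Part 4: abstract nets -/

/-- Data of a net. -/
structure NData where
  Q : Type
  bot : Q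
  src : Q → Obj
  tgt : Q → Obj
  id : Obj → Q
  comp : Q → Q → Q
  conj : Q → Q → Q
  disj : Q → Q → Q
  d : Obj → Obj → Obj → Q

/-- Typing of arrows. -/
def NData.T (N : NData) (f : N.Q) (x y : Obj) : Prop := f ≠ N.bot ∧ N.src f = x ∧ N.tgt f = y

/-- Admissible arguments of `d`. -/
structure Ok3 (x y z : Obj) : Prop where
  c1 : Cog x
  c2 : Cog y
  c3 : Cog z
  h12 : dj x y
  h13 : dj x z
  h23 : dj y z

structure Ok4 (x y z w : Obj) : Prop where
  c1 : Cog x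
  c2 : Cog y
  c3 : Cog z
  c4 : Cog w
  h12 : dj x y
  h13 : dj x z
  h14 : dj x w
  h23 : dj y z
  h24 : dj y w
  h34 : dj z w

theorem Ok3.rev {x y z : Obj} (h : Ok3 x y z) : Ok3 z y x :=
  ⟨h.c3, h.c2, h.c1, h.h23.symm, h.h13.symm, h.h12.symm⟩
theorem Ok3.co {x y z : Obj} (h : Ok3 x y z) : Ok3 x.co y.co z.co :=
  ⟨h.c1.co, h.c2.co, h.c3.co, h.h12, h.h13, h.h23⟩
theorem Ok4.rev {x y z w : Obj} (h : Ok4 x y z w) : Ok4 w z y x :=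
  ⟨h.c4, h.c3, h.c2, h.c1, h.h34.symm, h.h24.symm, h.h14.symm, h.h23.symm, h.h13.symm,
    h.h12.symm⟩
theorem Ok4.co {x y z w : Obj} (h : Ok4 x y z w) : Ok4 x.co y.co z.co w.co :=
  ⟨h.c1.co, h.c2.co, h.c3.co, h.c4.co, h.h12, h.h13, h.h14, h.h23, h.h24, h.h34⟩

/-- Abstract nets. -/
structure Net extends NData where
  id_T : ∀ {x}, Cog x → toNData.T (id x) x x
  comp_T : ∀ {g f x y z}, toNData.T g y z → toNData.T f x y → toNData.T (comp g f) x z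
  conj_T : ∀ {f g x y z w}, toNData.T f x y → toNData.T g z w → dj x z →
    toNData.T (conj f g) (x.conj z) (y.conj w)
  disj_T : ∀ {f g x y z w}, toNData.T f x y → toNData.T g z w → dj x z →
    toNData.T (disj f g) (x.disj z) (y.disj w)
  d_T : ∀ {x y z}, Ok3 x y z → (∃ p, p ∈ y.V) →
    toNData.T (d x y z) (x.conj (y.disj z)) ((x.conj y).disj z)
  V_T : ∀ {f x y}, toNData.T f x y → x.V = y.V
  src_T : ∀ {f x y}, toNData.T f x y → Cog x
  tgt_T : ∀ {f x y}, toNData.T f x y → Cog y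
  id_comp : ∀ {f x y}, toNData.T f x y → comp (id y) f = f
  comp_id : ∀ {f x y}, toNData.T f x y → comp f (id x) = f
  assoc : ∀ h g f, comp h (comp g f) = comp (comp h g) f
  conj_comm : ∀ f g, conj f g = conj g f
  disj_comm : ∀ f g, disj f g = disj g f
  conj_assoc : ∀ f g h, conj (conj f g) h = conj f (conj g h)
  disj_assoc : ∀ f g h, disj (disj f g) h = disj f (disj g h)
  conj_unit : ∀ f, conj f (id emp) = f
  disj_unit : ∀ f, disj f (id emp) = f
  conj_id : ∀ {x y}, Cog x → Cog y → dj x y → conj (id x) (id y) = id (x.conj y)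
  disj_id : ∀ {x y}, Cog x → Cog y → dj x y → disj (id x) (id y) = id (x.disj y)
  conj_comp : ∀ {g₁ f₁ g₂ f₂}, src g₁ = tgt f₁ → src g₂ = tgt f₂ →
    comp (conj g₁ g₂) (conj f₁ f₂) = conj (comp g₁ f₁) (comp g₂ f₂)
  disj_comp : ∀ {g₁ f₁ g₂ f₂}, src g₁ = tgt f₁ → src g₂ = tgt f₂ →
    comp (disj g₁ g₂) (disj f₁ f₂) = disj (comp g₁ f₁) (comp g₂ f₂)
  d_nat : ∀ {f g h x y z x' y' z'}, toNData.T f x x' → toNData.T g y y' → toNData.T h z z' →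
    comp (disj (conj f g) h) (d x y z) = comp (d x' y' z') (conj f (disj g h))
  d_emp_l : ∀ {y z}, Cog y → Cog z → dj y z → (∃ p, p ∈ y.V) → d emp y z = id (y.disj z)
  d_emp_r : ∀ {y z}, Cog y → Cog z → dj y z → (∃ p, p ∈ z.V) → d y z emp = id (y.conj z)
  dConj : ∀ {x x' y z}, Ok4 x x' y z → (∃ p, p ∈ y.V) →
    d (x.conj x') y z = comp (d x (x'.conj y) z) (conj (id x) (d x' y z))
  dDisj : ∀ {x y z z'}, Ok4 x y z z' → (∃ p, p ∈ y.V) →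
    d x y (z.disj z') = comp (disj (d x y z) (id z')) (d x (y.disj z) z')
  dBConj : ∀ {a b c e}, Ok4 a b c e → (∃ p, p ∈ b.V) → (∃ p, p ∈ c.V) →
    comp (d e c (a.conj b)) (conj (d a b c) (id e)) =
      comp (d a b (c.conj e)) (conj (id a) (d e c b))
  dBDisj : ∀ {a b c e}, Ok4 a b c e → (∃ p, p ∈ b.V) → (∃ p, p ∈ c.V) →
    comp (disj (id e) (d c b a)) (d (b.disj a) c e) =
      comp (disj (d b c e) (id a)) (d (e.disj c) b a)
  gen : ∀ (M : Q → Prop), (∀ x, Cog x → M (id x)) →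
    (∀ x y z, Ok3 x y z → (∃ p, p ∈ y.V) → M (d x y z)) →
    (∀ g f x y z, toNData.T g y z → toNData.T f x y → M g → M f → M (comp g f)) →
    (∀ f g x y z w, toNData.T f x y → toNData.T g z w → dj x z → M f → M g → M (conj f g)) →
    (∀ f g x y z w, toNData.T f x y → toNData.T g z w → dj x z → M f → M g → M (disj f g)) →
    ∀ f x y, toNData.T f x y → M f

namespace Net
variable {N : Net}

/-- Data of the opposite net. -/
def opD (N : Net) : NData where
  Q := N.Q
  bot := N.bot
  src f := (N.tgt f).co
  tgt f := (N.src f).co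
  id x := N.id x.co
  comp g f := N.comp f g
  conj f g := N.disj f g
  disj f g := N.conj f g
  d x y z := N.d z.co y.co x.co

theorem opT {f : N.Q} {x y : Obj} : N.opD.T f x y ↔ N.T f y.co x.co := by
  simp only [NData.T, opD]
  constructor
  · rintro ⟨h, rfl, rfl⟩
    simp [h]
  · rintro ⟨h, h1, h2⟩
    rw [h1, h2]
    simp [h]

theorem dj.co {x y : Obj} (h : dj x y) : dj x.co y.co := h

theorem dj_co {x y : Obj} : dj x.co y.co ↔ dj x y := Iff.rfl

theorem op_nat {f g h : N.Q} {x y z x' y' z' : Obj} (hf : N.T f x x') (hg : N.T g y y')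
    (hh : N.T h z z') :
    N.comp (N.d z' y' x') (N.conj (N.disj f g) h) =
      N.comp (N.disj f (N.conj g h)) (N.d z y x) := by
  have := N.d_nat hh hg hf
  rw [N.disj_comm f (N.conj g h), N.conj_comm g, this, N.conj_comm, N.disj_comm f]

/-- The opposite net. -/
def op (N : Net) : Net where
  toNData := N.opD
  id_T h := opT.2 (N.id_T h.co)
  comp_T hg hf := opT.2 (N.comp_T (opT.1 hf) (opT.1 hg))
  conj_T {f g x y z w} hf hg h := by
    replace hf := opT.1 hf
    replace hg := opT.1 hg
    refine opT.2 ?_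
    have h' : dj y w := fun p a b => h p (by have := N.V_T hf; simp at this; grind)
      (by have := N.V_T hg; simp at this; grind)
    rw [co_conj h, co_conj h']
    exact N.disj_T hf hg h'
  disj_T {f g x y z w} hf hg h := by
    replace hf := opT.1 hf
    replace hg := opT.1 hg
    refine opT.2 ?_
    have h' : dj y w := fun p a b => h p (by have := N.V_T hf; simp at this; grind)
      (by have := N.V_T hg; simp at this; grind)
    rw [co_disj h, co_disj h']
    exact N.conj_T hf hg h'
  d_T {x y z} h hy := by
    refine opT.2 ?_
    have e1 : ((x.conj y).disj z).co = z.co.conj (y.co.disj x.co) := by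
      rw [co_disj (dj_conj_left.2 ⟨h.h13, h.h23⟩), co_conj h.h12, Obj.conj_comm,
        Obj.disj_comm x.co]
    have e2 : (x.conj (y.disj z)).co = (z.co.conj y.co).disj x.co := by
      rw [co_conj (dj_disj_right.2 ⟨h.h12, h.h13⟩), co_disj h.h23, Obj.disj_comm,
        Obj.conj_comm y.co]
    rw [e1, e2]
    exact N.d_T h.rev.co hy
  V_T h := (N.V_T (opT.1 h)).symm
  src_T h := by have := (N.tgt_T (opT.1 h)).co; rwa [co_co] at this
  tgt_T h := by have := (N.src_T (opT.1 h)).co; rwa [co_co] at this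
  id_comp h := N.comp_id (opT.1 h)
  comp_id h := N.id_comp (opT.1 h)
  assoc h g f := (N.assoc f g h).symm
  conj_comm := N.disj_comm
  disj_comm := N.conj_comm
  conj_assoc := N.disj_assoc
  disj_assoc := N.conj_assoc
  conj_unit f := by
    change N.disj f (N.id emp.co) = f
    rw [co_emp]; exact N.disj_unit f
  disj_unit f := by
    change N.conj f (N.id emp.co) = f
    rw [co_emp]; exact N.conj_unit f
  conj_id hx hy h := by
    change N.disj (N.id _) (N.id _) = N.id _
    rw [co_conj h]
    exact N.disj_id hx.co hy.co h
  disj_id hx hy h := by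
    change N.conj (N.id _) (N.id _) = N.id _
    rw [co_disj h]
    exact N.conj_id hx.co hy.co h
  conj_comp h1 h2 := N.disj_comp (co_inj h1).symm (co_inj h2).symm
  disj_comp h1 h2 := N.conj_comp (co_inj h1).symm (co_inj h2).symm
  d_nat {f g h x y z x' y' z'} hf hg hh := by
    exact op_nat (opT.1 hf) (opT.1 hg) (opT.1 hh)
  d_emp_l {y z} hy hz h k := by
    change N.d _ _ _ = N.id _
    rw [co_emp, co_disj h, Obj.conj_comm]
    exact N.d_emp_r hz.co hy.co h.symm k
  d_emp_r {y z} hy hz h k := by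
    change N.d _ _ _ = N.id _
    rw [co_emp, co_conj h, Obj.disj_comm]
    exact N.d_emp_l hz.co hy.co h.symm k
  dConj {x x' y z} h k := by
    change N.d _ _ _ = N.comp (N.disj (N.id _) (N.d _ _ _)) (N.d _ _ _)
    rw [co_conj h.h12, co_conj h.h23, N.disj_comm, Obj.disj_comm x'.co, Obj.disj_comm x.co]
    exact N.dDisj ⟨h.c4.co, h.c3.co, h.c2.co, h.c1.co, h.h34.symm, h.h24.symm, h.h14.symm,
      h.h23.symm, h.h13.symm, h.h12.symm⟩ k
  dDisj {x y z z'} h k := by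
    change N.d _ _ _ = N.comp (N.d _ _ _) (N.conj (N.d _ _ _) (N.id _))
    rw [co_disj h.h34, co_disj h.h23, N.conj_comm, Obj.conj_comm y.co, Obj.conj_comm z.co]
    exact N.dConj ⟨h.c4.co, h.c3.co, h.c2.co, h.c1.co, h.h34.symm, h.h24.symm, h.h14.symm,
      h.h23.symm, h.h13.symm, h.h12.symm⟩ k
  dBConj {a b c e} h hb hc := by
    change N.comp (N.disj (N.d _ _ _) (N.id _)) (N.d _ _ _) =
      N.comp (N.disj (N.id _) (N.d _ _ _)) (N.d _ _ _)
    rw [co_conj h.h12, co_conj h.h34, Obj.disj_comm c.co]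
    have := N.dBDisj (a := e.co) (b := c.co) (c := b.co) (e := a.co) h.rev.co hc hb
    rw [Obj.disj_comm c.co] at this
    exact this.symm
  dBDisj {a b c e} h hb hc := by
    change N.comp (N.d _ _ _) (N.conj (N.id _) (N.d _ _ _)) =
      N.comp (N.d _ _ _) (N.conj (N.d _ _ _) (N.id _))
    rw [co_disj h.h12.symm, co_disj h.h34.symm]
    have := N.dBConj (a := e.co) (b := c.co) (c := b.co) (e := a.co) h.rev.co hc hb
    rw [this.symm]
  gen M h1 h2 h3 h4 h5 f x y hf := by
    refine N.gen M ?_ ?_ ?_ ?_ ?_ f _ _ (opT.1 hf)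
    · intro x hx
      have := h1 x.co hx.co
      simpa [opD] using this
    · intro x y z h k
      have := h2 z.co y.co x.co h.rev.co k
      simpa [opD] using this
    · intro g f x y z hg hf mg mf
      exact h3 f g z.co y.co x.co (opT.2 (by simpa using hf)) (opT.2 (by simpa using hg)) mf mg
    · intro f g x y z w hf hg h mf mg
      refine h5 f g y.co x.co w.co z.co (opT.2 (by simpa using hf)) (opT.2 (by simpa using hg))
        ?_ mf mg
      have h1 := N.V_T hf
      have h2 := N.V_T hg
      intro p; simp [← h1, ← h2]; exact h p
    · intro f g x y z w hf hg h mf mg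
      refine h4 f g y.co x.co w.co z.co (opT.2 (by simpa using hf)) (opT.2 (by simpa using hg))
        ?_ mf mg
      have h1 := N.V_T hf
      have h2 := N.V_T hg
      intro p; simp [← h1, ← h2]; exact h p

theorem op_op_T {f : N.Q} {x y : Obj} : N.op.T f y.co x.co ↔ N.T f x y := by
  have := @opT N f y.co x.co
  simp only [co_co] at this
  exact this

end Net
end DSC

namespace DSC
open Obj
namespace Net
variable {N : Net}

/-! ### Part 5: abstract theory -/

theorem T_uniq {f : N.Q} {x y x' y' : Obj} (h : N.T f x y) (h' : N.T f x' y') :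
    x = x' ∧ y = y' :=
  ⟨h.2.1.symm.trans h'.2.1, h.2.2.symm.trans h'.2.2⟩

theorem gen' (M : N.Q → Obj → Obj → Prop) (hid : ∀ x, Cog x → M (N.id x) x x)
    (hd : ∀ x y z, Ok3 x y z → (∃ p, p ∈ y.V) →
      M (N.d x y z) (x.conj (y.disj z)) ((x.conj y).disj z))
    (hcomp : ∀ g f x y z, N.T g y z → N.T f x y → M g y z → M f x y → M (N.comp g f) x z)
    (hconj : ∀ f g x y z w, N.T f x y → N.T g z w → dj x z → dj y w → M f x y → M g z w →
      M (N.conj f g) (x.conj z) (y.conj w))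
    (hdisj : ∀ f g x y z w, N.T f x y → N.T g z w → dj x z → dj y w → M f x y → M g z w →
      M (N.disj f g) (x.disj z) (y.disj w))
    {f : N.Q} {x y : Obj} (hf : N.T f x y) : M f x y := by
  refine N.gen (fun f => ∀ x y, N.T f x y → M f x y) ?_ ?_ ?_ ?_ ?_ f x y hf x y hf
  · intro x hx x' y' h
    obtain ⟨rfl, rfl⟩ := T_uniq (N.id_T hx) h
    exact hid _ hx
  · intro x y z hx hy x' y' h
    obtain ⟨rfl, rfl⟩ := T_uniq (N.d_T hx hy) h
    exact hd _ _ _ hx hy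
  · intro g f x y z hg hf mg mf x' y' h
    obtain ⟨rfl, rfl⟩ := T_uniq (N.comp_T hg hf) h
    exact hcomp _ _ _ _ _ hg hf (mg _ _ hg) (mf _ _ hf)
  · intro f g x y z w hf hg hh mf mg x' y' h
    obtain ⟨rfl, rfl⟩ := T_uniq (N.conj_T hf hg hh) h
    refine hconj _ _ _ _ _ _ hf hg hh ?_ (mf _ _ hf) (mg _ _ hg)
    intro p; rw [← N.V_T hf, ← N.V_T hg]; exact hh p
  · intro f g x y z w hf hg hh mf mg x' y' h
    obtain ⟨rfl, rfl⟩ := T_uniq (N.disj_T hf hg hh) h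
    refine hdisj _ _ _ _ _ _ hf hg hh ?_ (mf _ _ hf) (mg _ _ hg)
    intro p; rw [← N.V_T hf, ← N.V_T hg]; exact hh p

theorem conj_unit' (f : N.Q) : N.conj (N.id emp) f = f := by
  rw [N.conj_comm, N.conj_unit]
theorem disj_unit' (f : N.Q) : N.disj (N.id emp) f = f := by
  rw [N.disj_comm, N.disj_unit]

/-- Interchange with typing. -/
theorem conj_comp' {g₁ f₁ g₂ f₂ : N.Q} {x y z x' y' z' : Obj} (h1 : N.T g₁ y z) (h2 : N.T f₁ x y)
    (h3 : N.T g₂ y' z') (h4 : N.T f₂ x' y') :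
    N.comp (N.conj g₁ g₂) (N.conj f₁ f₂) = N.conj (N.comp g₁ f₁) (N.comp g₂ f₂) :=
  N.conj_comp (h1.2.1.trans h2.2.2.symm) (h3.2.1.trans h4.2.2.symm)

theorem disj_comp' {g₁ f₁ g₂ f₂ : N.Q} {x y z x' y' z' : Obj} (h1 : N.T g₁ y z) (h2 : N.T f₁ x y)
    (h3 : N.T g₂ y' z') (h4 : N.T f₂ x' y') :
    N.comp (N.disj g₁ g₂) (N.disj f₁ f₂) = N.disj (N.comp g₁ f₁) (N.comp g₂ f₂) :=
  N.disj_comp (h1.2.1.trans h2.2.2.symm) (h3.2.1.trans h4.2.2.symm)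

/-- Arrows between graphs with at most one vertex. -/
theorem small {f : N.Q} {a b : Obj} (h : N.T f a b) (hs : ∀ p ∈ a.V, ∀ q ∈ a.V, p = q) :
    a = b ∧ f = N.id a := by
  revert hs
  refine gen' (fun f a b => (∀ p ∈ a.V, ∀ q ∈ a.V, p = q) → a = b ∧ f = N.id a)
    ?_ ?_ ?_ ?_ ?_ h
  · intro x _ _
    exact ⟨rfl, rfl⟩
  · intro x y z ok ⟨p, hp⟩ hs
    have h12 := ok.h12
    have h23 := ok.h23
    have e1 : x = emp := eq_emp (by
      intro q hq
      have := hs p (by simp [hp]) q (by simp [hq])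
      subst this
      exact h12 _ hq hp)
    have e2 : z = emp := eq_emp (by
      intro q hq
      have := hs p (by simp [hp]) q (by simp [hq])
      subst this
      exact h23 _ hp hq)
    subst e1 e2
    refine ⟨by simp, ?_⟩
    rw [N.d_emp_l ok.c2 ok.c3 ok.h23 ⟨p, hp⟩]
    simp
  · intro g f x y z hg hf mg mf hs
    obtain ⟨rfl, rfl⟩ := mf hs
    obtain ⟨rfl, rfl⟩ := mg hs
    exact ⟨rfl, N.id_comp hf⟩
  · intro f g x y z w hf hg dd _ mf mg hs
    obtain ⟨rfl, rfl⟩ := mf (fun p hp q hq => hs p (Or.inl hp) q (Or.inl hq))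
    obtain ⟨rfl, rfl⟩ := mg (fun p hp q hq => hs p (Or.inr hp) q (Or.inr hq))
    exact ⟨rfl, N.conj_id (N.src_T hf) (N.src_T hg) dd⟩
  · intro f g x y z w hf hg dd _ mf mg hs
    obtain ⟨rfl, rfl⟩ := mf (fun p hp q hq => hs p (Or.inl hp) q (Or.inl hq))
    obtain ⟨rfl, rfl⟩ := mg (fun p hp q hq => hs p (Or.inr hp) q (Or.inr hq))
    exact ⟨rfl, N.disj_id (N.src_T hf) (N.src_T hg) dd⟩

/-- The conclusion of conjunctive splitting. -/
def SplC (N : Net) (f : N.Q) (a b : Obj) (S : Set ℕ) : Prop :=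
  a.flC S ∧ ∃ f1 f2, N.T f1 (a.r S) (b.r S) ∧ N.T f2 (a.r Sᶜ) (b.r Sᶜ) ∧ f = N.conj f1 f2

theorem spl_triv {f : N.Q} {a b : Obj} (h : N.T f a b) {S : Set ℕ}
    (hS : (∀ p ∈ b.V, p ∈ S) ∨ (∀ p ∈ b.V, p ∉ S)) : SplC N f a b S := by
  have hV := N.V_T h
  rcases hS with hS | hS
  · have e1 : a.r S = a := r_self (by rwa [hV])
    have e2 : b.r S = b := r_self hS
    have e3 : a.r Sᶜ = emp := r_none (by rw [hV]; simpa using hS)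
    have e4 : b.r Sᶜ = emp := r_none (by simpa using hS)
    refine ⟨fun p hp q hq h1 h2 => (h2 (hS q (hV ▸ hq))).elim, f, N.id emp, ?_, ?_, ?_⟩
    · rwa [e1, e2]
    · rw [e3, e4]; exact N.id_T Cog.emp
    · rw [N.conj_unit]
  · have e1 : a.r Sᶜ = a := r_self (by rwa [hV])
    have e2 : b.r Sᶜ = b := r_self hS
    have e3 : a.r S = emp := r_none (by rwa [hV])
    have e4 : b.r S = emp := r_none hS
    refine ⟨fun p hp q hq h1 h2 => (hS p (hV ▸ hp) h1).elim, N.id emp, f, ?_, ?_, ?_⟩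
    · rw [e3, e4]; exact N.id_T Cog.emp
    · rwa [e1, e2]
    · rw [conj_unit']

theorem flat_disj {x y : Obj} {S : Set ℕ} (hd : dj x y) (h : (x.disj y).flC S) :
    ((∀ p ∈ (x.disj y).V, p ∈ S) ∨ (∀ p ∈ (x.disj y).V, p ∉ S)) ∨ x = emp ∨ y = emp := by
  by_contra hc
  simp only [not_or] at hc
  obtain ⟨⟨h1, h2⟩, h3, h4⟩ := hc
  have h3' : ∃ p, p ∈ x.V := by
    by_contra hh; exact h3 (eq_emp (by grind))
  have h4' : ∃ p, p ∈ y.V := by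
    by_contra hh; exact h4 (eq_emp (by grind))
  obtain ⟨p, hp⟩ := h3'
  obtain ⟨q, hq⟩ := h4'
  have key : ∀ u ∈ x.V, ∀ v ∈ y.V, u ∈ S ↔ v ∈ S := by
    intro u hu v hv
    have a1 := h u (Or.inl hu) v (Or.inr hv)
    have a2 := h v (Or.inr hv) u (Or.inl hu)
    have b1 := @x.mem' u v
    have b2 := @y.mem u v
    have b3 := @x.mem v u
    have b4 := @y.mem' v u
    have c1 := hd u hu
    have c2 := hd v
    simp only [disj_E] at a1 a2
    grind
  simp only [disj_V] at h1 h2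
  grind

theorem eC {f : N.Q} {a b : Obj} (h : N.T f a b) {S : Set ℕ} (hb : b.flC S) : SplC N f a b S := by
  revert S
  refine gen' (fun f a b => ∀ {S : Set ℕ}, b.flC S → SplC N f a b S) ?_ ?_ ?_ ?_ ?_ h
  · intro x hx S hS
    refine ⟨hS, N.id _, N.id _, N.id_T (hx.r _), N.id_T (hx.r _), ?_⟩
    rw [N.conj_id (hx.r _) (hx.r _) (dj_r _ _), hS.eq]
  · intro x y z ok hy S hS
    rcases flat_disj (dj_conj_left.2 ⟨ok.h13, ok.h23⟩) hS with h | h | h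
    · exact spl_triv (N.d_T ok hy) h
    · obtain ⟨p, hp⟩ := hy
      have : p ∈ (x.conj y).V := Or.inr hp
      rw [h] at this
      exact this.elim
    · subst h
      rw [N.d_emp_r ok.c1 ok.c2 ok.h12 hy]
      simp only [disj_emp] at hS ⊢
      have hx := ok.c1.conj ok.c2 ok.h12
      refine ⟨hS, N.id _, N.id _, N.id_T (hx.r _), N.id_T (hx.r _), ?_⟩
      rw [N.conj_id (hx.r _) (hx.r _) (dj_r _ _), hS.eq]
  · intro g f x y z hg hf mg mf S hS
    obtain ⟨k1, g1, g2, t1, t2, rfl⟩ := mg hS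
    obtain ⟨k2, f1, f2, s1, s2, rfl⟩ := mf k1
    exact ⟨k2, _, _, N.comp_T t1 s1, N.comp_T t2 s2, conj_comp' t1 s1 t2 s2⟩
  · intro f g x y z w hf hg dd dd' mf mg S hS
    have d1 : ∀ p ∈ y.V, p ∈ w.V → False := dd'
    have hy : y.flC S := by
      intro p hp q hq h1 h2
      have := hS p (Or.inl hp) q (Or.inl hq) h1 h2
      have b := @w.mem p q
      simp only [conj_E] at this
      grind
    have hw : w.flC S := by
      intro p hp q hq h1 h2
      have := hS p (Or.inr hp) q (Or.inr hq) h1 h2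
      have b := @y.mem p q
      simp only [conj_E] at this
      grind
    obtain ⟨k1, f1, f2, t1, t2, rfl⟩ := mf hy
    obtain ⟨k2, g1, g2, s1, s2, rfl⟩ := mg hw
    refine ⟨?_, N.conj f1 g1, N.conj f2 g2, ?_, ?_, ?_⟩
    · intro p hp q hq h1 h2
      unfold flC at k1 k2
      simp at hp hq ⊢
      grind
    · rw [r_conj, r_conj]; exact N.conj_T t1 s1 (dd.r _ _)
    · rw [r_conj, r_conj]; exact N.conj_T t2 s2 (dd.r _ _)
    · rw [N.conj_assoc, N.conj_assoc, ← N.conj_assoc f2, N.conj_comm f2, N.conj_assoc]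
  · intro f g x y z w hf hg dd dd' mf mg S hS
    rcases flat_disj dd' hS with h | h | h
    · exact spl_triv (N.disj_T hf hg dd) h
    · subst h
      have hx : x = emp := eq_emp (by rw [N.V_T hf]; intro p hp; exact hp)
      subst hx
      obtain ⟨_, rfl⟩ := small hf (fun p hp => hp.elim)
      rw [disj_unit']
      simp only [emp_disj] at hS ⊢
      exact mg hS
    · subst h
      have hx : z = emp := eq_emp (by rw [N.V_T hg]; intro p hp; exact hp)
      subst hx
      obtain ⟨_, rfl⟩ := small hg (fun p hp => hp.elim)
      rw [N.disj_unit]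
      simp only [disj_emp] at hS ⊢
      exact mf hS

theorem eD {f : N.Q} {a b : Obj} (h : N.T f a b) {S : Set ℕ} (ha : a.flD S) :
    b.flD S ∧ ∃ f1 f2, N.T f1 (a.r S) (b.r S) ∧ N.T f2 (a.r Sᶜ) (b.r Sᶜ) ∧ f = N.disj f1 f2 := by
  have := eC (N := N.op) (op_op_T.2 h) ((flC_co S).2 ha)
  obtain ⟨h1, f1, f2, h2, h3, h4⟩ := this
  refine ⟨(flC_co S).1 h1, f1, f2, ?_, ?_, h4⟩
  · rw [← co_r, ← co_r] at h2
    exact op_op_T.1 h2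
  · rw [← co_r, ← co_r] at h3
    exact op_op_T.1 h3

end Net
end DSC

namespace DSC
open Obj
namespace Net
variable {N : Net}

theorem Ok3.mk' {x y z : Obj} (c1 : Cog x) (c2 : Cog y) (c3 : Cog z)
    (h12 : dj x y) (h13 : dj x z) (h23 : dj y z) : Ok3 x y z := ⟨c1, c2, c3, h12, h13, h23⟩

/-- Pairwise disjoint cographs. -/
def OkL (l : List Obj) : Prop := l.Pairwise dj ∧ ∀ x ∈ l, Cog x

theorem okl3 {x y z : Obj} : OkL [x, y, z] ↔ Ok3 x y z := by
  simp only [OkL, List.pairwise_cons, List.mem_cons]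
  constructor
  · intro h
    constructor <;> grind
  · intro h
    obtain ⟨⟩ := h
    simp; grind

theorem okl4 {x y z w : Obj} : OkL [x, y, z, w] ↔ Ok4 x y z w := by
  simp only [OkL, List.pairwise_cons, List.mem_cons]
  constructor
  · intro h
    constructor <;> grind
  · intro h
    obtain ⟨⟩ := h
    simp; grind

theorem okl_perm {l l' : List Obj} (h : OkL l) (hp : l.Perm l') : OkL l' :=
  ⟨(hp.pairwise_iff (fun h => dj.symm h)).1 h.1, fun x hx => h.2 x (hp.mem_iff.2 hx)⟩

theorem okl_conj {x y : Obj} {l : List Obj} (h : OkL (x :: y :: l)) : OkL (x.conj y :: l) := by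
  simp only [OkL, List.pairwise_cons, List.mem_cons] at *
  obtain ⟨⟨h1, h2, h3⟩, h4⟩ := h
  refine ⟨⟨fun z hz => dj_conj_left.2 ⟨h1 z (Or.inr hz), h2 z hz⟩, h3⟩, ?_⟩
  rintro z (rfl | hz)
  · exact Cog.conj (h4 _ (Or.inl rfl)) (h4 _ (Or.inr (Or.inl rfl))) (h1 _ (Or.inl rfl))
  · exact h4 _ (Or.inr (Or.inr hz))

theorem okl_disj {x y : Obj} {l : List Obj} (h : OkL (x :: y :: l)) : OkL (x.disj y :: l) := by
  simp only [OkL, List.pairwise_cons, List.mem_cons] at *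
  obtain ⟨⟨h1, h2, h3⟩, h4⟩ := h
  refine ⟨⟨fun z hz => dj_disj_left.2 ⟨h1 z (Or.inr hz), h2 z hz⟩, h3⟩, ?_⟩
  rintro z (rfl | hz)
  · exact Cog.disj (h4 _ (Or.inl rfl)) (h4 _ (Or.inr (Or.inl rfl))) (h1 _ (Or.inl rfl))
  · exact h4 _ (Or.inr (Or.inr hz))

theorem okl_tail {x : Obj} {l : List Obj} (h : OkL (x :: l)) : OkL l :=
  ⟨h.1.of_cons, fun y hy => h.2 y (List.mem_cons_of_mem _ hy)⟩

theorem okl_emp {l : List Obj} (h : OkL l) : OkL (emp :: l) :=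
  ⟨List.pairwise_cons.2 ⟨fun _ _ _ hp => hp.elim, h.1⟩, fun y hy => by
    rcases List.mem_cons.1 hy with rfl | hy
    · exact Cog.emp
    · exact h.2 y hy⟩

/-- Double dissociation. -/
def dl (N : Net) (g1 g2 x y : Obj) : N.Q :=
  N.comp (N.d g1 x (g2.conj y)) (N.conj (N.id g1) (N.d g2 y x))

theorem dl_T {g1 g2 x y : Obj} (h : Ok4 g1 g2 x y) (hx : ∃ p, p ∈ x.V) (hy : ∃ p, p ∈ y.V) :
    N.T (dl N g1 g2 x y) (g1.conj (g2.conj (x.disj y))) ((g1.conj x).disj (g2.conj y)) := by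
  obtain ⟨c1, c2, c3, c4, h12, h13, h14, h23, h24, h34⟩ := h
  refine N.comp_T (N.d_T ⟨c1, c3, c2.conj c4 h24, h13, dj_conj_right.2 ⟨h12, h14⟩,
    dj_conj_right.2 ⟨h23.symm, h34⟩⟩ hx) ?_
  have := N.conj_T (N.id_T c1) (N.d_T ⟨c2, c4, c3, h24, h23, h34.symm⟩ hy)
    (dj_conj_right.2 ⟨h12, dj_disj_right.2 ⟨h14, h13⟩⟩)
  rwa [Obj.disj_comm (g2.conj y), Obj.disj_comm y] at this

theorem dl_symm {g1 g2 x y : Obj} (h : Ok4 g1 g2 x y) (hx : ∃ p, p ∈ x.V) (hy : ∃ p, p ∈ y.V) :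
    dl N g1 g2 x y = dl N g2 g1 y x := by
  obtain ⟨c1, c2, c3, c4, h12, h13, h14, h23, h24, h34⟩ := h
  have := N.dBConj (a := g1) (b := x) (c := y) (e := g2)
    ⟨c1, c3, c4, c2, h13, h14, h12, h34, h23.symm, h24.symm⟩ hx hy
  unfold dl
  rw [Obj.conj_comm g2 y, ← this, N.conj_comm]

theorem conj_id_comp {x y z : Obj} {w : Obj} {g f : N.Q} (c : Cog w) (hg : N.T g y z)
    (hf : N.T f x y) :
    N.conj (N.id w) (N.comp g f) = N.comp (N.conj (N.id w) g) (N.conj (N.id w) f) := by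
  rw [conj_comp' (N.id_T c) (N.id_T c) hg hf, N.id_comp (N.id_T c)]

theorem disj_id_comp {x y z : Obj} {w : Obj} {g f : N.Q} (c : Cog w) (hg : N.T g y z)
    (hf : N.T f x y) :
    N.disj (N.id w) (N.comp g f) = N.comp (N.disj (N.id w) g) (N.disj (N.id w) f) := by
  rw [disj_comp' (N.id_T c) (N.id_T c) hg hf, N.id_comp (N.id_T c)]

/-- Peeling a conjunct off the double dissociation. -/
theorem dl_peel {u g1 g2 x y : Obj} (h : OkL [u, g1, g2, x, y]) (hx : ∃ p, p ∈ x.V)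
    (hy : ∃ p, p ∈ y.V) :
    dl N (u.conj g1) g2 x y =
      N.comp (N.d u (g1.conj x) (g2.conj y)) (N.conj (N.id u) (dl N g1 g2 x y)) := by
  have h4 := okl4.1 (okl_tail h)
  have hu : Ok4 u g2 x y := okl4.1 (okl_tail (okl_perm h (List.Perm.swap _ _ _)))
  obtain ⟨c1, c2, c3, c4, h12, h13, h14, h23, h24, h34⟩ := h4
  have hug : dj u g1 := (List.pairwise_cons.1 h.1).1 g1 (by simp)
  have T1 : N.T (N.d g2 y x) (g2.conj (y.disj x)) ((g2.conj y).disj x) :=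
    N.d_T ⟨c2, c4, c3, h24, h23, h34.symm⟩ hy
  have T1' := N.conj_T (N.id_T c1) T1 (dj_conj_right.2 ⟨h12, dj_disj_right.2 ⟨h14, h13⟩⟩)
  have T2 : N.T (N.d g1 x (g2.conj y)) _ _ := N.d_T ⟨c1, c3, c2.conj c4 h24, h13,
    dj_conj_right.2 ⟨h12, h14⟩, dj_conj_right.2 ⟨h23.symm, h34⟩⟩ hx
  unfold dl
  rw [N.dConj (x := u) (x' := g1) (y := x) (z := g2.conj y) ?_ hx, ← N.conj_id hu.c1 c1 hug,
    N.conj_assoc, ← N.assoc]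
  · congr 1
    rw [Obj.disj_comm (g2.conj y)] at T1'
    exact (conj_id_comp hu.c1 T2 T1').symm
  · exact ⟨hu.c1, c1, c3, c2.conj c4 h24, hug, hu.h13, dj_conj_right.2 ⟨hu.h12, hu.h14⟩, h13,
      dj_conj_right.2 ⟨h12, h14⟩, dj_conj_right.2 ⟨h23.symm, h34⟩⟩

theorem dl_nat {g1 g2 x y g1' g2' x' y' : Obj} {f1 f2 fx fy : N.Q} (h : Ok4 g1 g2 x y)
    (hy : ∃ p, p ∈ y.V)
    (t1 : N.T f1 g1 g1') (t2 : N.T f2 g2 g2') (tx : N.T fx x x') (ty : N.T fy y y') :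
    N.comp (N.disj (N.conj f1 fx) (N.conj f2 fy)) (dl N g1 g2 x y) =
      N.comp (dl N g1' g2' x' y') (N.conj f1 (N.conj f2 (N.disj fx fy))) := by
  obtain ⟨c1, c2, c3, c4, h12, h13, h14, h23, h24, h34⟩ := h
  have V1 := N.V_T t1
  have V2 := N.V_T t2
  have Vx := N.V_T tx
  have Vy := N.V_T ty
  have h34' : dj x' y' := by intro p; rw [← Vx, ← Vy]; exact h34 p
  have h24' : dj g2' y' := by intro p; rw [← V2, ← Vy]; exact h24 p
  have h23' : dj g2' x' := by intro p; rw [← V2, ← Vx]; exact h23 p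
  have hy' : ∃ p, p ∈ y'.V := Vy ▸ hy
  have T1 := N.d_T ⟨c2, c4, c3, h24, h23, h34.symm⟩ hy
  have T1' := N.d_T ⟨N.tgt_T t2, N.tgt_T ty, N.tgt_T tx, h24', h23', h34'.symm⟩ hy'
  have T2 := N.conj_T t2 ty h24
  have T3 := N.disj_T tx T2 (dj_conj_right.2 ⟨h23.symm, h34⟩)
  have T4 := N.conj_T t2 (N.disj_T ty tx h34.symm) (dj_disj_right.2 ⟨h24, h23⟩)
  unfold dl
  rw [N.assoc, N.d_nat t1 tx T2, ← N.assoc]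
  rw [Obj.disj_comm x] at T3
  rw [conj_comp' t1 (N.id_T c1) T3 T1, N.disj_comm fx, N.d_nat t2 ty tx, N.comp_id t1]
  conv_lhs => rw [← N.id_comp t1]
  rw [← conj_comp' (N.id_T (N.tgt_T t1)) t1 T1' T4, N.disj_comm fx, N.assoc]

end Net
end DSC

namespace DSC
open Obj
namespace Net
variable {N : Net}

/-- Commuting squares of binary splittings. -/
structure Sq (N : Net) (α β α' β' : N.Q) (A P Q t m r : Obj) : Prop where
  tα : N.T α A (P.disj r)
  tβ : N.T β P (t.disj m)
  tα' : N.T α' A (Q.disj t)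
  tβ' : N.T β' Q (r.disj m)
  ok : Ok3 t m r
  nt : ∃ p, p ∈ t.V
  nm : ∃ p, p ∈ m.V
  nr : ∃ p, p ∈ r.V
  eq : N.comp (N.disj β (N.id r)) α = N.comp (N.disj β' (N.id t)) α'

theorem Sq.symm {α β α' β' : N.Q} {A P Q t m r : Obj} (h : Sq N α β α' β' A P Q t m r) :
    Sq N α' β' α β A Q P r m t :=
  ⟨h.tα', h.tβ', h.tα, h.tβ, h.ok.rev, h.nr, h.nm, h.nt, h.eq.symm⟩

theorem Sq.VA {α β α' β' : N.Q} {A P Q t m r : Obj} (h : Sq N α β α' β' A P Q t m r) (p : ℕ) :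
    (p ∈ A.V ↔ p ∈ t.V ∨ p ∈ m.V ∨ p ∈ r.V) ∧ (p ∈ P.V ↔ p ∈ t.V ∨ p ∈ m.V) ∧
      (p ∈ Q.V ↔ p ∈ m.V ∨ p ∈ r.V) := by
  have h1 := N.V_T h.tα
  have h2 := N.V_T h.tβ
  have h3 := N.V_T h.tβ'
  have h1' : p ∈ A.V ↔ p ∈ (P.disj r).V := by rw [h1]
  have h2' : p ∈ P.V ↔ p ∈ (t.disj m).V := by rw [h2]
  have h3' : p ∈ Q.V ↔ p ∈ (r.disj m).V := by rw [h3]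
  simp only [disj_V] at h1' h2' h3'
  tauto

theorem peel_aux {α β : N.Q} {A P u m t r : Obj} (tα : N.T α A (P.disj r))
    (tβ : N.T β P (t.disj m)) (ok : Ok3 t m r) (nt : ∃ p, p ∈ t.V)
    (cu : Cog u) (du : dj u A) :
    N.comp (N.disj (N.comp (N.d u t m) (N.conj (N.id u) β)) (N.id r))
        (N.comp (N.d u P r) (N.conj (N.id u) α)) =
      N.comp (N.d u t (m.disj r)) (N.conj (N.id u) (N.comp (N.disj β (N.id r)) α)) := by
  have h1 := N.V_T tα
  have h2 := N.V_T tβ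
  have V1 : ∀ p, p ∈ A.V ↔ (p ∈ t.V ∨ p ∈ m.V) ∨ p ∈ r.V := by
    intro p; rw [h1, ← disj_V, ← h2]; rfl
  have dut : dj u t := fun p a b => du p a ((V1 p).2 (by tauto))
  have dum : dj u m := fun p a b => du p a ((V1 p).2 (by tauto))
  have dur : dj u r := fun p a b => du p a ((V1 p).2 (by tauto))
  have duP : dj u P := fun p a b => du p a ((V1 p).2 (by
    rw [h2] at b; simp only [disj_V] at b; tauto))
  have dPr : dj P r := fun p a b => by
    rw [h2] at a; exact a.elim (fun a => ok.h13 p a b) (fun a => ok.h23 p a b)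
  have T1 := N.d_T ⟨cu, ok.c1, ok.c2, dut, dum, ok.h12⟩ nt
  have T2 := N.conj_T (N.id_T cu) tβ duP
  have T3 := N.id_T ok.c3
  have T4 := N.disj_T tβ T3 dPr
  have e1 : N.disj (N.comp (N.d u t m) (N.conj (N.id u) β)) (N.id r) =
      N.comp (N.disj (N.d u t m) (N.id r)) (N.disj (N.conj (N.id u) β) (N.id r)) := by
    rw [disj_comp' T1 T2 T3 T3, N.id_comp T3]
  rw [e1, ← N.assoc, N.assoc (N.disj (N.conj (N.id u) β) (N.id r)), N.d_nat (N.id_T cu) tβ T3,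
    conj_id_comp cu T4 tα,
    N.dDisj ⟨cu, ok.c1, ok.c2, ok.c3, dut, dum, dur, ok.h12, ok.h13, ok.h23⟩ nt]
  simp only [N.assoc]

theorem Sq.peel_t {α β α' β' : N.Q} {A P Q t m r u : Obj} (h : Sq N α β α' β' A P Q t m r)
    (cu : Cog u) (du : dj u A) :
    Sq N (N.comp (N.d u P r) (N.conj (N.id u) α)) (N.comp (N.d u t m) (N.conj (N.id u) β))
      (N.comp (N.d u t Q) (N.conj (N.id u) α')) β' (u.conj A) (u.conj P) Q (u.conj t) m r := by
  have V := h.VA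
  have dut : dj u t := fun p a b => du p a ((V p).1.2 (by tauto))
  have dum : dj u m := fun p a b => du p a ((V p).1.2 (by tauto))
  have dur : dj u r := fun p a b => du p a ((V p).1.2 (by tauto))
  have duP : dj u P := fun p a b => du p a ((V p).1.2 (by have := (V p).2.1; tauto))
  have duQ : dj u Q := fun p a b => du p a ((V p).1.2 (by have := (V p).2.2; tauto))
  have dPr : dj P r := fun p a b => by
    rcases (V p).2.1.1 a with a | a
    · exact h.ok.h13 p a b
    · exact h.ok.h23 p a b
  have dtQ : dj t Q := fun p a b => by
    rcases (V p).2.2.1 b with b | b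
    · exact h.ok.h12 p a b
    · exact h.ok.h13 p a b
  have nP : ∃ p, p ∈ P.V := by obtain ⟨p, hp⟩ := h.nt; exact ⟨p, (V p).2.1.2 (Or.inl hp)⟩
  obtain ⟨p, hp⟩ := id h.nt
  have cP := N.src_T h.tβ
  have cQ := N.src_T h.tβ'
  have Tt := N.id_T h.ok.c1
  have ta' := h.tα'
  rw [Obj.disj_comm] at ta'
  refine ⟨N.comp_T (N.d_T ⟨cu, cP, h.ok.c3, duP, dur, dPr⟩ nP) (N.conj_T (N.id_T cu) h.tα du),
    N.comp_T (N.d_T ⟨cu, h.ok.c1, h.ok.c2, dut, dum, h.ok.h12⟩ h.nt)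
      (N.conj_T (N.id_T cu) h.tβ duP),
    ?_, h.tβ', ⟨cu.conj h.ok.c1 dut, h.ok.c2, h.ok.c3, dj_conj_left.2 ⟨dum, h.ok.h12⟩,
      dj_conj_left.2 ⟨dur, h.ok.h13⟩, h.ok.h23⟩, ⟨p, Or.inr hp⟩, h.nm, h.nr, ?_⟩
  · rw [Obj.disj_comm]
    exact N.comp_T (N.d_T ⟨cu, h.ok.c1, cQ, dut, duQ, dtQ⟩ h.nt)
      (N.conj_T (N.id_T cu) ta' du)
  · rw [peel_aux h.tα h.tβ h.ok h.nt cu du, h.eq, N.disj_comm β',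
      ← N.conj_id cu h.ok.c1 dut, N.disj_comm β', N.assoc, N.d_nat (N.id_T cu) Tt h.tβ',
      conj_id_comp cu (N.disj_T Tt h.tβ' dtQ) ta', Obj.disj_comm m, N.assoc]

theorem Sq.peel_m {α β α' β' : N.Q} {A P Q t m r u : Obj} (h : Sq N α β α' β' A P Q t m r)
    (cu : Cog u) (du : dj u A) :
    Sq N (N.comp (N.d u P r) (N.conj (N.id u) α)) (N.comp (N.d u m t) (N.conj (N.id u) β))
      (N.comp (N.d u Q t) (N.conj (N.id u) α')) (N.comp (N.d u m r) (N.conj (N.id u) β'))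
      (u.conj A) (u.conj P) (u.conj Q) t (u.conj m) r := by
  have V := h.VA
  have dut : dj u t := fun p a b => du p a ((V p).1.2 (by tauto))
  have dum : dj u m := fun p a b => du p a ((V p).1.2 (by tauto))
  have dur : dj u r := fun p a b => du p a ((V p).1.2 (by tauto))
  have duP : dj u P := fun p a b => du p a ((V p).1.2 (by have := (V p).2.1; tauto))
  have duQ : dj u Q := fun p a b => du p a ((V p).1.2 (by have := (V p).2.2; tauto))
  have dPr : dj P r := fun p a b => by
    rcases (V p).2.1.1 a with a | a
    · exact h.ok.h13 p a b
    · exact h.ok.h23 p a b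
  have dtQ : dj t Q := fun p a b => by
    rcases (V p).2.2.1 b with b | b
    · exact h.ok.h12 p a b
    · exact h.ok.h13 p a b
  have nP : ∃ p, p ∈ P.V := by obtain ⟨p, hp⟩ := h.nm; exact ⟨p, (V p).2.1.2 (Or.inr hp)⟩
  have nQ : ∃ p, p ∈ Q.V := by obtain ⟨p, hp⟩ := h.nm; exact ⟨p, (V p).2.2.2 (Or.inl hp)⟩
  obtain ⟨p, hp⟩ := id h.nm
  have cP := N.src_T h.tβ
  have cQ := N.src_T h.tβ'
  have tb := h.tβ
  rw [Obj.disj_comm] at tb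
  have tb' := h.tβ'
  rw [Obj.disj_comm] at tb'
  have ok := h.ok
  refine ⟨N.comp_T (N.d_T ⟨cu, cP, ok.c3, duP, dur, dPr⟩ nP) (N.conj_T (N.id_T cu) h.tα du),
    ?_, N.comp_T (N.d_T ⟨cu, cQ, ok.c1, duQ, dut, dtQ.symm⟩ nQ) (N.conj_T (N.id_T cu) h.tα' du),
    ?_, ⟨ok.c1, cu.conj ok.c2 dum, ok.c3, dj_conj_right.2 ⟨dut.symm, ok.h12⟩, ok.h13,
      dj_conj_left.2 ⟨dur, ok.h23⟩⟩, h.nt, ⟨p, Or.inr hp⟩, h.nr, ?_⟩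
  · rw [Obj.disj_comm t]
    exact N.comp_T (N.d_T ⟨cu, ok.c2, ok.c1, dum, dut, ok.h12.symm⟩ h.nm)
      (N.conj_T (N.id_T cu) tb duP)
  · rw [Obj.disj_comm r]
    exact N.comp_T (N.d_T ⟨cu, ok.c2, ok.c3, dum, dur, ok.h23⟩ h.nm)
      (N.conj_T (N.id_T cu) tb' duQ)
  · rw [peel_aux h.tα tb ⟨ok.c2, ok.c1, ok.c3, ok.h12.symm, ok.h23, ok.h13⟩ h.nm cu du,
      peel_aux h.tα' tb' ⟨ok.c2, ok.c3, ok.c1, ok.h23, ok.h12.symm, ok.h13.symm⟩ h.nm cu du,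
      h.eq, Obj.disj_comm t]

end Net
end DSC

namespace DSC
open Obj
namespace Net
variable {N : Net}

theorem Ok4.sw {x y z w : Obj} (h : Ok4 x y z w) : Ok4 y x w z :=
  ⟨h.c2, h.c1, h.c4, h.c3, h.h12.symm, h.h24, h.h23, h.h14, h.h13, h.h34.symm⟩

theorem Ok4.cons {u x y z w : Obj} (h : Ok4 x y z w) (c : Cog u)
    (d : dj u (x.conj z) ∧ dj u (y.conj w)) : OkL [u, x, y, z, w] := by
  simp only [dj_conj_right] at d
  refine ⟨List.pairwise_cons.2 ⟨?_, (okl4.2 h).1⟩, ?_⟩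
  · simp; tauto
  · have := (okl4.2 h).2
    simp at *; tauto

theorem Ok4.add {u x y z w : Obj} (h : Ok4 x y z w) (c : Cog u)
    (d : dj u (x.conj z) ∧ dj u (y.conj w)) : Ok4 (u.conj x) y z w :=
  okl4.1 (okl_conj (Ok4.cons h c d))

theorem Ok4.add' {u x y z w : Obj} (h : Ok4 x y z w) (c : Cog u)
    (d : dj u (x.conj z) ∧ dj u (y.conj w)) : Ok4 x (u.conj y) z w :=
  Ok4.sw (Ok4.add (Ok4.sw h) c d.symm)

theorem dl_peel_l {u g1 g2 x y : Obj} (h : Ok4 g1 g2 x y) (c : Cog u)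
    (d : dj u (g1.conj x) ∧ dj u (g2.conj y)) (hx : ∃ p, p ∈ x.V)
    (hy : ∃ p, p ∈ y.V) :
    dl N (u.conj g1) g2 x y =
      N.comp (N.d u (g1.conj x) (g2.conj y)) (N.conj (N.id u) (dl N g1 g2 x y)) :=
  dl_peel (Ok4.cons h c d) hx hy

theorem dl_peel_r {u g1 g2 x y : Obj} (h : Ok4 g1 g2 x y) (c : Cog u)
    (d : dj u (g1.conj x) ∧ dj u (g2.conj y)) (hx : ∃ p, p ∈ x.V)
    (hy : ∃ p, p ∈ y.V) :
    dl N g1 (u.conj g2) x y =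
      N.comp (N.d u (g2.conj y) (g1.conj x)) (N.conj (N.id u) (dl N g1 g2 x y)) := by
  rw [dl_symm (Ok4.add' h c d) hx hy, dl_peel_l (Ok4.sw h) c d.symm hy hx, dl_symm h hx hy]

theorem dl_emp_l {g2 x y : Obj} (h : Ok4 emp g2 x y) (hx : ∃ p, p ∈ x.V)
    (hy : ∃ p, p ∈ y.V) : dl N emp g2 x y = N.d g2 y x := by
  unfold dl
  rw [conj_unit', N.d_emp_l h.c3 (h.c2.conj h.c4 h.h24) (dj_conj_right.2 ⟨h.h23.symm, h.h34⟩) hx,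
    Obj.disj_comm]
  exact N.id_comp (N.d_T ⟨h.c2, h.c4, h.c3, h.h24, h.h23, h.h34.symm⟩ hy)

theorem dl_emp_r {g1 x y : Obj} (h : Ok4 g1 emp x y) (hx : ∃ p, p ∈ x.V)
    (hy : ∃ p, p ∈ y.V) : dl N g1 emp x y = N.d g1 x y := by
  rw [dl_symm h hx hy, dl_emp_l (Ok4.sw h) hy hx]

theorem dl_emp {x y : Obj} (c : Cog x) (c' : Cog y) (h : dj x y) (hx : ∃ p, p ∈ x.V)
    (hy : ∃ p, p ∈ y.V) : dl N emp emp x y = N.id (x.disj y) := by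
  rw [dl_emp_l (okl4.1 (okl_emp (okl_emp ⟨by simpa using h, by simp [c, c']⟩))) hx hy,
    N.d_emp_l c' c h.symm hy, Obj.disj_comm]

/-- Commuting squares of double dissociations. -/
structure DSq (N : Net) (a1 a2 ax ay b1 b2 bx by' c1 c2 cx cy e1 e2 ex ey : Obj) : Prop where
  oa : Ok4 a1 a2 ax ay
  ob : Ok4 b1 b2 bx by'
  oc : Ok4 c1 c2 cx cy
  oe : Ok4 e1 e2 ex ey
  nax : ∃ p, p ∈ ax.V
  nay : ∃ p, p ∈ ay.V
  nbx : ∃ p, p ∈ bx.V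
  nby : ∃ p, p ∈ by'.V
  ncx : ∃ p, p ∈ cx.V
  ncy : ∃ p, p ∈ cy.V
  nex : ∃ p, p ∈ ex.V
  ney : ∃ p, p ∈ ey.V
  q1 : c2.conj cy = b1.conj bx
  q2 : e1.conj ex = b2.conj by'
  q3 : e2.conj ey = a2.conj ay
  sq : ∃ A, Sq N (dl N a1 a2 ax ay) (dl N b1 b2 bx by') (dl N c1 c2 cx cy) (dl N e1 e2 ex ey) A
    (a1.conj ax) (c1.conj cx) (b1.conj bx) (b2.conj by') (a2.conj ay)

variable {a1 a2 ax ay b1 b2 bx by' c1 c2 cx cy e1 e2 ex ey : Obj}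

/-- Disjointness from everything in a square. -/
def DSq.dis (_ : DSq N a1 a2 ax ay b1 b2 bx by' c1 c2 cx cy e1 e2 ex ey) (u : Obj) : Prop :=
  dj u (b1.conj bx) ∧ dj u (b2.conj by') ∧ dj u (a2.conj ay)

theorem DSq.dis_all (h : DSq N a1 a2 ax ay b1 b2 bx by' c1 c2 cx cy e1 e2 ex ey) {u A : Obj}
    (hu : h.dis u)
    (hA : Sq N (dl N a1 a2 ax ay) (dl N b1 b2 bx by') (dl N c1 c2 cx cy) (dl N e1 e2 ex ey) A
      (a1.conj ax) (c1.conj cx) (b1.conj bx) (b2.conj by') (a2.conj ay)) :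
    dj u A ∧ dj u (a1.conj ax) ∧ dj u (c1.conj cx) := by
  obtain ⟨h1, h2, h3⟩ := hu
  have V := hA.VA
  refine ⟨fun p a b => ?_, fun p a b => ?_, fun p a b => ?_⟩
  · rcases (V p).1.1 b with b | b | b
    · exact h1 p a b
    · exact h2 p a b
    · exact h3 p a b
  · rcases (V p).2.1.1 b with b | b
    · exact h1 p a b
    · exact h2 p a b
  · rcases (V p).2.2.1 b with b | b
    · exact h2 p a b
    · exact h3 p a b

theorem DSq.symm (h : DSq N a1 a2 ax ay b1 b2 bx by' c1 c2 cx cy e1 e2 ex ey) :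
    DSq N c1 c2 cx cy e2 e1 ey ex a1 a2 ax ay b2 b1 by' bx := by
  obtain ⟨oa, ob, oc, oe, nax, nay, nbx, nby, ncx, ncy, nex, ney, q1, q2, q3, A, hA⟩ := h
  refine ⟨oc, Ok4.sw oe, oa, Ok4.sw ob, ncx, ncy, ney, nex, nax, nay, nby, nbx, q3.symm, q2.symm,
    q1.symm, A, ?_⟩
  rw [q1, q2, q3, ← dl_symm ob nbx nby, ← dl_symm oe nex ney]
  exact hA.symm

theorem DSq.t (h : DSq N a1 a2 ax ay b1 b2 bx by' c1 c2 cx cy e1 e2 ex ey) {u : Obj}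
    (cu : Cog u) (hu : h.dis u) :
    DSq N (u.conj a1) a2 ax ay (u.conj b1) b2 bx by' c1 (u.conj c2) cx cy e1 e2 ex ey := by
  obtain ⟨A, hA⟩ := h.sq
  obtain ⟨h1, h2, h3⟩ := h.dis_all hu hA
  obtain ⟨h4, h5, h6⟩ := hu
  obtain ⟨oa, ob, oc, oe, nax, nay, nbx, nby, ncx, ncy, nex, ney, q1, q2, q3, _⟩ := h
  have dc : dj u (c1.conj cx) ∧ dj u (c2.conj cy) := ⟨h3, q1 ▸ h4⟩
  refine ⟨Ok4.add oa cu ⟨h2, h6⟩, Ok4.add ob cu ⟨h4, h5⟩, Ok4.add' oc cu dc, oe, nax, nay, nbx,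
    nby, ncx, ncy, nex, ney, ?_, q2, q3, u.conj A, ?_⟩
  · rw [Obj.conj_assoc, Obj.conj_assoc, q1]
  · rw [dl_peel_l oa cu ⟨h2, h6⟩ nax nay, dl_peel_l ob cu ⟨h4, h5⟩ nbx nby,
      dl_peel_r oc cu dc ncx ncy, Obj.conj_assoc, Obj.conj_assoc, q1]
    exact hA.peel_t cu h1

theorem DSq.m (h : DSq N a1 a2 ax ay b1 b2 bx by' c1 c2 cx cy e1 e2 ex ey) {u : Obj}
    (cu : Cog u) (hu : h.dis u) :
    DSq N (u.conj a1) a2 ax ay b1 (u.conj b2) bx by' (u.conj c1) c2 cx cy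
      (u.conj e1) e2 ex ey := by
  obtain ⟨A, hA⟩ := h.sq
  obtain ⟨h1, h2, h3⟩ := h.dis_all hu hA
  obtain ⟨h4, h5, h6⟩ := hu
  obtain ⟨oa, ob, oc, oe, nax, nay, nbx, nby, ncx, ncy, nex, ney, q1, q2, q3, _⟩ := h
  have dc : dj u (c1.conj cx) ∧ dj u (c2.conj cy) := ⟨h3, q1 ▸ h4⟩
  have de : dj u (e1.conj ex) ∧ dj u (e2.conj ey) := ⟨q2 ▸ h5, q3 ▸ h6⟩
  refine ⟨Ok4.add oa cu ⟨h2, h6⟩, Ok4.add' ob cu ⟨h4, h5⟩, Ok4.add oc cu dc, Ok4.add oe cu de,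
    nax, nay, nbx, nby, ncx, ncy, nex, ney, q1, ?_, q3, u.conj A, ?_⟩
  · rw [Obj.conj_assoc, Obj.conj_assoc, q2]
  · rw [dl_peel_l oa cu ⟨h2, h6⟩ nax nay, dl_peel_r ob cu ⟨h4, h5⟩ nbx nby,
      dl_peel_l oc cu dc ncx ncy, dl_peel_l oe cu de nex ney, Obj.conj_assoc, Obj.conj_assoc,
      Obj.conj_assoc, q1, q2, q3]
    exact hA.peel_m cu h1

theorem DSq.r (h : DSq N a1 a2 ax ay b1 b2 bx by' c1 c2 cx cy e1 e2 ex ey) {u : Obj}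
    (cu : Cog u) (hu : h.dis u) :
    DSq N a1 (u.conj a2) ax ay b1 b2 bx by' (u.conj c1) c2 cx cy e1 (u.conj e2) ex ey := by
  refine (h.symm.t cu ?_).symm
  obtain ⟨h4, h5, h6⟩ := hu
  exact ⟨h.q3 ▸ h6, h.q2 ▸ h5, h.q1 ▸ h4⟩

/-- Base square: three disjuncts. -/
theorem dsq_same0 {t m r : Obj} (ok : Ok3 t m r) (nt : ∃ p, p ∈ t.V) (nm : ∃ p, p ∈ m.V)
    (nr : ∃ p, p ∈ r.V) :
    DSq N emp emp (t.disj m) r emp emp t m emp emp (m.disj r) t emp emp m r := by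
  obtain ⟨c1, c2, c3, h12, h13, h23⟩ := id ok
  have k1 : Cog (t.disj m) := c1.disj c2 h12
  have k2 : Cog (m.disj r) := c2.disj c3 h23
  have j1 : dj (t.disj m) r := dj_disj_left.2 ⟨h13, h23⟩
  have j2 : dj (m.disj r) t := dj_disj_left.2 ⟨h12.symm, h13.symm⟩
  have aux : ∀ {x y : Obj}, Cog x → Cog y → dj x y → Ok4 emp emp x y := fun c c' h =>
    okl4.1 (okl_emp (okl_emp ⟨by simpa using h, by simp [c, c']⟩))
  have n1 : ∃ p, p ∈ (t.disj m).V := ⟨_, Or.inl nt.choose_spec⟩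
  have n2 : ∃ p, p ∈ (m.disj r).V := ⟨_, Or.inl nm.choose_spec⟩
  refine ⟨aux k1 c3 j1, aux c1 c2 h12, aux k2 c1 j2, aux c2 c3 h23, n1, nr, nt, nm, n2, nt, nm,
    nr, rfl, rfl, rfl, (t.disj m).disj r, ?_⟩
  have e : (m.disj r).disj t = (t.disj m).disj r := by
    rw [Obj.disj_comm, Obj.disj_assoc]
  rw [dl_emp k1 c3 j1 n1 nr, dl_emp c1 c2 h12 nt nm, dl_emp k2 c1 j2 n2 nt,
    dl_emp c2 c3 h23 nm nr]
  simp only [emp_conj]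
  have Tt := N.id_T (k1.disj c3 j1)
  refine ⟨Tt, N.id_T k1, ?_, ?_, ok, nt, nm, nr, ?_⟩
  · rw [e]; exact Tt
  · rw [Obj.disj_comm r]; exact N.id_T k2
  · rw [N.disj_id k1 c3 j1, N.disj_id k2 c1 j2, e]

/-- Base square: two independent pairs. -/
theorem dsq_diff0 {t m n r : Obj} (ok : Ok4 t m n r) (nt : ∃ p, p ∈ t.V) (nm : ∃ p, p ∈ m.V)
    (nn : ∃ p, p ∈ n.V) (nr : ∃ p, p ∈ r.V) :
    DSq N (t.disj m) emp n r emp n t m (n.disj r) emp m t m emp n r := by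
  have h0 := okl4.2 ok
  obtain ⟨c1, c2, c3, c4, h12, h13, h14, h23, h24, h34⟩ := id ok
  have o1 : Ok4 (t.disj m) emp n r := okl4.1 (okl_perm (okl_emp (okl_disj h0)) (List.Perm.swap _ _ _))
  have o2 : Ok4 emp n t m := ⟨Cog.emp, c3, c1, c2, fun _ h => h.elim, fun _ h => h.elim,
    fun _ h => h.elim, h13.symm, h23.symm, h12⟩
  have o3 : Ok4 (n.disj r) emp m t := ⟨c3.disj c4 h34, Cog.emp, c2, c1, fun _ _ h => h.elim,
    dj_disj_left.2 ⟨h23.symm, h24.symm⟩, dj_disj_left.2 ⟨h13.symm, h14.symm⟩,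
    fun _ h => h.elim, fun _ h => h.elim, h12.symm⟩
  have o4 : Ok4 m emp n r := ⟨c2, Cog.emp, c3, c4, fun _ _ h => h.elim, h23, h24,
    fun _ h => h.elim, fun _ h => h.elim, h34⟩
  refine ⟨o1, o2, o3, o4, nn, nr, nt, nm, nm, nt, nn, nr, rfl, by simp [Obj.conj_comm m], rfl,
    (t.disj m).conj (n.disj r), ?_⟩
  rw [dl_emp_r o1 nn nr, dl_emp_l o2 nt nm, dl_emp_r o3 nm nt, dl_emp_r o4 nn nr]
  simp only [emp_conj]
  have T1 := N.d_T ⟨o1.c1, c3, c4, o1.h13, o1.h14, h34⟩ nn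
  have T2 := N.d_T ⟨c3, c2, c1, h23.symm, h13.symm, h12.symm⟩ nm
  have T3 := N.d_T ⟨o3.c1, c2, c1, o3.h13, o3.h14, h12.symm⟩ nm
  have T4 := N.d_T ⟨c2, c3, c4, h23, h24, h34⟩ nn
  refine ⟨T1, ?_, ?_, ?_, ⟨c1, c3.conj c2 h23.symm, c4, dj_conj_right.2 ⟨h13, h12⟩, h14,
    dj_conj_left.2 ⟨h34, h24⟩⟩, nt, ⟨_, Or.inl nn.choose_spec⟩, nr, ?_⟩
  · rwa [Obj.conj_comm n, Obj.disj_comm t, Obj.disj_comm t, Obj.conj_comm n] at *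
  · rw [Obj.conj_comm, Obj.disj_comm t m]; exact T3
  · have e1 : (n.disj r).conj m = m.conj (n.disj r) := Obj.conj_comm _ _
    have e2 : r.disj (n.conj m) = (m.conj n).disj r := by rw [Obj.disj_comm, Obj.conj_comm n]
    rw [e1, e2]
    exact T4
  · have := N.dBDisj (a := r) (b := n) (c := m) (e := t)
      ⟨c4, c3, c2, c1, h34.symm, h24.symm, h14.symm, h23.symm, h13.symm, h12.symm⟩ nn nm
    rw [N.disj_comm (N.id t)] at this
    exact this.symm

end Net
end DSC

namespace DSC
open Obj
namespace Net
variable {N : Net}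

/-- `C` is a conjunctive part of `a`, split disjunctively by `S`; the rest is split
conjunctively. -/
structure Nice (a : Obj) (S C : Set ℕ) : Prop where
  n1 : ∃ p, p ∈ a.V ∧ p ∈ C ∧ p ∈ S
  n2 : ∃ p, p ∈ a.V ∧ p ∈ C ∧ p ∉ S
  e1 : ∀ p q, p ∈ a.V → q ∈ a.V → p ∈ C → q ∉ C → a.E p q
  e2 : ∀ p q, p ∈ a.V → q ∈ a.V → p ∈ S → p ∉ C → q ∉ S → q ∉ C → a.E p q
  e3 : ∀ p q, p ∈ a.V → q ∈ a.V → p ∈ C → p ∈ S → q ∈ C → q ∉ S → ¬ a.E p q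

theorem Nice.symm {a : Obj} {S C : Set ℕ} (h : Nice a S C) : Nice a Sᶜ C := by
  obtain ⟨h1, h2, h3, h4, h5⟩ := h
  have := @a.symm
  constructor <;> (try simp only [Set.mem_compl_iff, not_not]) <;> grind

/-- The double dissociation attached to a nice pair. -/
def del (N : Net) (a : Obj) (S C : Set ℕ) : N.Q :=
  dl N (a.r {p | p ∈ S ∧ p ∉ C}) (a.r {p | p ∉ S ∧ p ∉ C}) (a.r {p | p ∈ C ∧ p ∈ S})
    (a.r {p | p ∈ C ∧ p ∉ S})

theorem r_ok4 {a : Obj} (c : Cog a) (A B C D : Set ℕ) (h12 : ∀ p ∈ a.V, p ∈ A → p ∉ B)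
    (h13 : ∀ p ∈ a.V, p ∈ A → p ∉ C) (h14 : ∀ p ∈ a.V, p ∈ A → p ∉ D)
    (h23 : ∀ p ∈ a.V, p ∈ B → p ∉ C) (h24 : ∀ p ∈ a.V, p ∈ B → p ∉ D)
    (h34 : ∀ p ∈ a.V, p ∈ C → p ∉ D) : Ok4 (a.r A) (a.r B) (a.r C) (a.r D) :=
  ⟨c.r _, c.r _, c.r _, c.r _, fun p x y => h12 p x.1 x.2 y.2, fun p x y => h13 p x.1 x.2 y.2,
    fun p x y => h14 p x.1 x.2 y.2, fun p x y => h23 p x.1 x.2 y.2,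
    fun p x y => h24 p x.1 x.2 y.2, fun p x y => h34 p x.1 x.2 y.2⟩

theorem del_ok {a : Obj} (c : Cog a) (S C : Set ℕ) :
    Ok4 (a.r {p | p ∈ S ∧ p ∉ C}) (a.r {p | p ∉ S ∧ p ∉ C}) (a.r {p | p ∈ C ∧ p ∈ S})
    (a.r {p | p ∈ C ∧ p ∉ S}) := by
  apply r_ok4 c <;> simp only [Set.mem_ofPred_eq] <;> grind

theorem Nice.x {a : Obj} {S C : Set ℕ} (h : Nice a S C) :
    ∃ p, p ∈ (a.r {p | p ∈ C ∧ p ∈ S}).V := h.n1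
theorem Nice.y {a : Obj} {S C : Set ℕ} (h : Nice a S C) :
    ∃ p, p ∈ (a.r {p | p ∈ C ∧ p ∉ S}).V := h.n2

theorem Nice.src {a : Obj} {S C : Set ℕ} (h : Nice a S C) :
    (a.r {p | p ∈ S ∧ p ∉ C}).conj ((a.r {p | p ∉ S ∧ p ∉ C}).conj
      ((a.r {p | p ∈ C ∧ p ∈ S}).disj (a.r {p | p ∈ C ∧ p ∉ S}))) = a := by
  obtain ⟨h1, h2, h3, h4, h5⟩ := h
  have := @a.symm
  have := @a.mem
  apply ext' <;> simp <;> grind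

theorem Nice.t1 {a : Obj} {S C : Set ℕ} (h : Nice a S C) :
    (a.r {p | p ∈ S ∧ p ∉ C}).conj (a.r {p | p ∈ C ∧ p ∈ S}) = a.r S := by
  obtain ⟨h1, h2, h3, h4, h5⟩ := h
  have := @a.symm
  have := @a.mem
  apply ext' <;> simp <;> grind

theorem Nice.t2 {a : Obj} {S C : Set ℕ} (h : Nice a S C) :
    (a.r {p | p ∉ S ∧ p ∉ C}).conj (a.r {p | p ∈ C ∧ p ∉ S}) = a.r Sᶜ := by
  obtain ⟨h1, h2, h3, h4, h5⟩ := h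
  have := @a.symm
  have := @a.mem
  apply ext' <;> simp <;> grind

theorem del_T {a : Obj} {S C : Set ℕ} (c : Cog a) (h : Nice a S C) :
    N.T (del N a S C) a ((a.r S).disj (a.r Sᶜ)) := by
  have := dl_T (N := N) (del_ok c S C) h.x h.y
  rwa [h.src, h.t1, h.t2] at this

theorem del_symm {a : Obj} {S C : Set ℕ} (c : Cog a) (h : Nice a S C) :
    del N a S C = del N a Sᶜ C := by
  unfold del
  rw [dl_symm (del_ok c S C) h.x h.y]
  simp

theorem Nice.congr {a : Obj} {S C S' C' : Set ℕ} (h : Nice a S C)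
    (hS : ∀ p ∈ a.V, p ∈ S ↔ p ∈ S') (hC : ∀ p ∈ a.V, p ∈ C ↔ p ∈ C') : Nice a S' C' := by
  obtain ⟨h1, h2, h3, h4, h5⟩ := h
  constructor <;> grind

theorem del_congr {a : Obj} {S C S' C' : Set ℕ} 
    (hS : ∀ p ∈ a.V, p ∈ S ↔ p ∈ S') (hC : ∀ p ∈ a.V, p ∈ C ↔ p ∈ C') :
    del N a S C = del N a S' C' := by
  have e1 : a.r {p | p ∈ S ∧ p ∉ C} = a.r {p | p ∈ S' ∧ p ∉ C'} := r_congr (by simp; grind)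
  have e2 : a.r {p | p ∉ S ∧ p ∉ C} = a.r {p | p ∉ S' ∧ p ∉ C'} := r_congr (by simp; grind)
  have e3 : a.r {p | p ∈ C ∧ p ∈ S} = a.r {p | p ∈ C' ∧ p ∈ S'} := r_congr (by simp; grind)
  have e4 : a.r {p | p ∈ C ∧ p ∉ S} = a.r {p | p ∈ C' ∧ p ∉ S'} := r_congr (by simp; grind)
  unfold del
  rw [e1, e2, e3, e4]

/-- Nested splittings over the same part. -/
theorem nested_same {a : Obj} {S T C : Set ℕ} (c : Cog a) (hS : Nice a S C) (hT : Nice a T C)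
    (hTS : ∀ p ∈ a.V, p ∈ T → p ∈ S) (hm : ∃ p, p ∈ a.V ∧ p ∈ C ∧ p ∈ S ∧ p ∉ T) :
    N.comp (N.disj (del N (a.r S) T C) (N.id (a.r Sᶜ))) (del N a S C) =
      N.comp (N.disj (del N (a.r Tᶜ) S C) (N.id (a.r T))) (del N a T C) := by
  have hs := @a.symm
  have hmm := @a.mem
  obtain ⟨h1, h2, h3, h4, h5⟩ := id hS
  obtain ⟨k1, k2, k3, k4, k5⟩ := id hT
  have Dq := dsq_same0 (N := N) (t := a.r {p | p ∈ C ∧ p ∈ T}) (m := a.r {p | p ∈ C ∧ p ∈ S ∧ p ∉ T})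
    (r := a.r {p | p ∈ C ∧ p ∉ S}) ⟨c.r _, c.r _, c.r _, by simp [dj]; grind, by simp [dj]; grind,
      by simp [dj]; grind⟩ k1 hm hS.n2
  have D1 := Dq.t (u := a.r {p | p ∈ T ∧ p ∉ C}) (c.r _) (by simp [DSq.dis, dj]; grind)
  have D2 := D1.m (u := a.r {p | p ∈ S ∧ p ∉ T ∧ p ∉ C}) (c.r _) (by simp [DSq.dis, dj]; grind)
  have D3 := D2.r (u := a.r {p | p ∉ S ∧ p ∉ C}) (c.r _) (by simp [DSq.dis, dj]; grind)
  obtain ⟨A, hA⟩ := D3.sq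
  have := hA.eq
  simp only [conj_emp] at this
  rw [del_symm c hT]
  convert this using 3
  all_goals (try unfold del)
  all_goals congr 1
  all_goals apply ext'
  all_goals simp
  all_goals grind

/-- Nested splittings over different parts. -/
theorem nested_diff {a : Obj} {S T C D : Set ℕ} (c : Cog a) (hS : Nice a S C) (hT : Nice a T D)
    (hTS : ∀ p ∈ a.V, p ∈ T → p ∈ S) (hCD : ∀ p ∈ a.V, p ∈ C → p ∉ D)
    (hCT : ∀ p ∈ a.V, p ∈ C → p ∉ T) :
    N.comp (N.disj (del N (a.r S) T D) (N.id (a.r Sᶜ))) (del N a S C) =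
      N.comp (N.disj (del N (a.r Tᶜ) S C) (N.id (a.r T))) (del N a T D) := by
  have hs := @a.symm
  have hmm := @a.mem
  obtain ⟨h1, h2, h3, h4, h5⟩ := id hS
  obtain ⟨k1, k2, k3, k4, k5⟩ := id hT
  have hDS : ∀ p ∈ a.V, p ∈ D → p ∈ S := by grind
  have Dq := dsq_diff0 (N := N) (t := a.r {p | p ∈ D ∧ p ∈ T}) (m := a.r {p | p ∈ D ∧ p ∉ T})
    (n := a.r {p | p ∈ C ∧ p ∈ S})
    (r := a.r {p | p ∈ C ∧ p ∉ S}) (by apply r_ok4 c <;> simp only [Set.mem_ofPred_eq] <;> grind)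
    k1 k2 h1 h2
  have D1 := Dq.t (u := a.r {p | p ∈ T ∧ p ∉ D}) (c.r _) (by simp [DSq.dis, dj]; grind)
  have D2 := D1.m (u := a.r {p | p ∈ S ∧ p ∉ T ∧ p ∉ C ∧ p ∉ D}) (c.r _)
    (by simp [DSq.dis, dj]; grind)
  have D3 := D2.r (u := a.r {p | p ∉ S ∧ p ∉ C}) (c.r _) (by simp [DSq.dis, dj]; grind)
  obtain ⟨A, hA⟩ := D3.sq
  have := hA.eq
  simp only [conj_emp] at this
  rw [del_symm c hT]
  convert this using 3
  all_goals (try unfold del)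
  all_goals congr 1
  all_goals apply ext'
  all_goals simp
  all_goals grind

end Net
end DSC

namespace DSC
open Obj
namespace Net
variable {N : Net}

/-- A left splitting of an arrow, with witnesses. -/
structure LSw (N : Net) (f : N.Q) (a b : Obj) (S C : Set ℕ) (f1 f2 : N.Q) : Prop where
  tf : N.T f a b
  nice : Nice a S C
  fl : b.flD S
  t1 : N.T f1 (a.r S) (b.r S)
  t2 : N.T f2 (a.r Sᶜ) (b.r Sᶜ)
  eq : f = N.comp (N.disj f1 f2) (del N a S C)

/-- Left splittings. -/
def LS (N : Net) (f : N.Q) (a b : Obj) (S C : Set ℕ) : Prop := ∃ f1 f2, LSw N f a b S C f1 f2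

/-- Right splittings. -/
def RS (N : Net) (f : N.Q) (a b : Obj) (S C : Set ℕ) : Prop := LS N.op f b.co a.co S C

theorem flD_symm {a : Obj} {S : Set ℕ} (h : a.flD S) : a.flD Sᶜ := by
  intro p hp q hq h1 h2 h3
  exact h q hq p hp (by simpa using h2) h1 (a.symm h3)

theorem flC_symm {a : Obj} {S : Set ℕ} (h : a.flC S) : a.flC Sᶜ := by
  intro p hp q hq h1 h2
  exact a.symm (h q hq p hp (by simpa using h2) h1)

theorem flD_congr {a : Obj} {S S' : Set ℕ} (h : a.flD S) (hS : ∀ p ∈ a.V, p ∈ S ↔ p ∈ S') :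
    a.flD S' := by
  intro p hp q hq h1 h2
  exact h p hp q hq ((hS p hp).2 h1) (fun h => h2 ((hS q hq).1 h))

theorem LSw.symm {f : N.Q} {a b : Obj} {S C : Set ℕ} {f1 f2 : N.Q}
    (h : LSw N f a b S C f1 f2) : LSw N f a b Sᶜ C f2 f1 := by
  refine ⟨h.tf, h.nice.symm, flD_symm h.fl, h.t2, by simpa using h.t1, ?_⟩
  rw [N.disj_comm, ← del_symm (N.src_T h.tf) h.nice]
  exact h.eq

theorem LSw.congr {f : N.Q} {a b : Obj} {S C S' C' : Set ℕ} {f1 f2 : N.Q}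
    (h : LSw N f a b S C f1 f2) (hS : ∀ p ∈ a.V, p ∈ S ↔ p ∈ S')
    (hC : ∀ p ∈ a.V, p ∈ C ↔ p ∈ C') : LSw N f a b S' C' f1 f2 := by
  have hV := N.V_T h.tf
  have hb : ∀ p ∈ b.V, p ∈ S ↔ p ∈ S' := fun p hp => hS p (hV ▸ hp)
  refine ⟨h.tf, h.nice.congr hS hC, flD_congr h.fl hb, ?_, ?_, ?_⟩
  · rw [← r_congr hS, ← r_congr hb]; exact h.t1
  · rw [← r_congr (x := a) (S := Sᶜ) (by simpa [not_iff_not] using hS),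
      ← r_congr (x := b) (S := Sᶜ) (by simpa [not_iff_not] using hb)]
    exact h.t2
  · rw [← del_congr hS hC]; exact h.eq

theorem LS.symm {f : N.Q} {a b : Obj} {S C : Set ℕ} (h : LS N f a b S C) : LS N f a b Sᶜ C := by
  obtain ⟨f1, f2, h⟩ := h
  exact ⟨f2, f1, h.symm⟩

theorem LS.congr {f : N.Q} {a b : Obj} {S C S' C' : Set ℕ}
    (h : LS N f a b S C) (hS : ∀ p ∈ a.V, p ∈ S ↔ p ∈ S')
    (hC : ∀ p ∈ a.V, p ∈ C ↔ p ∈ C') : LS N f a b S' C' := by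
  obtain ⟨f1, f2, h⟩ := h
  exact ⟨f1, f2, h.congr hS hC⟩

theorem RS.symm {f : N.Q} {a b : Obj} {S C : Set ℕ} (h : RS N f a b S C) : RS N f a b Sᶜ C :=
  LS.symm h

theorem op_op (N : Net) : N.op.op = N := by
  obtain ⟨⟨Q, bot, src, tgt, id, comp, conj, disj, d⟩, _⟩ := N
  simp [op, opD]

theorem opRS {f : N.Q} {a b : Obj} {S C : Set ℕ} (h : LS N f a b S C) :
    RS N.op f b.co a.co S C := by
  unfold RS
  have : ∀ M : Net, M = N → ∀ f' : M.Q, HEq f' f → LS M f' a b S C := by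
    rintro M rfl f' hf
    rw [eq_of_heq hf]; exact h
  simp only [co_co]
  exact this _ (op_op N) f HEq.rfl

theorem LS_flat {f : N.Q} {a b : Obj} {S : Set ℕ} (h : N.T f a b) (ha : a.flD S)
    (h1 : ∃ p, p ∈ a.V ∧ p ∈ S) (h2 : ∃ p, p ∈ a.V ∧ p ∉ S) : LS N f a b S Set.univ := by
  obtain ⟨hb, f1, f2, t1, t2, e⟩ := eD h ha
  have hN : Nice a S Set.univ := ⟨by simpa using h1, by simpa using h2, by simp, by simp, by
    intro p q hp hq _ h1 _ h2
    exact ha p hp q hq h1 h2⟩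
  refine ⟨f1, f2, h, hN, hb, t1, t2, ?_⟩
  have c := N.src_T h
  have : del N a S Set.univ = N.id a := by
    unfold del
    rw [r_none (S := {p | p ∈ S ∧ p ∉ Set.univ}) (by simp),
      r_none (S := {p | p ∉ S ∧ p ∉ Set.univ}) (by simp)]
    have e1 : a.r {p | p ∈ Set.univ ∧ p ∈ S} = a.r S := r_congr (by simp)
    have e2 : a.r {p | p ∈ Set.univ ∧ p ∉ S} = a.r Sᶜ := r_congr (by simp)
    rw [e1, e2, dl_emp (c.r _) (c.r _) (dj_r a S) h1 h2, ha.eq]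
  rw [this, ← e, N.comp_id h]

theorem RS_flat {f : N.Q} {a b : Obj} {S : Set ℕ} (h : N.T f a b) (hb : b.flC S)
    (h1 : ∃ p, p ∈ b.V ∧ p ∈ S) (h2 : ∃ p, p ∈ b.V ∧ p ∉ S) : RS N f a b S Set.univ :=
  LS_flat (N := N.op) (op_op_T.2 h) ((flD_co _).2 hb) h1 h2

theorem del_peel {a : Obj} {S C T : Set ℕ} (c : Cog a) (h : Nice a S C)
    (hT : ∀ p ∈ a.V, p ∈ T → p ∈ S ∧ p ∉ C) (hE : (a.r S).flC T) :
    del N a S C = N.comp (N.d (a.r T) (a.r {p | p ∈ S ∧ p ∉ T}) (a.r Sᶜ))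
      (N.conj (N.id (a.r T)) (del N (a.r Tᶜ) S C)) := by
  have hs := @a.symm
  have hmm := @a.mem
  obtain ⟨h1, h2, h3, h4, h5⟩ := id h
  simp only [flC, r_V, r_E] at hE
  have e1 : a.r {p | p ∈ S ∧ p ∉ C} = (a.r T).conj (a.r {p | p ∈ S ∧ p ∉ T ∧ p ∉ C}) := by
    apply ext' <;> simp <;> grind
  have := dl_peel_l (N := N) (u := a.r T) (g1 := a.r {p | p ∈ S ∧ p ∉ T ∧ p ∉ C})
    (g2 := a.r {p | p ∉ S ∧ p ∉ C}) (x := a.r {p | p ∈ C ∧ p ∈ S}) (y := a.r {p | p ∈ C ∧ p ∉ S})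
    (by apply r_ok4 c <;> simp only [Set.mem_ofPred_eq] <;> grind) (c.r _)
    (by simp [dj]; grind) h.x h.y
  have e2 : del N a S C = dl N ((a.r T).conj (a.r {p | p ∈ S ∧ p ∉ T ∧ p ∉ C}))
    (a.r {p | p ∉ S ∧ p ∉ C}) (a.r {p | p ∈ C ∧ p ∈ S}) (a.r {p | p ∈ C ∧ p ∉ S}) := by
    rw [← e1]; rfl
  rw [e2, this, h.t2]
  have e3 : (a.r {p | p ∈ S ∧ p ∉ T ∧ p ∉ C}).conj (a.r {p | p ∈ C ∧ p ∈ S}) =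
      a.r {p | p ∈ S ∧ p ∉ T} := by
    apply ext' <;> simp <;> grind
  rw [e3]
  unfold del
  congr 3 <;> apply ext' <;> simp <;> grind

theorem nest_LL {f : N.Q} {a b : Obj} {S C T D : Set ℕ} {f1 f2 : N.Q}
    (h : LSw N f a b S C f1 f2) (hTS : ∀ p ∈ a.V, p ∈ T → p ∈ S) (hN : Nice a T D)
    (hD : (∀ p ∈ a.V, p ∈ C ↔ p ∈ D) ∨
      (∀ p ∈ a.V, p ∈ C → p ∉ D) ∧ (∀ p ∈ a.V, p ∈ C → p ∉ T))
    (hf : LS N f1 (a.r S) (b.r S) T D) : LS N f a b T D := by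
  obtain ⟨g1, g2, k⟩ := hf
  have c := N.src_T h.tf
  have cb := N.tgt_T h.tf
  have hV := N.V_T h.tf
  have hm : ∃ p, p ∈ a.V ∧ p ∈ C ∧ p ∈ S ∧ p ∉ T := by
    rcases hD with hD | hD
    · obtain ⟨p, hp, hp', hp''⟩ := k.nice.n2
      exact ⟨p, hp.1, (hD p hp.1).2 hp', hp.2, hp''⟩
    · obtain ⟨p, hp, hp', hp''⟩ := h.nice.n1
      exact ⟨p, hp, hp', hp'', hD.2 p hp hp'⟩
  have key : N.comp (N.disj (del N (a.r S) T D) (N.id (a.r Sᶜ))) (del N a S C) =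
      N.comp (N.disj (del N (a.r Tᶜ) S C) (N.id (a.r T))) (del N a T D) := by
    rcases hD with hD | hD
    · have := nested_same (N := N) c h.nice (hN.congr (fun _ _ => Iff.rfl) (fun p hp => (hD p hp).symm)) hTS hm
      rw [del_congr (N := N) (a := a.r S) (S := T) (S' := T) (C := C) (C' := D), del_congr (N := N) (a := a) (S := T) (S' := T) (C := C) (C' := D)] at this
      · exact this
      · exact fun _ _ => Iff.rfl
      · exact hD
      · exact fun _ _ => Iff.rfl
      · exact fun p hp => hD p hp.1
    · exact nested_diff c h.nice hN hTS hD.1 hD.2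
  have nT : Nice (a.r Tᶜ) S C := by
    obtain ⟨h1, h2, h3, h4, h5⟩ := h.nice
    constructor <;> simp only [r_V, r_E, Set.mem_compl_iff] <;> grind
  have q1 : (a.r S).r T = a.r T := by rw [r_r]; exact r_congr (by simp; grind)
  have q2 : (b.r S).r T = b.r T := by rw [r_r]; exact r_congr (by simp; grind)
  have q3 : (a.r Tᶜ).r S = (a.r S).r Tᶜ := by rw [r_r, r_r, Set.inter_comm]
  have q4 : (a.r Tᶜ).r Sᶜ = a.r Sᶜ := by rw [r_r]; exact r_congr (by simp; grind)
  have flS := h.fl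
  have flT := k.fl
  have sb := @b.symm
  simp only [flD, r_V, r_E] at flS flT
  have q5 : ((b.r S).r Tᶜ).disj (b.r Sᶜ) = b.r Tᶜ := by
    have := @b.mem
    apply ext' <;> simp <;> grind
  have d1 := del_T (N := N) (c.r _) nT
  have d2 := del_T (N := N) c hN
  have d3 := del_T (N := N) (c.r _) k.nice
  have d4 := del_T (N := N) c h.nice
  rw [q3, q4] at d1
  have kt1 := k.t1
  have kt2 := k.t2
  have j1 : dj ((a.r S).r Tᶜ) (a.r Sᶜ) := by simp [dj]; grind
  have j2 : dj ((a.r S).r T) ((a.r S).r Tᶜ) := dj_r _ _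
  have tg := N.disj_T kt2 h.t2 j1
  have j3 := N.disj_T kt1 kt2 j2
  refine ⟨g1, N.comp (N.disj g2 f2) (del N (a.r Tᶜ) S C), h.tf, hN, ?_, ?_, ?_, ?_⟩
  · simp only [flD]; grind
  · rw [← q1, ← q2]; exact kt1
  · rw [← q5]; exact N.comp_T tg d1
  · have i1 := N.id_T (c.r Sᶜ)
    have i2 := N.id_T (c.r T)
    rw [q1, q2] at kt1
    rw [h.eq, k.eq]
    have x1 : N.disj (N.comp (N.disj g1 g2) (del N (a.r S) T D)) f2 =
        N.comp (N.disj (N.disj g1 g2) f2) (N.disj (del N (a.r S) T D) (N.id (a.r Sᶜ))) := by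
      rw [disj_comp' j3 d3 h.t2 i1, N.comp_id h.t2]
    have x2 : N.disj g1 (N.comp (N.disj g2 f2) (del N (a.r Tᶜ) S C)) =
        N.comp (N.disj g1 (N.disj g2 f2)) (N.disj (N.id (a.r T)) (del N (a.r Tᶜ) S C)) := by
      rw [disj_comp' kt1 i2 tg d1, N.comp_id kt1]
    rw [x1, x2, ← N.assoc, key, ← N.assoc, N.disj_assoc, N.disj_comm (N.id (a.r T))]

set_option maxHeartbeats 1000000 in
theorem nest_LR {f : N.Q} {a b : Obj} {S C T D : Set ℕ} {f1 f2 : N.Q}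
    (h : LSw N f a b S C f1 f2) (hTS : ∀ p ∈ a.V, p ∈ T → p ∈ S) (hTC : ∀ p ∈ a.V, p ∈ T → p ∉ C)
    (hf : RS N f1 (a.r S) (b.r S) T D) : RS N f a b T {p | p ∈ D ∧ p ∈ S} := by
  obtain ⟨g1, g2, k⟩ := hf
  have c := N.src_T h.tf
  have cb := N.tgt_T h.tf
  have hV := N.V_T h.tf
  have hE : (a.r S).flC T := (flD_co _).1 k.fl
  have ss := @a.symm
  have sb := @b.symm
  have ma := @a.mem
  have mb := @b.mem
  have ib := @b.irr
  have P := del_peel (N := N) c h.nice (T := T) (by grind) hE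
  obtain ⟨h1, h2, h3, h4, h5⟩ := h.nice
  have knb : Nice (b.r S).co T {p | p ∈ D ∧ p ∈ S} :=
    k.nice.congr (fun _ _ => Iff.rfl) (fun p hp => by simp [hp.2])
  obtain ⟨k1, k2, k3, k4, k5⟩ := k.nice
  have flS := h.fl
  have aT : a.flC T := by
    simp only [flC, r_V, r_E] at *; grind
  simp only [flD, flC, r_V, r_E, co_V, co_E] at flS hE k1 k2 k3 k4 k5
  have nb : Nice b.co T {p | p ∈ D ∧ p ∈ S} := by
    constructor <;> simp only [co_V, co_E, Set.mem_ofPred_eq]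
    · grind
    · grind
    · grind
    · grind
    · grind
  have P2 := del_peel (N := N.op) cb.co nb.symm (T := Sᶜ) (by simp; grind) (by
    simp only [flC, r_V, r_E, co_V, co_E, Set.mem_compl_iff]; grind)
  rw [← del_symm cb.co nb] at P2
  have nT : Nice (a.r Tᶜ) S C := by
    constructor <;> simp only [r_V, r_E, Set.mem_compl_iff] <;> grind
  have q1 : (a.r S).r T = a.r T := by rw [r_r]; exact r_congr (by simp; grind)
  have q2 : (b.r S).r T = b.r T := by rw [r_r]; exact r_congr (by simp; grind)
  have q3 : (a.r Tᶜ).r S = a.r {p | p ∈ S ∧ p ∉ T} := by rw [r_r]; exact r_congr (by simp; grind)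
  have q4 : (a.r Tᶜ).r Sᶜ = a.r Sᶜ := by rw [r_r]; exact r_congr (by simp; grind)
  have q6 : (a.r S).r Tᶜ = a.r {p | p ∈ S ∧ p ∉ T} := by rw [r_r]; rfl
  have q7 : (b.r S).r Tᶜ = b.r {p | p ∈ S ∧ p ∉ T} := by rw [r_r]; rfl
  have q5 : (b.r {p | p ∈ S ∧ p ∉ T}).disj (b.r Sᶜ) = b.r Tᶜ := by
    apply ext' <;> simp <;> grind
  have kt1 : N.T g1 (a.r T) (b.r T) := op_op_T.1 (by
    rw [← q1, ← q2, co_r (x := b.r S), co_r (x := a.r S)]; exact k.t1)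
  have kt2 : N.T g2 (a.r {p | p ∈ S ∧ p ∉ T}) (b.r {p | p ∈ S ∧ p ∉ T}) :=
    op_op_T.1 (by
      rw [← q6, ← q7, co_r (x := b.r S), co_r (x := a.r S)]; exact k.t2)
  have d1 := del_T (N := N) (c.r _) nT
  rw [q3, q4] at d1
  have j1 : dj (a.r {p | p ∈ S ∧ p ∉ T}) (a.r Sᶜ) := by simp [dj]; grind
  have tg := N.disj_T kt2 h.t2 j1
  have e2 := N.comp_T tg d1
  rw [q5] at e2
  refine ⟨g1, N.comp (N.disj g2 f2) (del N (a.r Tᶜ) S C), op_op_T.2 h.tf, nb, (flD_co _).2 aT,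
    ?_, ?_, ?_⟩
  · rw [← co_r, ← co_r]; exact op_op_T.2 kt1
  · rw [← co_r, ← co_r]; exact op_op_T.2 e2
  · have ke := k.eq
    rw [del_congr (N := N.op) (fun _ _ => Iff.rfl) (C' := {p | p ∈ D ∧ p ∈ S})
      (fun p hp => by simp [hp.2])] at ke
    have dn := del_T (N := N.op) (cb.r S).co knb
    have tn : N.T (del N.op (b.r S).co T {p | p ∈ D ∧ p ∈ S})
      ((b.r T).conj (b.r {p | p ∈ S ∧ p ∉ T})) (b.r S) := by
      rw [← co_r, ← co_r, ← co_conj (dj_r _ _), q2, q7] at dn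
      exact op_op_T.1 dn
    rw [compl_compl, compl_compl, ← del_symm (by rw [← co_r]; exact (cb.r S).co) (by rw [← co_r]; exact knb)] at P2
    have q8 : (b.co.r {p | p ∈ Tᶜ ∧ p ∉ Sᶜ}) = (b.r {p | p ∈ S ∧ p ∉ T}).co := by
      rw [co_r]; apply r_congr; simp; grind
    rw [q8, ← co_r, ← co_r, ← co_r] at P2
    change f = N.comp (del N.op b.co T {p | p ∈ D ∧ p ∈ S}) (N.conj g1 _)
    change del N.op b.co T {p | p ∈ D ∧ p ∈ S} = N.comp (N.disj (N.id (b.r Sᶜ).co.co)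
      (del N.op (b.r S).co T {p | p ∈ D ∧ p ∈ S}))
      (N.d (b.r T).co.co (b.r {p | p ∈ S ∧ p ∉ T}).co.co (b.r Sᶜ).co.co) at P2
    change f1 = N.comp (del N.op (b.r S).co T {p | p ∈ D ∧ p ∈ S}) (N.conj g1 g2) at ke
    simp only [co_co] at P2
    generalize del N.op (b.r S).co T {p | p ∈ D ∧ p ∈ S} = n at *
    rw [h.eq, P, P2, ke]
    have j4 : dj (a.r T) (a.r {p | p ∈ S ∧ p ∉ T}) := by simp [dj]; grind
    have x1 : N.disj (N.comp n (N.conj g1 g2)) f2 =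
        N.comp (N.disj n (N.id (b.r Sᶜ))) (N.disj (N.conj g1 g2) f2) := by
      rw [disj_comp' tn (N.conj_T kt1 kt2 j4) (N.id_T (cb.r _)) h.t2, N.id_comp h.t2]
    have x2 : N.conj g1 (N.comp (N.disj g2 f2) (del N (a.r Tᶜ) S C)) =
        N.comp (N.conj g1 (N.disj g2 f2)) (N.conj (N.id (a.r T)) (del N (a.r Tᶜ) S C)) := by
      rw [conj_comp' kt1 (N.id_T (c.r _)) tg d1, N.comp_id kt1]
    rw [x1, x2, N.disj_comm _ n]
    have dn := N.d_nat kt1 kt2 h.t2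
    simp only [← N.assoc]
    congr 1
    simp only [N.assoc]
    rw [dn]

end Net
end DSC

namespace DSC
open Obj
namespace Net
variable {N : Net}

theorem opLS {f : N.Q} {a b : Obj} {S C : Set ℕ} (h : RS N.op f b.co a.co S C) :
    LS N f a b S C := by
  unfold RS at h
  have : ∀ M : Net, M = N → ∀ f' : M.Q, HEq f' f → LS M f' a b S C → LS N f a b S C := by
    rintro M rfl f' hf hh
    rw [← eq_of_heq hf]; exact hh
  simp only [co_co] at h
  exact this _ (op_op N) f HEq.rfl h

theorem RS.congr {f : N.Q} {a b : Obj} {S C S' C' : Set ℕ}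
    (h : RS N f a b S C) (hS : ∀ p ∈ b.V, p ∈ S ↔ p ∈ S')
    (hC : ∀ p ∈ b.V, p ∈ C ↔ p ∈ C') : RS N f a b S' C' := LS.congr h hS hC

theorem LS.tf {f : N.Q} {a b : Obj} {S C : Set ℕ} (h : LS N f a b S C) : N.T f a b := by
  obtain ⟨_, _, h⟩ := h; exact h.tf
theorem LS.nice {f : N.Q} {a b : Obj} {S C : Set ℕ} (h : LS N f a b S C) : Nice a S C := by
  obtain ⟨_, _, h⟩ := h; exact h.nice
theorem LS.fl {f : N.Q} {a b : Obj} {S C : Set ℕ} (h : LS N f a b S C) : b.flD S := by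
  obtain ⟨_, _, h⟩ := h; exact h.fl
theorem RS.tf {f : N.Q} {a b : Obj} {S C : Set ℕ} (h : RS N f a b S C) : N.T f a b :=
  op_op_T.1 (LS.tf h)
theorem RS.nice {f : N.Q} {a b : Obj} {S C : Set ℕ} (h : RS N f a b S C) : Nice b.co S C :=
  LS.nice h
theorem RS.fl {f : N.Q} {a b : Obj} {S C : Set ℕ} (h : RS N f a b S C) : a.flC S :=
  (flD_co _).1 (LS.fl h)

theorem r_inter {a : Obj} {S T : Set ℕ} : ∀ p ∈ (a.r S).V, p ∈ T ↔ p ∈ T ∩ S := by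
  intro p hp; simp [hp.2]

theorem nestS {f : N.Q} {a b : Obj} {S C T : Set ℕ} {f1 f2 : N.Q}
    (h : LSw N f a b S C f1 f2) (hf : LS N f1 (a.r S) (b.r S) T C) : LS N f a b (T ∩ S) C := by
  have ss := @a.symm
  have hN : Nice a (T ∩ S) C := by
    obtain ⟨h1, h2, h3, h4, h5⟩ := h.nice
    obtain ⟨k1, k2, k3, k4, k5⟩ := hf.nice
    simp only [r_V, r_E] at *
    constructor <;> (try simp only [Set.mem_inter_iff]) <;> grind
  exact nest_LL h (fun p _ hp => hp.2) hN (Or.inl fun _ _ => Iff.rfl)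
    (hf.congr r_inter (fun _ _ => Iff.rfl))

/-- A splitting which does not cut `X`. -/
def UN (N : Net) (f : N.Q) (a b : Obj) (X : Set ℕ) : Prop :=
  ∃ S C, (LS N f a b S C ∨ RS N f a b S C) ∧ ∀ p ∈ a.V, p ∈ X → p ∉ S

theorem nestU {f : N.Q} {a b : Obj} {S C : Set ℕ} {f1 f2 : N.Q}
    (h : LSw N f a b S C f1 f2) (hf : UN N f1 (a.r S) (b.r S) C) : UN N f a b C := by
  have ss := @a.symm
  obtain ⟨T, D, hf, hT⟩ := hf
  have hT' : ∀ p ∈ a.V, p ∈ C → p ∉ T ∩ S := by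
    intro p hp hC h2
    exact hT p ⟨hp, h2.2⟩ hC h2.1
  rcases hf with hf | hf
  · have hN : Nice a (T ∩ S) (D ∩ S) := by
      obtain ⟨h1, h2, h3, h4, h5⟩ := h.nice
      obtain ⟨k1, k2, k3, k4, k5⟩ := hf.nice
      simp only [r_V, r_E, Set.mem_inter_iff] at *
      have : ∀ p ∈ a.V, p ∈ C → p ∈ S → p ∉ D := by grind
      constructor
      · grind
      · grind
      · simp only [Set.mem_inter_iff]; grind
      · simp only [Set.mem_inter_iff]; grind
      · simp only [Set.mem_inter_iff]; grind
    refine ⟨_, _, Or.inl (nest_LL h (fun p _ hp => hp.2) hN (Or.inr ⟨?_, hT'⟩)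
      (hf.congr r_inter r_inter)), hT'⟩
    obtain ⟨h1, h2, h3, h4, h5⟩ := h.nice
    obtain ⟨k1, k2, k3, k4, k5⟩ := hf.nice
    simp only [r_V, r_E, Set.mem_inter_iff] at *
    grind
  · exact ⟨_, _, Or.inr (nest_LR h (fun p _ hp => hp.2) (fun p hp h1 h2 => hT' p hp h2 h1)
      (hf.congr r_inter (fun _ _ => Iff.rfl))), hT'⟩

theorem UN.symm' {f : N.Q} {a b : Obj} {S C X : Set ℕ} (h : LS N f a b S C ∨ RS N f a b S C)
    (hX : ∀ p ∈ a.V, p ∈ X → p ∈ S) : UN N f a b X :=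
  ⟨Sᶜ, C, h.imp LS.symm RS.symm, fun p hp hx => by simpa using hX p hp hx⟩

theorem UN.congr {f : N.Q} {a b : Obj} {X Y : Set ℕ} (h : UN N f a b X)
    (hX : ∀ p ∈ a.V, p ∈ Y → p ∈ X) : UN N f a b Y := by
  obtain ⟨S, C, h, h'⟩ := h
  exact ⟨S, C, h, fun p hp hy => h' p hp (hX p hp hy)⟩

/-- Some splitting exists. -/
def Spl (N : Net) (f : N.Q) (a b : Obj) : Prop := ∃ S C, LS N f a b S C ∨ RS N f a b S C

theorem card_lt {a : Obj} (c : Cog a) {S : Set ℕ} (h : ∃ p, p ∈ a.V ∧ p ∉ S) :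
    (a.r S).V.ncard < a.V.ncard := by
  obtain ⟨p, hp, hpS⟩ := h
  refine Set.ncard_lt_ncard ⟨fun q hq => hq.1, fun hh => hpS (hh hp).2⟩ c.fin

/-- Existence of splittings below size `n`. -/
def EX (N : Net) (n : ℕ) : Prop := ∀ f a b, N.T f a b → a.V.ncard < n →
  (∃ p q, p ∈ a.V ∧ q ∈ a.V ∧ p ≠ q) → Spl N f a b

theorem L2 {n : ℕ} (hE : EX N n) (m : ℕ) : ∀ (f : N.Q) (a b : Obj) (D1 D2 : Set ℕ), N.T f a b →
    a.V.ncard = m → m ≤ n → Spl N f a b → (∀ p ∈ a.V, p ∈ D1 → p ∉ D2) →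
    (∃ p, p ∈ a.V ∧ p ∈ D1) → (∃ p, p ∈ a.V ∧ p ∈ D2) →
    (∀ p q, p ∈ a.V → q ∈ a.V → (p ∈ D1 ∨ p ∈ D2) → q ∉ D1 → q ∉ D2 → a.E p q) →
    (∀ p q, p ∈ a.V → q ∈ a.V → p ∈ D1 → q ∈ D2 → ¬ a.E p q) →
    (∃ S, LS N f a b S (D1 ∪ D2) ∧ (∀ p ∈ a.V, p ∈ D1 → p ∈ S) ∧ (∀ p ∈ a.V, p ∈ D2 → p ∉ S)) ∨
      UN N f a b (D1 ∪ D2) := by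
  induction m using Nat.strong_induction_on with
  | _ m ih =>
    intro f a b D1 D2 hf hm hmn hs hd h1 h2 hin hout
    have ss := @a.symm
    have c := N.src_T hf
    obtain ⟨S, C, hs | hs⟩ := hs
    · by_cases hu1 : ∀ p ∈ a.V, p ∈ D1 ∪ D2 → p ∉ S
      · exact Or.inr ⟨S, C, Or.inl hs, hu1⟩
      by_cases hu2 : ∀ p ∈ a.V, p ∈ D1 ∪ D2 → p ∈ S
      · exact Or.inr (UN.symm' (Or.inl hs) hu2)
      have hC : ∀ p ∈ a.V, p ∈ C ↔ p ∈ D1 ∪ D2 := by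
        obtain ⟨k1, k2, k3, k4, k5⟩ := hs.nice
        simp only [Set.mem_union] at hu1 hu2 ⊢
        have key : ∃ u v, u ∈ a.V ∧ v ∈ a.V ∧ u ∈ D1 ∧ v ∈ D2 ∧ (u ∈ S ∧ v ∉ S ∨ u ∉ S ∧ v ∈ S) := by
          grind
        obtain ⟨u, v, hu, hv, hu1, hv1, huv⟩ := key
        have hne := hout u v hu hv hu1 hv1
        have : u ∈ C := by grind
        have : v ∈ C := by grind
        intro p hp
        grind
      have hs' : LS N f a b S (D1 ∪ D2) := hs.congr (fun _ _ => Iff.rfl) hC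
      by_cases ex1 : (∀ p ∈ a.V, p ∈ D1 → p ∈ S) ∧ (∀ p ∈ a.V, p ∈ D2 → p ∉ S)
      · exact Or.inl ⟨S, hs', ex1⟩
      by_cases ex2 : (∀ p ∈ a.V, p ∈ D1 → p ∉ S) ∧ (∀ p ∈ a.V, p ∈ D2 → p ∈ S)
      · exact Or.inl ⟨Sᶜ, hs'.symm, by simpa using ex2⟩
      -- some side meets both parts
      have side : ∃ S, LS N f a b S (D1 ∪ D2) ∧ (∃ p, p ∈ a.V ∧ p ∈ S ∧ p ∈ D1) ∧
          (∃ p, p ∈ a.V ∧ p ∈ S ∧ p ∈ D2) ∧ (∃ p, p ∈ a.V ∧ p ∉ S ∧ p ∈ D1 ∪ D2) := by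
        by_cases hside : (∃ p, p ∈ a.V ∧ p ∈ S ∧ p ∈ D1) ∧ (∃ p, p ∈ a.V ∧ p ∈ S ∧ p ∈ D2)
        · exact ⟨S, hs', hside.1, hside.2, by grind⟩
        · refine ⟨Sᶜ, hs'.symm, ?_⟩
          simp only [Set.mem_union, Set.mem_compl_iff] at *
          grind
      clear hs hs' ex1 ex2 hu1 hu2 hC S C
      obtain ⟨S, ⟨f1, f2, hs⟩, hS1, hS2, hS3⟩ := side
      -- recursive call on a half
      have hrec : ∀ {S : Set ℕ} {f1 f2 : N.Q} {E1 E2 : Set ℕ}, LSw N f a b S (D1 ∪ D2) f1 f2 →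
          (∀ p ∈ a.V, p ∈ S → (p ∈ D1 ∪ D2 ↔ p ∈ E1 ∪ E2)) →
          (∀ p ∈ a.V, p ∈ S → p ∈ E1 → p ∉ E2) →
          (∀ p q, p ∈ a.V → q ∈ a.V → p ∈ E1 → q ∈ E2 → ¬ a.E p q) →
          (∃ p, p ∈ a.V ∧ p ∈ S ∧ p ∈ E1) → (∃ p, p ∈ a.V ∧ p ∈ S ∧ p ∈ E2) →
          (∃ U, LS N f a b U (D1 ∪ D2) ∧ (∀ p ∈ a.V, p ∈ U → p ∈ S) ∧
            (∀ p ∈ a.V, p ∈ S → p ∈ E1 → p ∈ U) ∧ (∀ p ∈ a.V, p ∈ E2 → p ∉ U)) ∨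
          UN N f a b (D1 ∪ D2) := by
        intro S f1 f2 E1 E2 hs hE12 hE1 hE2 n1 n2
        have lt : (a.r S).V.ncard < a.V.ncard :=
          card_lt c (by obtain ⟨p, hp⟩ := hs.nice.n2; exact ⟨p, hp.1, hp.2.2⟩)
        have sp : Spl N f1 (a.r S) (b.r S) := by
          refine hE _ _ _ hs.t1 (by omega) ?_
          obtain ⟨p, hp, hp1, hp2⟩ := n1
          obtain ⟨q, hq, hq1, hq2⟩ := n2
          refine ⟨p, q, ⟨hp, hp1⟩, ⟨hq, hq1⟩, ?_⟩
          rintro rfl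
          exact hE1 p hp hp1 hp2 hq2
        have hC : ∀ p ∈ (a.r S).V, p ∈ E1 ∪ E2 ↔ p ∈ D1 ∪ D2 := fun p hp => (hE12 p hp.1 hp.2).symm
        rcases ih _ (by omega) f1 (a.r S) (b.r S) E1 E2 hs.t1 rfl (by omega) sp
          (by simp only [r_V]; grind) (by simp only [r_V]; grind) (by simp only [r_V]; grind)
          (by simp only [r_V, r_E]; simp only [Set.mem_union] at *; grind)
          (by simp only [r_V, r_E]; grind) with ⟨U, hU, k1, k2⟩ | hU
        · left
          refine ⟨_, nestS hs (hU.congr (fun _ _ => Iff.rfl) hC), ?_, ?_, ?_⟩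
          · intro p _ h; exact h.2
          · intro p hp h1 h2; exact ⟨k1 p ⟨hp, h1⟩ h2, h1⟩
          · intro p hp h1 h2; exact k2 p ⟨hp, h2.2⟩ h1 h2.1
        · right
          exact nestU hs (hU.congr (fun p hp => (hC p hp).2))
      rcases hrec (E1 := D1) (E2 := D2) hs (fun _ _ _ => Iff.rfl) (fun p hp _ => hd p hp)
        hout hS1 hS2 with ⟨U, hU, k1, k2, k3⟩ | hU
      · by_cases hall : ∀ p ∈ a.V, p ∈ D1 → p ∈ S
        · exact Or.inl ⟨U, hU, fun p hp h => k2 p hp (hall p hp h) h, k3⟩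
        · obtain ⟨g1, g2, hU⟩ := hU.symm
          rcases hrec (E1 := D2) (E2 := D1 \ S) hU (by simp; grind) (by simp; grind)
            (by simp; grind) (by simp; grind) (by simp; grind) with ⟨W, hW, l1, l2, l3⟩ | hW
          · left
            refine ⟨Wᶜ, hW.symm, ?_, ?_⟩
            · simp only [Set.mem_compl_iff, Set.mem_sdiff] at *; grind
            · simp only [Set.mem_compl_iff, Set.mem_sdiff] at *; grind
          · exact Or.inr hW
      · exact Or.inr hU
    · right
      have fl := hs.fl
      simp only [flC] at fl
      by_cases hu1 : ∀ p ∈ a.V, p ∈ D1 ∪ D2 → p ∉ S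
      · exact ⟨S, C, Or.inr hs, hu1⟩
      · refine UN.symm' (Or.inr hs) ?_
        simp only [Set.mem_union] at *
        grind

end Net
end DSC

namespace DSC
open Obj
namespace Net
variable {N : Net}

theorem del_dl {a g1 g2 x y : Obj} {S C : Set ℕ} (ok : Ok4 g1 g2 x y)
    (ha : a = g1.conj (g2.conj (x.disj y)))
    (h1 : ∀ p ∈ g1.V, p ∈ S ∧ p ∉ C) (h2 : ∀ p ∈ g2.V, p ∉ S ∧ p ∉ C)
    (h3 : ∀ p ∈ x.V, p ∈ S ∧ p ∈ C) (h4 : ∀ p ∈ y.V, p ∉ S ∧ p ∈ C) :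
    del N a S C = dl N g1 g2 x y := by
  subst ha
  obtain ⟨c1, c2, c3, c4, h12, h13, h14, h23, h24, h34⟩ := ok
  have i1 := @g1.mem
  have i2 := @g2.mem
  have i3 := @x.mem
  have i4 := @y.mem
  have j1 := @g1.mem'
  have j2 := @g2.mem'
  have j3 := @x.mem'
  have j4 := @y.mem'
  simp only [dj] at *
  unfold del
  congr 1 <;> apply ext' <;> simp <;> grind

theorem nice_dl {a g1 g2 x y : Obj} {S C : Set ℕ} (ok : Ok4 g1 g2 x y)
    (ha : a = g1.conj (g2.conj (x.disj y))) (hx : ∃ p, p ∈ x.V) (hy : ∃ p, p ∈ y.V)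
    (h1 : ∀ p ∈ g1.V, p ∈ S ∧ p ∉ C) (h2 : ∀ p ∈ g2.V, p ∉ S ∧ p ∉ C)
    (h3 : ∀ p ∈ x.V, p ∈ S ∧ p ∈ C) (h4 : ∀ p ∈ y.V, p ∉ S ∧ p ∈ C) :
    Nice a S C := by
  subst ha
  obtain ⟨c1, c2, c3, c4, h12, h13, h14, h23, h24, h34⟩ := ok
  have i1 := @g1.mem
  have i2 := @g2.mem
  have i3 := @x.mem
  have i4 := @y.mem
  have j1 := @g1.mem'
  have j2 := @g2.mem'
  have j3 := @x.mem'
  have j4 := @y.mem'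
  simp only [dj] at *
  constructor <;> (try simp only [conj_V, conj_E, disj_V, disj_E]) <;> grind

theorem LS_pre {f s : N.Q} {a b c : Obj} {S C C' : Set ℕ} {f1 f2 s1 s2 : N.Q}
    (h : LSw N f b c S C f1 f2) (ts : N.T s a b) (hN : Nice a S C')
    (t1 : N.T s1 (a.r S) (b.r S)) (t2 : N.T s2 (a.r Sᶜ) (b.r Sᶜ))
    (e : N.comp (del N b S C) s = N.comp (N.disj s1 s2) (del N a S C')) :
    LS N (N.comp f s) a c S C' := by
  refine ⟨N.comp f1 s1, N.comp f2 s2, N.comp_T h.tf ts, hN, h.fl, N.comp_T h.t1 t1,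
    N.comp_T h.t2 t2, ?_⟩
  rw [h.eq, ← N.assoc, e, N.assoc, disj_comp' h.t1 t1 h.t2 t2]

theorem LS_post {f g : N.Q} {a b c : Obj} {S C : Set ℕ} (h : LS N f a b S C) (tg : N.T g b c) :
    LS N (N.comp g f) a c S C := by
  obtain ⟨f1, f2, h⟩ := h
  obtain ⟨hc, g1, g2, t1, t2, e⟩ := eD tg h.fl
  refine ⟨N.comp g1 f1, N.comp g2 f2, N.comp_T tg h.tf, h.nice, hc, N.comp_T t1 h.t1,
    N.comp_T t2 h.t2, ?_⟩
  rw [h.eq, N.assoc, e, disj_comp' t1 h.t1 t2 h.t2]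

theorem RS_pre {f s : N.Q} {a b c : Obj} {S C : Set ℕ} (h : RS N f b c S C) (ts : N.T s a b) :
    RS N (N.comp f s) a c S C :=
  LS_post (N := N.op) h (op_op_T.2 ts)

/-- Elementary steps. -/
inductive Step (N : Net) : N.Q → Obj → Obj → Prop
  | d (x y z : Obj) : Ok3 x y z → (∃ p, p ∈ y.V) →
      Step N (N.d x y z) (x.conj (y.disj z)) ((x.conj y).disj z)
  | conj (s : N.Q) (a b x : Obj) : Step N s a b → Cog x → dj a x →
      Step N (N.conj s (N.id x)) (a.conj x) (b.conj x)
  | disj (s : N.Q) (a b x : Obj) : Step N s a b → Cog x → dj a x →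
      Step N (N.disj s (N.id x)) (a.disj x) (b.disj x)

theorem Step.T {s : N.Q} {a b : Obj} (h : Step N s a b) : N.T s a b := by
  induction h with
  | d x y z h k => exact N.d_T h k
  | conj s a b x _ c d ih => exact N.conj_T ih (N.id_T c) d
  | disj s a b x _ c d ih => exact N.disj_T ih (N.id_T c) d

inductive Path (N : Net) : N.Q → Obj → Obj → Prop
  | id (x : Obj) : Cog x → Path N (N.id x) x x
  | cons (f s : N.Q) (a b c : Obj) : Path N f b c → Step N s a b → Path N (N.comp f s) a c

theorem Path.T {s : N.Q} {a b : Obj} (h : Path N s a b) : N.T s a b := by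
  induction h with
  | id x c => exact N.id_T c
  | cons f s a b c _ hs ih => exact N.comp_T ih hs.T

theorem Path.comp {f g : N.Q} {a b c : Obj} (hf : Path N f a b) (hg : Path N g b c) :
    Path N (N.comp g f) a c := by
  induction hf with
  | id x cx => rw [N.comp_id hg.T]; exact hg
  | cons f s a b c _ hs ih => rw [N.assoc]; exact .cons _ _ _ _ _ (ih hg) hs

theorem Path.conj {f : N.Q} {a b x : Obj} (hf : Path N f a b) (c : Cog x) (d : dj a x) :
    Path N (N.conj f (N.id x)) (a.conj x) (b.conj x) := by
  induction hf with
  | id y cx => rw [N.conj_id cx c d]; exact .id _ (cx.conj c d)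
  | cons f s a b e hf hs ih =>
    have d' : dj b x := by intro p; rw [← N.V_T hs.T]; exact d p
    rw [← N.id_comp (N.id_T c), ← conj_comp' hf.T hs.T (N.id_T c) (N.id_T c)]
    exact .cons _ _ _ _ _ (ih d') (.conj _ _ _ _ hs c d)

theorem Path.disj {f : N.Q} {a b x : Obj} (hf : Path N f a b) (c : Cog x) (d : dj a x) :
    Path N (N.disj f (N.id x)) (a.disj x) (b.disj x) := by
  induction hf with
  | id y cx => rw [N.disj_id cx c d]; exact .id _ (cx.disj c d)
  | cons f s a b e hf hs ih =>
    have d' : dj b x := by intro p; rw [← N.V_T hs.T]; exact d p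
    rw [← N.id_comp (N.id_T c), ← disj_comp' hf.T hs.T (N.id_T c) (N.id_T c)]
    exact .cons _ _ _ _ _ (ih d') (.disj _ _ _ _ hs c d)

theorem path {f : N.Q} {a b : Obj} (h : N.T f a b) : Path N f a b := by
  refine gen' (Path N) ?_ ?_ ?_ ?_ ?_ h
  · intro x c; exact .id x c
  · intro x y z h k
    rw [← N.id_comp (N.d_T h k)]
    exact .cons _ _ _ _ _ (.id _ (N.tgt_T (N.d_T h k))) (.d _ _ _ h k)
  · intro g f x y z _ _ hg hf; exact hf.comp hg
  · intro f g x y z w tf tg d d' hf hg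
    have d'' : dj y z := by intro p; rw [← N.V_T tf]; exact d p
    have h1 := hf.conj (N.src_T tg) d
    have h2 := hg.conj (N.tgt_T tf) d''.symm
    rw [N.conj_comm, Obj.conj_comm z, Obj.conj_comm w] at h2
    have := h1.comp h2
    rwa [conj_comp' (N.id_T (N.tgt_T tf)) tf tg (N.id_T (N.src_T tg)), N.id_comp tf,
      N.comp_id tg] at this
  · intro f g x y z w tf tg d d' hf hg
    have d'' : dj y z := by intro p; rw [← N.V_T tf]; exact d p
    have h1 := hf.disj (N.src_T tg) d
    have h2 := hg.disj (N.tgt_T tf) d''.symm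
    rw [N.disj_comm, Obj.disj_comm z, Obj.disj_comm w] at h2
    have := h1.comp h2
    rwa [disj_comp' (N.id_T (N.tgt_T tf)) tf tg (N.id_T (N.src_T tg)), N.id_comp tf,
      N.comp_id tg] at this

/-- Normal forms of steps. -/
def NF (N : Net) (s : N.Q) (a b : Obj) : Prop :=
  (a = b ∧ s = N.id a) ∨
  (∃ g x y z, Ok4 g x y z ∧ (∃ p, p ∈ y.V) ∧ (∃ p, p ∈ x.V) ∧ (∃ p, p ∈ z.V) ∧
    a = g.conj (x.conj (y.disj z)) ∧ b = g.conj ((x.conj y).disj z) ∧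
    s = N.conj (N.id g) (N.d x y z)) ∨
  (∃ g t u v y, Ok3 g u y ∧ N.T t u v ∧ (∃ p, p ∈ u.V) ∧ (∃ p, p ∈ y.V) ∧
    a = g.conj (u.disj y) ∧ b = g.conj (v.disj y) ∧ s = N.conj (N.id g) (N.disj t (N.id y)))

theorem Step.nf {s : N.Q} {a b : Obj} (h : Step N s a b) : NF N s a b := by
  induction h with
  | d x y z h k =>
    by_cases hx : ∃ p, p ∈ x.V
    · by_cases hz : ∃ p, p ∈ z.V
      · right; left
        exact ⟨emp, x, y, z, okl4.1 (okl_emp (okl3.2 h)), k, hx, hz, by simp, by simp,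
          by rw [conj_unit']⟩
      · left
        obtain rfl := eq_emp (not_exists.1 hz)
        exact ⟨by simp, by rw [N.d_emp_r h.c1 h.c2 h.h12 k]; simp⟩
    · left
      obtain rfl := eq_emp (not_exists.1 hx)
      exact ⟨by simp, by rw [N.d_emp_l h.c2 h.c3 h.h23 k]; simp⟩
  | conj s a b w hs c d ih =>
    rcases ih with ⟨rfl, rfl⟩ | ⟨g, x, y, z, ok, n1, n2, n3, rfl, rfl, rfl⟩ |
      ⟨g, t, u, v, y, ok, n1, n2, n3, rfl, rfl, rfl⟩
    · left
      exact ⟨rfl, N.conj_id (N.src_T hs.T) c d⟩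
    · right; left
      simp only [dj_conj_left, dj_disj_left] at d
      have ok' : OkL [w, g, x, y, z] := by
        refine Ok4.cons ok c ?_
        simp only [dj_conj_right]
        exact ⟨⟨d.1.symm, d.2.2.1.symm⟩, d.2.1.symm, d.2.2.2.symm⟩
      refine ⟨w.conj g, x, y, z, okl4.1 (okl_conj ok'), n1, n2, n3, ?_, ?_, ?_⟩
      · rw [Obj.conj_comm, Obj.conj_assoc]
      · rw [Obj.conj_comm, Obj.conj_assoc]
      · rw [N.conj_comm, ← N.conj_id c ok.c1 d.1.symm, N.conj_assoc]
    · right; right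
      simp only [dj_conj_left, dj_disj_left] at d
      refine ⟨w.conj g, t, u, v, y, ⟨c.conj ok.c1 d.1.symm, ok.c2, ok.c3, ?_, ?_, ok.h23⟩,
        n1, n2, n3, ?_, ?_, ?_⟩
      · exact dj_conj_left.2 ⟨d.2.1.symm, ok.h12⟩
      · exact dj_conj_left.2 ⟨d.2.2.symm, ok.h13⟩
      · rw [Obj.conj_comm, Obj.conj_assoc]
      · rw [Obj.conj_comm, Obj.conj_assoc]
      · rw [N.conj_comm, ← N.conj_id c ok.c1 d.1.symm, N.conj_assoc]
  | disj s a b w hs c d ih =>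
    by_cases hw : ∃ p, p ∈ w.V
    · by_cases ha : ∃ p, p ∈ a.V
      · right; right
        exact ⟨emp, s, a, b, w, ⟨.emp, N.src_T hs.T, c, fun p h => h.elim, fun p h => h.elim, d⟩,
          hs.T, ha, hw, by simp, by simp, by rw [conj_unit']⟩
      · left
        obtain rfl := eq_emp (not_exists.1 ha)
        obtain ⟨rfl, rfl⟩ := small hs.T (fun p hp => hp.elim)
        exact ⟨by simp, by rw [N.disj_id .emp c d]⟩
    · obtain rfl := eq_emp (not_exists.1 hw)
      rw [N.disj_unit, disj_emp, disj_emp]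
      exact ih

theorem dl_d {g1 g2 x y z : Obj} (ok : OkL [x, g1, g2, y, z]) (hy : ∃ p, p ∈ y.V)
    (hz : ∃ p, p ∈ z.V) :
    N.comp (dl N g1 g2 (x.conj y) z) (N.conj (N.id g1) (N.conj (N.id g2) (N.d x y z))) =
      dl N (g1.conj x) g2 y z := by
  have ok1 : Ok4 x g2 y z := okl4.1 (okl_tail (okl_perm ok (List.Perm.swap _ _ _)))
  have ok2 : OkL [g1, x, g2, y, z] := okl_perm ok (List.Perm.swap _ _ _)
  have ok4 := okl4.1 (okl_tail ok)
  have t1 : N.T (N.d x y z) _ _ := N.d_T ⟨ok1.c1, ok1.c3, ok1.c4, ok1.h13, ok1.h14, ok1.h34⟩ hy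
  have t2 : N.T (N.conj (N.id g2) (N.d x y z)) _ _ := N.conj_T (N.id_T ok4.c2) t1
    (dj_conj_right.2 ⟨ok1.h12.symm, dj_disj_right.2 ⟨ok1.h23, ok1.h24⟩⟩)
  have t3 : N.T (N.d g2 z (x.conj y)) _ _ := N.d_T ⟨ok1.c2, ok1.c4, ok1.c1.conj ok1.c3 ok1.h13,
    ok1.h24, dj_conj_right.2 ⟨ok1.h12.symm, ok1.h23⟩, dj_conj_right.2 ⟨ok1.h14.symm, ok1.h34.symm⟩⟩ hz
  rw [Obj.disj_comm z] at t3
  have k := N.dBConj (a := x) (b := y) (c := z) (e := g2)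
    ⟨ok1.c1, ok1.c3, ok1.c4, ok1.c2, ok1.h13, ok1.h14, ok1.h12, ok1.h34, ok1.h23.symm,
      ok1.h24.symm⟩ hy hz
  rw [dl_peel ok2 hy hz]
  conv_lhs => unfold dl
  rw [← N.assoc, ← conj_id_comp ok4.c1 t3 t2, N.conj_comm (N.id g2), k, Obj.conj_comm z]
  rfl

theorem id2 {g : Obj} {S : Set ℕ} (c : Cog g) (h : g.flC S) :
    N.id g = N.conj (N.id (g.r S)) (N.id (g.r Sᶜ)) := by
  rw [N.conj_id (c.r _) (c.r _) (dj_r _ _), h.eq]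

theorem id4 {g1 g2 x y : Obj} (ok : Ok4 g1 g2 x y) :
    N.id (g1.conj (g2.conj (x.disj y))) =
      N.conj (N.id g1) (N.conj (N.id g2) (N.disj (N.id x) (N.id y))) := by
  obtain ⟨c1, c2, c3, c4, h12, h13, h14, h23, h24, h34⟩ := ok
  rw [N.disj_id c3 c4 h34, N.conj_id c2 (c3.disj c4 h34) (dj_disj_right.2 ⟨h23, h24⟩),
    N.conj_id c1 (c2.conj (c3.disj c4 h34) (dj_disj_right.2 ⟨h23, h24⟩))
      (dj_conj_right.2 ⟨h12, dj_disj_right.2 ⟨h13, h14⟩⟩)]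

end Net
end DSC

namespace DSC
open Obj
namespace Net
variable {N : Net}

theorem r_sub {x y : Obj} {S : Set ℕ} (hx : ∀ p ∈ x.V, p ∈ S) (hy : ∀ p ∈ y.V, p ∉ S) :
    (x.disj y).r S = x ∧ (x.disj y).r Sᶜ = y := by
  have i3 := @x.mem
  have i4 := @y.mem
  have j3 := @x.mem'
  have j4 := @y.mem'
  constructor <;> apply ext' <;> simp <;> grind

theorem pre_un {f t : N.Q} {g u v c : Obj} {S C : Set ℕ} (cg : Cog g) (t1 : N.T t u v)
    (d : dj g u) (h : LS N f (g.conj v) c S C) (hv : ∀ p ∈ v.V, p ∉ S) :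
    LS N (N.comp f (N.conj (N.id g) t)) (g.conj u) c S C := by
  obtain ⟨f1, f2, h⟩ := h
  have hV := N.V_T t1
  have d' : dj g v := by intro p; rw [← hV]; exact d p
  obtain ⟨n1, n2, e1, e2, e3⟩ := id h.nice
  have hvC : ∀ p ∈ v.V, p ∉ C := by
    obtain ⟨q, hq1, hq2, hq3⟩ := n1
    intro p hp hC
    have hq : q ∈ g.V := by rcases hq1 with h | h; exact h; exact (hv q h hq3).elim
    exact e3 q p (Or.inl hq) (Or.inr hp) hq2 hq3 hC (hv p hp)
      (Or.inr (Or.inr ⟨by rintro rfl; exact d' _ hq hp, Or.inl ⟨hq, hp⟩⟩))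
  have hN : Nice g S C := by
    have := @v.mem
    have := @v.mem'
    simp only [conj_V, conj_E, dj] at *
    constructor <;> grind
  have ok := del_ok cg S C
  have du : ∀ T : Set ℕ, dj (g.r T) u := fun T p h1 h2 => d p h1.1 h2
  have dv : ∀ T : Set ℕ, dj (g.r T) v := fun T p h1 h2 => d' p h1.1 h2
  have oku : Ok4 (g.r {p | p ∈ S ∧ p ∉ C}) ((g.r {p | p ∉ S ∧ p ∉ C}).conj u)
      (g.r {p | p ∈ C ∧ p ∈ S}) (g.r {p | p ∈ C ∧ p ∉ S}) := by
    rw [Obj.conj_comm]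
    exact Ok4.add' ok (N.src_T t1) ⟨dj_conj_right.2 ⟨(du _).symm, (du _).symm⟩,
      dj_conj_right.2 ⟨(du _).symm, (du _).symm⟩⟩
  have okv : Ok4 (g.r {p | p ∈ S ∧ p ∉ C}) ((g.r {p | p ∉ S ∧ p ∉ C}).conj v)
      (g.r {p | p ∈ C ∧ p ∈ S}) (g.r {p | p ∈ C ∧ p ∉ S}) := by
    rw [Obj.conj_comm]
    exact Ok4.add' ok (N.tgt_T t1) ⟨dj_conj_right.2 ⟨(dv _).symm, (dv _).symm⟩,
      dj_conj_right.2 ⟨(dv _).symm, (dv _).symm⟩⟩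
  have src : ∀ u : Obj, g.conj u = (g.r {p | p ∈ S ∧ p ∉ C}).conj
      (((g.r {p | p ∉ S ∧ p ∉ C}).conj u).conj
      ((g.r {p | p ∈ C ∧ p ∈ S}).disj (g.r {p | p ∈ C ∧ p ∉ S}))) := by
    intro u
    conv_lhs => rw [← hN.src]
    rw [Obj.conj_assoc, Obj.conj_assoc, Obj.conj_assoc, Obj.conj_comm u]
  have k1 := del_dl (N := N) (S := S) (C := C) oku (src u) (by simp) (by simp; grind) (by simp; grind)
    (by simp; grind)
  have k2 := del_dl (N := N) (S := S) (C := C) okv (src v) (by simp) (by simp; grind) (by simp; grind)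
    (by simp; grind)
  have k3 := nice_dl (S := S) (C := C) oku (src u) hN.x hN.y (by simp) (by simp; grind) (by simp; grind)
    (by simp; grind)
  have e : N.conj (N.id g) t = N.conj (N.id (g.r {p | p ∈ S ∧ p ∉ C}))
      (N.conj (N.conj (N.id (g.r {p | p ∉ S ∧ p ∉ C})) t)
        (N.disj (N.id (g.r {p | p ∈ C ∧ p ∈ S})) (N.id (g.r {p | p ∈ C ∧ p ∉ S})))) := by
    conv_lhs => rw [← hN.src]
    rw [id4 ok, N.conj_assoc, N.conj_assoc, N.conj_assoc, N.conj_comm _ t]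
  have tt : N.T (N.conj (N.id (g.r {p | p ∉ S ∧ p ∉ C})) t) _ _ :=
    N.conj_T (N.id_T ok.c2) t1 (du _)
  have nat := dl_nat (N := N) oku hN.y (N.id_T ok.c1) tt (N.id_T ok.c3) (N.id_T ok.c4)
  refine LS_pre h (N.conj_T (N.id_T cg) t1 d) k3 (s1 := N.id (g.r S)) (s2 := N.conj (N.id (g.r Sᶜ)) t)
    ?_ ?_ ?_
  · have e1 : (g.conj u).r S = g.r S := by
      have := @u.mem
      have := @u.mem'
      apply ext' <;> simp <;> grind
    have e2 : (g.conj v).r S = g.r S := by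
      have := @v.mem
      have := @v.mem'
      apply ext' <;> simp <;> grind
    rw [e1, e2]
    exact N.id_T (cg.r _)
  · have e1 : ∀ u : Obj, (∀ p ∈ u.V, p ∉ S) → (g.conj u).r Sᶜ = (g.r Sᶜ).conj u := by
      intro u hv
      have := @u.mem
      have := @u.mem'
      apply ext' <;> simp <;> grind
    rw [e1 _ hv, e1 _ (hV ▸ hv)]
    exact N.conj_T (N.id_T (cg.r _)) t1 (du _)
  · rw [k1, k2, e, ← nat, N.conj_id ok.c1 ok.c3 ok.h13, N.conj_comm _ t, N.conj_assoc,
      N.conj_id ok.c2 ok.c4 ok.h24, hN.t1, hN.t2, N.conj_comm t]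

theorem pre_ex {f : N.Q} {g v y c : Obj} {S : Set ℕ} (ok : Ok3 g v y)
    (h : LS N f (g.conj (v.disj y)) c S (v.V ∪ y.V))
    (hv : ∀ p ∈ v.V, p ∈ S) (hy : ∀ p ∈ y.V, p ∉ S) :
    g.flC S ∧ del N (g.conj (v.disj y)) S (v.V ∪ y.V) = dl N (g.r S) (g.r Sᶜ) v y ∧
      Ok4 (g.r S) (g.r Sᶜ) v y := by
  obtain ⟨m1, m2, e1, e2, e3⟩ := id h.nice
  have o1 := ok.h12
  have o2 := ok.h13
  have o3 := ok.h23
  have hg : g.flC S := by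
    have := @v.mem
    have := @v.mem'
    have := @y.mem
    have := @y.mem'
    simp only [conj_V, conj_E, disj_V, disj_E, dj, Set.mem_union] at *
    intro p hp q hq h1 h2
    grind
  have ok4 : Ok4 (g.r S) (g.r Sᶜ) v y := ⟨ok.c1.r _, ok.c1.r _, ok.c2, ok.c3, dj_r _ _,
    fun p h1 h2 => ok.h12 p h1.1 h2, fun p h1 h2 => ok.h13 p h1.1 h2,
    fun p h1 h2 => ok.h12 p h1.1 h2, fun p h1 h2 => ok.h13 p h1.1 h2, ok.h23⟩
  refine ⟨hg, del_dl ok4 ?_ ?_ ?_ ?_ ?_, ok4⟩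
  · conv_lhs => rw [← hg.eq]
    rw [Obj.conj_assoc]
  all_goals simp only [r_V, Set.mem_union, Set.mem_compl_iff, dj] at *
  all_goals grind

theorem pre_disj {f t : N.Q} {g u v y c : Obj} {S : Set ℕ} (ok : Ok3 g u y) (t1 : N.T t u v)
    (n1 : ∃ p, p ∈ u.V) (n2 : ∃ p, p ∈ y.V)
    (h : LS N f (g.conj (v.disj y)) c S (v.V ∪ y.V))
    (hv : ∀ p ∈ v.V, p ∈ S) (hy : ∀ p ∈ y.V, p ∉ S) :
    LS N (N.comp f (N.conj (N.id g) (N.disj t (N.id y)))) (g.conj (u.disj y)) c S (v.V ∪ y.V) := by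
  have hV := N.V_T t1
  have ok' : Ok3 g v y := ⟨ok.c1, N.tgt_T t1, ok.c3, by intro p; rw [← hV]; exact ok.h12 p,
    ok.h13, by intro p; rw [← hV]; exact ok.h23 p⟩
  obtain ⟨hg, k2, okv⟩ := pre_ex ok' h hv hy
  have oku : Ok4 (g.r S) (g.r Sᶜ) u y := ⟨ok.c1.r _, ok.c1.r _, ok.c2, ok.c3, dj_r _ _,
    fun p h1 h2 => ok.h12 p h1.1 h2, fun p h1 h2 => ok.h13 p h1.1 h2,
    fun p h1 h2 => ok.h12 p h1.1 h2, fun p h1 h2 => ok.h13 p h1.1 h2, ok.h23⟩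
  have src : ∀ u : Obj, g.conj (u.disj y) = (g.r S).conj ((g.r Sᶜ).conj (u.disj y)) := by
    intro u
    conv_lhs => rw [← hg.eq]
    rw [Obj.conj_assoc]
  have o1 := ok.h12
  have o2 := ok.h13
  have hu : ∀ p ∈ u.V, p ∈ S := hV ▸ hv
  have c1 : ∀ p ∈ (g.r S).V, p ∈ S ∧ p ∉ (v.V ∪ y.V) := by
    simp only [r_V, Set.mem_union, dj, ← hV] at *; grind
  have c2 : ∀ p ∈ (g.r Sᶜ).V, p ∉ S ∧ p ∉ (v.V ∪ y.V) := by
    simp only [r_V, Set.mem_union, dj, ← hV, Set.mem_compl_iff] at *; grind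
  have c3 : ∀ p ∈ u.V, p ∈ S ∧ p ∈ (v.V ∪ y.V) := by
    simp only [Set.mem_union, ← hV] at *; grind
  have c4 : ∀ p ∈ y.V, p ∉ S ∧ p ∈ (v.V ∪ y.V) := by
    simp only [Set.mem_union, ← hV] at *; grind
  have k1 := del_dl (N := N) (S := S) (C := v.V ∪ y.V) oku (src u) c1 c2 c3 c4
  have k3 := nice_dl (S := S) (C := v.V ∪ y.V) oku (src u) n1 n2 c1 c2 c3 c4
  have nat := dl_nat (N := N) oku n2 (N.id_T oku.c1) (N.id_T oku.c2) t1 (N.id_T oku.c4)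
  obtain ⟨f1, f2, h⟩ := h
  have tgt : ∀ u : Obj, (∀ p ∈ u.V, p ∈ S) → (g.conj (u.disj y)).r S = (g.r S).conj u ∧
      (g.conj (u.disj y)).r Sᶜ = (g.r Sᶜ).conj y := by
    intro u hu
    rw [r_conj, r_conj, (r_sub hu hy).1, (r_sub hu hy).2]; exact ⟨rfl, rfl⟩
  refine LS_pre h (N.conj_T (N.id_T ok.c1) (N.disj_T t1 (N.id_T ok.c3) ok.h23)
    (dj_disj_right.2 ⟨o1, o2⟩)) k3 (s1 := N.conj (N.id (g.r S)) t)
    (s2 := N.conj (N.id (g.r Sᶜ)) (N.id y)) ?_ ?_ ?_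
  · rw [(tgt u hu).1, (tgt v hv).1]
    exact N.conj_T (N.id_T oku.c1) t1 oku.h13
  · rw [(tgt u hu).2, (tgt v hv).2]
    exact N.conj_T (N.id_T oku.c2) (N.id_T ok.c3) oku.h24
  · rw [k1, k2, id2 ok.c1 hg, N.conj_assoc, ← nat]

theorem pre_d {f : N.Q} {g x y z c : Obj} {S : Set ℕ} (ok : Ok4 g x y z)
    (n1 : ∃ p, p ∈ y.V) (n3 : ∃ p, p ∈ z.V)
    (h : LS N f (g.conj ((x.conj y).disj z)) c S ((x.conj y).V ∪ z.V))
    (hv : ∀ p ∈ (x.conj y).V, p ∈ S) (hy : ∀ p ∈ z.V, p ∉ S) :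
    LS N (N.comp f (N.conj (N.id g) (N.d x y z))) (g.conj (x.conj (y.disj z))) c S
      (y.V ∪ z.V) := by
  obtain ⟨p0, hp0⟩ := n1
  have ok' : Ok3 g (x.conj y) z := ⟨ok.c1, ok.c2.conj ok.c3 ok.h23, ok.c4,
    dj_conj_right.2 ⟨ok.h12, ok.h13⟩, ok.h14, dj_conj_left.2 ⟨ok.h24, ok.h34⟩⟩
  obtain ⟨hg, k2, okv⟩ := pre_ex ok' h hv hy
  have oku : OkL [x, g.r S, g.r Sᶜ, y, z] := by
    refine Ok4.cons ⟨ok.c1.r _, ok.c1.r _, ok.c3, ok.c4, dj_r _ _,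
      fun p h1 h2 => ok.h13 p h1.1 h2, fun p h1 h2 => ok.h14 p h1.1 h2,
      fun p h1 h2 => ok.h13 p h1.1 h2, fun p h1 h2 => ok.h14 p h1.1 h2, ok.h34⟩ ok.c2 ?_
    simp only [dj_conj_right]
    exact ⟨⟨fun p h1 h2 => ok.h12 p h2.1 h1, ok.h23⟩, fun p h1 h2 => ok.h12 p h2.1 h1, ok.h24⟩
  have k0 := dl_d (N := N) oku ⟨p0, hp0⟩ n3
  have oku' := okl4.1 (okl_conj (okl_perm oku (List.Perm.swap _ _ _)))
  have src : g.conj (x.conj (y.disj z)) =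
      ((g.r S).conj x).conj ((g.r Sᶜ).conj (y.disj z)) := by
    conv_lhs => rw [← hg.eq]
    rw [Obj.conj_assoc, Obj.conj_assoc, ← Obj.conj_assoc x, ← Obj.conj_assoc _ x,
      Obj.conj_comm x]
  obtain ⟨i1, i2, i3, i4, o1, o2, o3, o4, o5, o6⟩ := id ok
  have c1 : ∀ p ∈ ((g.r S).conj x).V, p ∈ S ∧ p ∉ (y.V ∪ z.V) := by
    simp only [r_V, Set.mem_union, dj, conj_V] at *; grind
  have c2 : ∀ p ∈ (g.r Sᶜ).V, p ∉ S ∧ p ∉ (y.V ∪ z.V) := by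
    simp only [r_V, Set.mem_union, dj, Set.mem_compl_iff] at *; grind
  have c3 : ∀ p ∈ y.V, p ∈ S ∧ p ∈ (y.V ∪ z.V) := by
    simp only [Set.mem_union, conj_V] at *; grind
  have c4 : ∀ p ∈ z.V, p ∉ S ∧ p ∈ (y.V ∪ z.V) := by
    simp only [Set.mem_union] at *; grind
  have k1 := del_dl (N := N) (S := S) (C := y.V ∪ z.V) oku' src c1 c2 c3 c4
  have k3 := nice_dl (S := S) (C := y.V ∪ z.V) oku' src ⟨p0, hp0⟩ n3 c1 c2 c3 c4
  obtain ⟨f1, f2, h⟩ := h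
  have tgt1 : (g.conj ((x.conj y).disj z)).r S = (g.r S).conj (x.conj y) ∧
      (g.conj ((x.conj y).disj z)).r Sᶜ = (g.r Sᶜ).conj z := by
    rw [r_conj, r_conj, (r_sub hv hy).1, (r_sub hv hy).2]; exact ⟨rfl, rfl⟩
  have tgt2 : (g.conj (x.conj (y.disj z))).r S = (g.r S).conj (x.conj y) ∧
      (g.conj (x.conj (y.disj z))).r Sᶜ = (g.r Sᶜ).conj z := by
    have hv' : ∀ p ∈ y.V, p ∈ S := fun p hp => hv p (Or.inr hp)
    rw [r_conj, r_conj, r_conj, r_conj, (r_sub hv' hy).1, (r_sub hv' hy).2,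
      r_self (x := x) (fun p hp => hv p (Or.inl hp)), r_none (x := x) (S := Sᶜ)
      (fun p hp h => h (hv p (Or.inl hp))), emp_conj]; exact ⟨rfl, rfl⟩
  have td : N.T (N.d x y z) _ _ := N.d_T ⟨i2, i3, i4, o4, o5, o6⟩ ⟨p0, hp0⟩
  have cc : Cog (g.conj ((x.conj y).disj z)) := N.src_T h.tf
  refine LS_pre h (N.conj_T (N.id_T ok.c1) td
    (dj_conj_right.2 ⟨o1, dj_disj_right.2 ⟨o2, o3⟩⟩)) k3
    (s1 := N.id ((g.conj ((x.conj y).disj z)).r S))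
    (s2 := N.id ((g.conj ((x.conj y).disj z)).r Sᶜ)) ?_ ?_ ?_
  · rw [tgt2.1, tgt1.1, ← tgt1.1]; exact N.id_T (cc.r _)
  · rw [tgt2.2, tgt1.2, ← tgt1.2]; exact N.id_T (cc.r _)
  · rw [k2, id2 ok.c1 hg, N.conj_assoc, k0, ← k1, N.disj_id (cc.r _) (cc.r _) (dj_r _ _),
      tgt1.1, tgt1.2, ← tgt2.1, ← tgt2.2, N.id_comp (del_T (N.src_T (N.conj_T (N.id_T ok.c1) td
    (dj_conj_right.2 ⟨o1, dj_disj_right.2 ⟨o2, o3⟩⟩))) k3)]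

theorem ex_step {n : ℕ} (hE : EX N n) {f : N.Q} {a b : Obj} (hf : Path N f a b)
    (hn : a.V.ncard ≤ n) (h2 : ∃ p q, p ∈ a.V ∧ q ∈ a.V ∧ p ≠ q) : Spl N f a b := by
  induction hf with
  | id x c =>
    obtain ⟨p, q, hp, hq, hpq⟩ := h2
    obtain ⟨S, h1, h2, h | h⟩ := c.split hp hq hpq
    · exact ⟨_, _, Or.inr (RS_flat (N.id_T c) h h1 h2)⟩
    · exact ⟨_, _, Or.inl (LS_flat (N.id_T c) h h1 h2)⟩
  | cons f s a b c hf hs ih =>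
    have hV := N.V_T hs.T
    have ih := ih (hV ▸ hn) (hV ▸ h2)
    have ts := hs.T
    have tf := hf.T
    have key : ∀ {g v w : Obj}, Ok3 g v w → b = g.conj (v.disj w) → (∃ p, p ∈ v.V) →
        (∃ p, p ∈ w.V) → (∃ S, LS N f b c S (v.V ∪ w.V) ∧ (∀ p ∈ v.V, p ∈ S) ∧
          (∀ p ∈ w.V, p ∉ S)) ∨ UN N f b c (v.V ∪ w.V) := by
      intro g v w ok hb n1 n2
      have o1 := ok.h12
      have o2 := ok.h13
      have o3 := ok.h23
      have i1 := @g.mem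
      have i2 := @g.mem'
      have i3 := @v.mem
      have i4 := @v.mem'
      have i5 := @w.mem
      have i6 := @w.mem'
      have := L2 hE _ f b c v.V w.V tf rfl (hV ▸ hn) ih (fun p _ h1 h2 => ok.h23 p h1 h2)
        (by subst hb; simp; grind) (by subst hb; simp; grind)
        (by subst hb; simp only [conj_V, conj_E, disj_V, disj_E, dj] at *; grind)
        (by subst hb; simp only [conj_V, conj_E, disj_V, disj_E, dj] at *; grind)
      rcases this with ⟨S, h, h3, h4⟩ | h
      · left
        exact ⟨S, h, fun p hp => h3 p (by subst hb; exact Or.inr (Or.inl hp)) hp,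
          fun p hp => h4 p (by subst hb; exact Or.inr (Or.inr hp)) hp⟩
      · exact Or.inr h
    rcases hs.nf with ⟨rfl, rfl⟩ | ⟨g, x, y, z, ok, n1, n2, n3, rfl, rfl, rfl⟩ |
      ⟨g, t, u, v, y, ok, tt, n1, n2, rfl, rfl, rfl⟩
    · rw [N.comp_id tf]; exact ih
    · obtain ⟨p0, hp0⟩ := n1
      have ok' : Ok3 g (x.conj y) z := ⟨ok.c1, ok.c2.conj ok.c3 ok.h23, ok.c4,
        dj_conj_right.2 ⟨ok.h12, ok.h13⟩, ok.h14, dj_conj_left.2 ⟨ok.h24, ok.h34⟩⟩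
      have td : N.T (N.d x y z) _ _ :=
        N.d_T ⟨ok.c2, ok.c3, ok.c4, ok.h23, ok.h24, ok.h34⟩ ⟨p0, hp0⟩
      rcases key ok' rfl ⟨p0, Or.inr hp0⟩ n3 with ⟨S, h, h3, h4⟩ | ⟨S, C, h | h, hS⟩
      · exact ⟨_, _, Or.inl (pre_d ok ⟨p0, hp0⟩ n3 h h3 h4)⟩
      · exact ⟨_, _, Or.inl (pre_un ok.c1 td (dj_conj_right.2 ⟨ok.h12,
          dj_disj_right.2 ⟨ok.h13, ok.h14⟩⟩) h (fun p hp => hS p (Or.inr hp) hp))⟩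
      · exact ⟨_, _, Or.inr (RS_pre h ts)⟩
    · have hVt := N.V_T tt
      have ok' : Ok3 g v y := ⟨ok.c1, N.tgt_T tt, ok.c3, by intro p; rw [← hVt]; exact ok.h12 p,
        ok.h13, by intro p; rw [← hVt]; exact ok.h23 p⟩
      rcases key ok' rfl (hVt ▸ n1) n2 with ⟨S, h, h3, h4⟩ | ⟨S, C, h | h, hS⟩
      · exact ⟨_, _, Or.inl (pre_disj ok tt n1 n2 h h3 h4)⟩
      · exact ⟨_, _, Or.inl (pre_un ok.c1 (N.disj_T tt (N.id_T ok.c3) ok.h23)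
          (dj_disj_right.2 ⟨ok.h12, ok.h13⟩) h (fun p hp => hS p (Or.inr hp) hp))⟩
      · exact ⟨_, _, Or.inr (RS_pre h ts)⟩

theorem ex_all (n : ℕ) : EX N n := by
  induction n with
  | zero => intro f a b _ h; omega
  | succ n ih =>
    intro f a b hf hn h2
    exact ex_step ih (path hf) (by omega) h2

theorem spl {f : N.Q} {a b : Obj} (hf : N.T f a b)
    (h2 : ∃ p q, p ∈ a.V ∧ q ∈ a.V ∧ p ≠ q) : Spl N f a b :=
  ex_all (a.V.ncard + 1) f a b hf (by omega) h2

end Net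
end DSC

namespace DSC
open Obj
namespace Net
variable {N : Net}

/-- Connectedness below size `n`. -/
def CN (N : Net) (n : ℕ) : Prop := ∀ f a b (S : Set ℕ), N.T f a b → a.V.ncard < n →
  (∃ p, p ∈ a.V ∧ p ∈ S) → (∃ p, p ∈ a.V ∧ p ∉ S) → a.flC S → b.flD S → False

theorem flC_r {a : Obj} {S : Set ℕ} (U : Set ℕ) (h : a.flC S) : (a.r U).flC S := by
  intro p hp q hq h1 h2
  exact ⟨h p hp.1 q hq.1 h1 h2, hp.2, hq.2⟩
theorem flD_r {a : Obj} {S : Set ℕ} (U : Set ℕ) (h : a.flD S) : (a.r U).flD S := by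
  intro p hp q hq h1 h2 h3
  exact h p hp.1 q hq.1 h1 h2 h3.1

theorem conn_L {n : ℕ} (ih : CN N n) {f : N.Q} {a b : Obj} {S U C : Set ℕ} (h : LS N f a b U C)
    (hn : a.V.ncard ≤ n) (h1 : ∃ p, p ∈ a.V ∧ p ∈ S) (h2 : ∃ p, p ∈ a.V ∧ p ∉ S)
    (ha : a.flC S) (hb : b.flD S) : False := by
  obtain ⟨f1, f2, h⟩ := h
  have c := N.src_T h.tf
  obtain ⟨n1, n2, e1, e2, e3⟩ := h.nice
  have l1 := card_lt c (S := U) (by grind)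
  have l2 := card_lt c (S := Uᶜ) (by simp; grind)
  have k1 : ¬ ((∃ p, p ∈ a.V ∧ p ∈ U ∧ p ∈ S) ∧ (∃ p, p ∈ a.V ∧ p ∈ U ∧ p ∉ S)) := by
    rintro ⟨⟨p, h1, h2, h3⟩, ⟨q, h4, h5, h6⟩⟩
    exact ih f1 _ _ S h.t1 (by omega) ⟨p, ⟨h1, h2⟩, h3⟩ ⟨q, ⟨h4, h5⟩, h6⟩ (flC_r _ ha) (flD_r _ hb)
  have k2 : ¬ ((∃ p, p ∈ a.V ∧ p ∉ U ∧ p ∈ S) ∧ (∃ p, p ∈ a.V ∧ p ∉ U ∧ p ∉ S)) := by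
    rintro ⟨⟨p, h1, h2, h3⟩, ⟨q, h4, h5, h6⟩⟩
    exact ih f2 _ _ S h.t2 (by omega) ⟨p, ⟨h1, h2⟩, h3⟩ ⟨q, ⟨h4, h5⟩, h6⟩ (flC_r _ ha) (flD_r _ hb)
  have ss := @a.symm
  simp only [flC] at ha
  obtain ⟨p, hp1, hp2, hp3⟩ := n1
  obtain ⟨q, hq1, hq2, hq3⟩ := n2
  have := e3 p q hp1 hq1 hp2 hp3 hq2 hq3
  have : p ∈ S ↔ q ∈ S := by grind
  grind

theorem conn (n : ℕ) : ∀ N : Net, CN N n := by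
  induction n with
  | zero => intro N f a b S _ h; omega
  | succ n ih =>
    intro N f a b S hf hn h1 h2 ha hb
    obtain ⟨p, hp, hpS⟩ := id h1
    obtain ⟨q, hq, hqS⟩ := id h2
    have hV := N.V_T hf
    obtain ⟨U, C, h | h⟩ := spl hf ⟨p, q, hp, hq, by rintro rfl; exact hqS hpS⟩
    · exact conn_L (ih N) h (by omega) h1 h2 ha hb
    · exact conn_L (ih N.op) h (by simp [← hV]; omega) (by simpa [← hV] using h1)
        (by simpa [← hV] using h2) ((flC_co _).2 hb) ((flD_co _).2 ha)

theorem con {f : N.Q} {a b : Obj} {S : Set ℕ} (hf : N.T f a b) (h1 : ∃ p, p ∈ a.V ∧ p ∈ S)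
    (h2 : ∃ p, p ∈ a.V ∧ p ∉ S) (ha : a.flC S) (hb : b.flD S) : False :=
  conn (a.V.ncard + 1) N f a b S hf (by omega) h1 h2 ha hb

/-- Splitting along any compatible pair, below size `n`. -/
def KK (N : Net) (n : ℕ) : Prop := ∀ f a b (T D : Set ℕ), N.T f a b → a.V.ncard < n →
  Nice a T D → b.flD T → LS N f a b T D

theorem nice_uniq {a : Obj} {S C D : Set ℕ} (h : Nice a S C) (k : Nice a S D) :
    ∀ p ∈ a.V, p ∈ C ↔ p ∈ D := by
  obtain ⟨n1, n2, e1, e2, e3⟩ := h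
  obtain ⟨m1, m2, i1, i2, i3⟩ := k
  have ss := @a.symm
  intro p hp
  by_cases hS : p ∈ S <;> grind

theorem K_LL {n : ℕ} (ih : KK N n) {f : N.Q} {a b : Obj} {S C T D : Set ℕ} (h : LS N f a b S C)
    (hn : a.V.ncard ≤ n) (hT : Nice a T D) (hb : b.flD T) (hTS : ∀ p ∈ a.V, p ∈ T → p ∈ S) :
    LS N f a b T D := by
  have ss := @a.symm
  by_cases heq : ∀ p ∈ a.V, p ∈ S → p ∈ T
  · have hs : ∀ p ∈ a.V, p ∈ S ↔ p ∈ T := fun p hp => ⟨heq p hp, hTS p hp⟩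
    have := h.congr hs (fun _ _ => Iff.rfl)
    exact this.congr (fun _ _ => Iff.rfl) (nice_uniq this.nice hT)
  · obtain ⟨f1, f2, h⟩ := h
    have c := N.src_T h.tf
    obtain ⟨n1, n2, e1, e2, e3⟩ := id h.nice
    obtain ⟨m1, m2, i1, i2, i3⟩ := id hT
    have l1 := card_lt c (S := S) (by grind)
    by_cases hq : ∃ q, q ∈ a.V ∧ q ∈ D ∧ q ∉ S
    · obtain ⟨q, hq1, hq2, hq3⟩ := hq
      obtain ⟨p, hp1, hp2, hp3⟩ := id m1
      have hqT : q ∉ T := fun h => hq3 (hTS q hq1 h)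
      have hpq := i3 p q hp1 hq1 hp2 hp3 hq2 hqT
      have hpS := hTS p hp1 hp3
      have hpC : p ∈ C := by grind
      have hqC : q ∈ C := by grind
      have hCD : ∀ p ∈ a.V, p ∈ C ↔ p ∈ D := by
        intro r hr
        constructor
        · intro h1
          by_contra h2
          by_cases hS : r ∈ S <;> grind
        · intro h1
          by_contra h2
          by_cases hS : r ∈ T <;> grind
      by_cases hx : ∃ r, r ∈ a.V ∧ r ∈ C ∧ r ∈ S ∧ r ∉ T
      · have hN : Nice (a.r S) T D := by
          constructor <;> simp only [r_V, r_E] <;> grind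
        exact nest_LL h hTS hT (Or.inl hCD) (ih _ _ _ _ _ h.t1 (by omega) hN (flD_r _ hb))
      · exfalso
        refine con (S := T) h.t1 ?_ ?_ ?_ (flD_r _ hb)
        · exact ⟨p, ⟨hp1, hpS⟩, hp3⟩
        · simp only [r_V]; grind
        · intro u hu v hv h1 h2
          simp only [r_V, r_E] at *
          grind
    · have hN : Nice (a.r S) T D := by
        constructor <;> simp only [r_V, r_E] <;> grind
      refine nest_LL h hTS hT (Or.inr ⟨?_, ?_⟩) (ih _ _ _ _ _ h.t1 (by omega) hN (flD_r _ hb))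
      · obtain ⟨s, hs1, hs2, hs3⟩ := n2
        intro p hp h1 h2
        grind
      · obtain ⟨s, hs1, hs2, hs3⟩ := n2
        have hD : ∀ p ∈ a.V, p ∈ C → p ∉ D := by
          intro p hp h1 h2
          grind
        intro p hp h1 h2
        grind

theorem K_RL {n : ℕ} (ih : KK N n) {f : N.Q} {a b : Obj} {S C T D : Set ℕ} (h : RS N f a b S C)
    (hn : a.V.ncard ≤ n) (hT : Nice a T D) (hb : b.flD T) (hTS : ∀ p ∈ a.V, p ∈ T → p ∈ S) :
    LS N f a b T D := by
  have ss := @a.symm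
  have sb := @b.symm
  have hV := N.V_T h.tf
  have hfl := h.fl
  obtain ⟨f1, f2, h⟩ := h
  have tf : N.T f a b := op_op_T.1 h.tf
  have c := N.src_T tf
  obtain ⟨n1, n2, e1, e2, e3⟩ := id h.nice
  obtain ⟨m1, m2, i1, i2, i3⟩ := id hT
  simp only [co_V', ← hV] at n1 n2
  have l1 := card_lt c (S := S) (by grind)
  have hDS : ∀ p ∈ a.V, p ∈ D → p ∈ S := by
    simp only [flC] at hfl
    intro p hp h1
    by_contra h2
    by_cases hpT : p ∈ T
    · grind
    · grind
  have hN : Nice (a.r S) T D := by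
    constructor <;> simp only [r_V, r_E] <;> grind
  have t1 := h.t1
  rw [← co_r, ← co_r] at t1
  have k := opRS (ih _ _ _ _ _ (op_op_T.1 t1) (by omega) hN (flD_r _ hb))
  rw [co_r, co_r] at k
  have := nest_LR h (by simpa [← hV] using hTS) (T := T) (by
    intro p hp h1 h2
    obtain ⟨q, hq1, hq2, hq3⟩ := n2
    have hq4 : q ∈ b.co.V := by rw [co_V', ← hV]; exact hq1
    have := e3 p q hp hq4 h2 (hTS p (by rw [hV]; exact hp) h1) hq2 hq3
    simp only [co_E] at this
    have hpq := hb p hp q hq4 h1 (fun h => hq3 (hTS q hq1 h))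
    exact this ⟨hp, hq4, by rintro rfl; exact hq3 (hTS _ hq1 h1), hpq⟩) k
  refine (opLS this).congr (fun _ _ => Iff.rfl) ?_
  intro p hp
  simp only [Set.mem_ofPred_eq]
  grind

theorem K_nest {n : ℕ} (ih : KK N n) {f : N.Q} {a b : Obj} {S C T D : Set ℕ}
    (h : LS N f a b S C ∨ RS N f a b S C)
    (hn : a.V.ncard ≤ n) (hT : Nice a T D) (hb : b.flD T)
    (hTS : (∀ p ∈ a.V, p ∈ T → p ∈ S) ∨ (∀ p ∈ a.V, p ∈ T → p ∉ S) ∨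
      (∀ p ∈ a.V, p ∉ T → p ∈ S) ∨ (∀ p ∈ a.V, p ∉ T → p ∉ S)) :
    LS N f a b T D := by
  have main : ∀ {S T : Set ℕ}, (LS N f a b S C ∨ RS N f a b S C) → Nice a T D → b.flD T →
      (∀ p ∈ a.V, p ∈ T → p ∈ S) → LS N f a b T D := by
    intro S T h hT hb hTS
    rcases h with h | h
    · exact K_LL ih h hn hT hb hTS
    · exact K_RL ih h hn hT hb hTS
  have hs : LS N f a b Sᶜ C ∨ RS N f a b Sᶜ C := h.imp LS.symm RS.symm
  have cc : LS N f a b Tᶜ D → LS N f a b T D := fun h => by simpa using h.symm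
  rcases hTS with k | k | k | k
  · exact main h hT hb k
  · exact main hs hT hb k
  · exact cc (main h hT.symm (flD_symm hb) k)
  · exact cc (main hs hT.symm (flD_symm hb) k)

theorem K_step {n : ℕ} (ih : KK N n) : KK N (n + 1) := by
  intro f a b T D hf hn hT hb
  have ss := @a.symm
  obtain ⟨m1, m2, i1, i2, i3⟩ := id hT
  obtain ⟨p0, hp1, hp2, hp3⟩ := id m1
  obtain ⟨q0, hq1, hq2, hq3⟩ := id m2
  obtain ⟨S, C, h⟩ := spl hf ⟨p0, q0, hp1, hq1, by rintro rfl; exact hq3 hp3⟩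
  by_cases hc : (∀ p ∈ a.V, p ∈ T → p ∈ S) ∨ (∀ p ∈ a.V, p ∈ T → p ∉ S) ∨
      (∀ p ∈ a.V, p ∉ T → p ∈ S) ∨ (∀ p ∈ a.V, p ∉ T → p ∉ S)
  · exact K_nest ih h (by omega) hT hb hc
  have x1 : ∃ p, p ∈ a.V ∧ p ∈ S ∧ p ∈ T := by grind
  have x2 : ∃ p, p ∈ a.V ∧ p ∈ S ∧ p ∉ T := by grind
  have x3 : ∃ p, p ∈ a.V ∧ p ∉ S ∧ p ∈ T := by grind
  have x4 : ∃ p, p ∈ a.V ∧ p ∉ S ∧ p ∉ T := by grind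
  clear hc
  rcases h with h | h
  · have hbS := h.fl
    obtain ⟨f1, f2, k⟩ := id h
    obtain ⟨n1, n2, e1, e2, e3⟩ := id h.nice
    have y1 : (∃ p, p ∈ a.V ∧ p ∈ S ∧ p ∈ T ∧ p ∈ D) ∧ (∃ p, p ∈ a.V ∧ p ∈ S ∧ p ∉ T ∧ p ∈ D) := by
      by_contra hx
      refine con (S := T) k.t1 ?_ ?_ ?_ (flD_r _ hb)
      · simp only [r_V]; grind
      · simp only [r_V]; grind
      · intro u hu v hv h1 h2
        have hno : ¬ (u ∈ D ∧ v ∈ D) := fun h =>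
          hx ⟨⟨u, hu.1, hu.2, h1, h.1⟩, ⟨v, hv.1, hv.2, h2, h.2⟩⟩
        simp only [r_V, r_E] at *
        by_cases hu' : u ∈ D <;> by_cases hv' : v ∈ D <;> grind
    have y2 : (∃ p, p ∈ a.V ∧ p ∉ S ∧ p ∈ T ∧ p ∈ D) ∧ (∃ p, p ∈ a.V ∧ p ∉ S ∧ p ∉ T ∧ p ∈ D) := by
      by_contra hx
      refine con (S := T) k.t2 ?_ ?_ ?_ (flD_r _ hb)
      · simp only [r_V, Set.mem_compl_iff]; grind
      · simp only [r_V, Set.mem_compl_iff]; grind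
      · intro u hu v hv h1 h2
        have hno : ¬ (u ∈ D ∧ v ∈ D) := fun h =>
          hx ⟨⟨u, hu.1, hu.2, h1, h.1⟩, ⟨v, hv.1, hv.2, h2, h.2⟩⟩
        simp only [r_V, r_E, Set.mem_compl_iff] at *
        by_cases hu' : u ∈ D <;> by_cases hv' : v ∈ D <;> grind
    obtain ⟨⟨u1, u2, u3, u4, u5⟩, ⟨v1, v2, v3, v4, v5⟩⟩ := y1
    obtain ⟨⟨w1, w2, w3, w4, w5⟩, ⟨z1, z2, z3, z4, z5⟩⟩ := y2
    have a1 := i3 u1 z1 u2 z2 u5 u4 z5 z4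
    have a2 := i3 w1 v1 w2 v2 w5 w4 v5 v4
    have c1 : u1 ∈ C := by grind
    have c2 : z1 ∈ C := by grind
    have hCD : ∀ p ∈ a.V, p ∈ C ↔ p ∈ D := by
      intro r hr
      constructor
      · intro h1
        by_contra h2
        by_cases hS : r ∈ S <;> grind
      · intro h1
        by_contra h2
        by_cases hS : r ∈ T <;> grind
    have hQ : Nice a (T ∩ S) C := by
      constructor <;> (try simp only [Set.mem_inter_iff]) <;> grind
    have hbQ : b.flD (T ∩ S) := by
      simp only [flD, Set.mem_inter_iff] at *
      grind
    have kQ := K_nest ih (Or.inl h) (by omega) hQ hbQ (Or.inl fun p _ hp => hp.2)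
    exact K_nest ih (Or.inl kQ) (by omega) hT hb (Or.inr (Or.inr (Or.inr fun p _ hp h => hp h.1)))
  · exfalso
    have ha := h.fl
    have hside : ∃ S C, RS N f a b S C ∧ (∃ p, p ∈ a.V ∧ p ∉ S ∧ p ∈ T) ∧
        (∃ p, p ∈ a.V ∧ p ∉ S ∧ p ∉ T) ∧ (∀ p ∈ a.V, p ∈ D → p ∈ S) := by
      by_cases hp : p0 ∈ S
      · refine ⟨S, C, h, x3, x4, ?_⟩
        simp only [flC] at ha
        have : q0 ∈ S := by grind
        grind
      · refine ⟨Sᶜ, C, h.symm, ?_⟩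
        simp only [flC, Set.mem_compl_iff] at *
        have : q0 ∉ S := by grind
        grind
    obtain ⟨S, C, ⟨f1, f2, k⟩, y1, y2, y3⟩ := hside
    have t2 := k.t2
    rw [← co_r, ← co_r] at t2
    refine con (S := T) (op_op_T.1 t2) ?_ ?_ ?_ (flD_r _ hb)
    · simp only [r_V, Set.mem_compl_iff]; grind
    · simp only [r_V, Set.mem_compl_iff]; grind
    · intro u hu v hv h1 h2
      simp only [r_V, r_E, Set.mem_compl_iff] at *
      grind

theorem K_all (N : Net) (n : ℕ) : KK N n := by
  induction n with
  | zero => intro f a b T D _ h; omega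
  | succ n ih => exact K_step ih

theorem thin_aux (n : ℕ) : ∀ (N : Net) (f g : N.Q) (a b : Obj), a.V.ncard = n → N.T f a b →
    N.T g a b → f = g := by
  induction n using Nat.strong_induction_on with
  | _ n ih =>
    intro N f g a b hn hf hg
    by_cases h2 : ∃ p q, p ∈ a.V ∧ q ∈ a.V ∧ p ≠ q
    · have main : ∀ (N : Net) (f g : N.Q) (a b : Obj) (S C : Set ℕ), a.V.ncard = n → N.T g a b →
          LS N f a b S C → f = g := by
        intro N f g a b S C hn hg h
        obtain ⟨g1, g2, k⟩ := K_all N (n + 1) g a b S C hg (by omega) h.nice h.fl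
        obtain ⟨f1, f2, h⟩ := h
        have c := N.src_T hg
        obtain ⟨p, hp, _, hp'⟩ := h.nice.n1
        obtain ⟨q, hq, _, hq'⟩ := h.nice.n2
        have l1 := card_lt c (S := S) ⟨q, hq, hq'⟩
        have l2 := card_lt c (S := Sᶜ) ⟨p, hp, by simpa using hp'⟩
        rw [h.eq, k.eq, ih _ (by omega) N f1 g1 _ _ rfl h.t1 k.t1,
          ih _ (by omega) N f2 g2 _ _ rfl h.t2 k.t2]
      obtain ⟨S, C, h | h⟩ := spl hf h2
      · exact main N f g a b S C hn hg h
      · exact main N.op f g b.co a.co S C (by simpa [← N.V_T hf] using hn) (op_op_T.2 hg) h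
    · have hs : ∀ p ∈ a.V, ∀ q ∈ a.V, p = q := by
        intro p hp q hq
        by_contra h
        exact h2 ⟨p, q, hp, hq, h⟩
      rw [(small hf hs).2, (small hg hs).2]

/-- Abstract nets are thin. -/
theorem thin {f g : N.Q} {a b : Obj} (hf : N.T f a b) (hg : N.T g a b) : f = g :=
  thin_aux _ N f g a b rfl hf hg

end Net
end DSC

open CategoryTheory

namespace DSC

/-! ### Part 2: coherence for associativity and commutativity -/

/-- Letters of a formula. -/
def lets : Form ℕ → Set ℕ
  | .letter n => {n}
  | .conj A B => lets A ∪ lets B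
  | .disj A B => lets A ∪ lets B

/-- Diversified formulae. -/
def Div : Form ℕ → Prop
  | .letter _ => True
  | .conj A B => Div A ∧ Div B ∧ ∀ p, p ∈ lets A → p ∈ lets B → False
  | .disj A B => Div A ∧ Div B ∧ ∀ p, p ∈ lets A → p ∈ lets B → False

theorem lets_op (b : Bool) (A B : Form ℕ) : lets (opF b A B) = lets A ∪ lets B := by
  cases b <;> rfl

theorem Div_op (b : Bool) (A B : Form ℕ) : Div (opF b A B) ↔
    Div A ∧ Div B ∧ ∀ p, p ∈ lets A → p ∈ lets B → False := by
  cases b <;> rfl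

theorem lets_ne (A : Form ℕ) : ∃ p, p ∈ lets A := by
  induction A with
  | letter n => exact ⟨n, rfl⟩
  | conj A B h _ => obtain ⟨p, hp⟩ := h; exact ⟨p, Or.inl hp⟩
  | disj A B h _ => obtain ⟨p, hp⟩ := h; exact ⟨p, Or.inl hp⟩

/-- Every arrow preserves letters and diversification. -/
theorem pres {A B : Form ℕ} (f : A ⟶ B) : lets A = lets B ∧ (Div A ↔ Div B) := by
  induction f using hom_ind with
  | hid A => exact ⟨rfl, Iff.rfl⟩
  | hcomp f g h1 h2 => exact ⟨h1.1.trans h2.1, h1.2.trans h2.2⟩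
  | hop b f g h1 h2 => simp only [lets_op, Div_op, h1, h2, and_self]
  | hto b A B C =>
    simp only [lets_op, Div_op, Set.mem_union, Set.union_assoc, true_and]
    grind
  | hfr b A B C =>
    simp only [lets_op, Div_op, Set.mem_union, Set.union_assoc, true_and]
    grind
  | hc b A B =>
    simp only [lets_op, Div_op, Set.union_comm, true_and]
    grind
  | hd A B C =>
    simp only [lets, Div, Set.mem_union, Set.union_assoc, true_and]
    grind

/-- Arrows built from associativity and commutativity. -/
inductive IsAC : ∀ {A B : Form ℕ}, (A ⟶ B) → Prop
  | id (A : Form ℕ) : IsAC (𝟙 A)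
  | comp {A B C : Form ℕ} {f : A ⟶ B} {g : B ⟶ C} : IsAC f → IsAC g → IsAC (f ≫ g)
  | op (b : Bool) {A B C D : Form ℕ} {f : A ⟶ C} {g : B ⟶ D} :
      IsAC f → IsAC g → IsAC (mOp b f g)
  | asTo (b : Bool) (A B C : Form ℕ) : IsAC (asTo b A B C)
  | asFr (b : Bool) (A B C : Form ℕ) : IsAC (asFr b A B C)
  | cm (b : Bool) (A B : Form ℕ) : IsAC (cm b A B)

theorem IsAC.inv {A B : Form ℕ} {f : A ⟶ B} (h : IsAC f) :
    ∃ g : B ⟶ A, IsAC g ∧ f ≫ g = 𝟙 A ∧ g ≫ f = 𝟙 B := by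
  induction h with
  | id A => exact ⟨𝟙 A, .id A, by simp, by simp⟩
  | @comp A B C f g _ _ h1 h2 =>
    obtain ⟨f', a1, a2, a3⟩ := h1
    obtain ⟨g', b1, b2, b3⟩ := h2
    refine ⟨g' ≫ f', b1.comp a1, ?_, ?_⟩
    · rw [Category.assoc, ← Category.assoc g, b2, Category.id_comp, a2]
    · rw [Category.assoc, ← Category.assoc f', a3, Category.id_comp, b3]
  | op b _ _ h1 h2 =>
    obtain ⟨f', a1, a2, a3⟩ := h1
    obtain ⟨g', b1, b2, b3⟩ := h2
    refine ⟨mOp b f' g', .op b a1 b1, ?_, ?_⟩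
    · rw [← mOp_comp, a2, b2, mOp_id]
    · rw [← mOp_comp, a3, b3, mOp_id]
  | asTo b A B C => exact ⟨_, .asFr b A B C, by simp, by simp⟩
  | asFr b A B C => exact ⟨_, .asTo b A B C, by simp, by simp⟩
  | cm b A B => exact ⟨_, .cm b B A, by simp, by simp⟩

/-- A formula with a factor pulled in front. -/
structure PR (b : Bool) (A : Form ℕ) where
  K : Form ℕ
  R : Form ℕ
  e : A ⟶ opF b K R

def up (b : Bool) (A B : Form ℕ) : Option (PR b A) → PR b (opF b A B)
  | none => ⟨A, B, 𝟙 _⟩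
  | some X => ⟨X.K, opF b X.R B, mOp b X.e (𝟙 B) ≫ asFr b _ _ _⟩

def upR (b : Bool) (A B : Form ℕ) (X : Option (PR b B)) : PR b (opF b A B) :=
  ⟨(up b B A X).K, (up b B A X).R, cm b A B ≫ (up b B A X).e⟩

open Classical in
noncomputable def pull (b : Bool) (p : ℕ) : (A : Form ℕ) → Option (PR b A)
  | .letter _ => none
  | .conj A B => match b with
    | true => some (if p ∈ lets A then up true A B (pull true p A)
        else upR true A B (pull true p B))
    | false => none
  | .disj A B => match b with
    | false => some (if p ∈ lets A then up false A B (pull false p A)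
        else upR false A B (pull false p B))
    | true => none

theorem pull_l {b : Bool} {p : ℕ} {A : Form ℕ} (B : Form ℕ) (h : p ∈ lets A) :
    pull b p (opF b A B) = some (up b A B (pull b p A)) := by
  cases b <;> simp [pull, h]

theorem pull_r {b : Bool} {p : ℕ} {A : Form ℕ} (B : Form ℕ) (h : p ∉ lets A) :
    pull b p (opF b A B) = some (upR b A B (pull b p B)) := by
  cases b <;> simp [pull, h]

theorem pull_n {b b' : Bool} {p : ℕ} (A B : Form ℕ) (h : b' ≠ b) :
    pull b' p (opF b A B) = none := by
  cases b <;> cases b' <;> simp [pull] at *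

def Rel1 {b : Bool} {A B : Form ℕ} (f : A ⟶ B) (X : PR b A) (Y : PR b B) : Prop :=
  ∃ k r, IsAC k ∧ IsAC r ∧ f ≫ Y.e = X.e ≫ mOp b k r

def Rel {b : Bool} {A B : Form ℕ} (f : A ⟶ B) : Option (PR b A) → Option (PR b B) → Prop
  | none, none => True
  | some X, some Y => Rel1 f X Y
  | _, _ => False

theorem Rel1.comp {b : Bool} {A B C : Form ℕ} {f : A ⟶ B} {g : B ⟶ C} {X : PR b A} {Y : PR b B}
    {Z : PR b C} (h1 : Rel1 f X Y) (h2 : Rel1 g Y Z) : Rel1 (f ≫ g) X Z := by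
  obtain ⟨k, r, hk, hr, e⟩ := h1
  obtain ⟨k', r', hk', hr', e'⟩ := h2
  refine ⟨k ≫ k', r ≫ r', hk.comp hk', hr.comp hr', ?_⟩
  rw [Category.assoc, e', ← Category.assoc, e, mOp_comp, Category.assoc]

theorem Rel.comp {b : Bool} {A B C : Form ℕ} {f : A ⟶ B} {g : B ⟶ C} {X : Option (PR b A)}
    {Y : Option (PR b B)} {Z : Option (PR b C)} (h1 : Rel f X Y) (h2 : Rel g Y Z) :
    Rel (f ≫ g) X Z := by
  rcases X with _ | X <;> rcases Y with _ | Y <;> rcases Z with _ | Z <;>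
    simp only [Rel] at *
  exact h1.comp h2

theorem Rel.inv {b : Bool} {A B : Form ℕ} {f : A ⟶ B} {g : B ⟶ A} {X : Option (PR b A)}
    {Y : Option (PR b B)} (h1 : Rel f X Y) (e2 : g ≫ f = 𝟙 B) : Rel g Y X := by
  rcases X with _ | X <;> rcases Y with _ | Y <;> simp only [Rel] at *
  obtain ⟨k, r, hk, hr, e⟩ := h1
  obtain ⟨k', hk', a1, a2⟩ := hk.inv
  obtain ⟨r', hr', b1, b2⟩ := hr.inv
  refine ⟨k', r', hk', hr', ?_⟩
  have : g ≫ (f ≫ Y.e) ≫ mOp b k' r' = Y.e ≫ mOp b k' r' := by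
    rw [Category.assoc, ← Category.assoc g, e2, Category.id_comp]
  rw [← this, e, Category.assoc, ← mOp_comp, a1, b1, mOp_id, Category.comp_id]

theorem Rel1.id {b : Bool} {A : Form ℕ} (X : PR b A) : Rel1 (𝟙 A) X X :=
  ⟨𝟙 _, 𝟙 _, .id _, .id _, by simp⟩

theorem Rel.id {b : Bool} {A : Form ℕ} (X : Option (PR b A)) : Rel (𝟙 A) X X := by
  rcases X with _ | X <;> simp only [Rel]
  exact Rel1.id X

theorem asFr_nat (b : Bool) {A B C D E F : Form ℕ} (f : A ⟶ D) (g : B ⟶ E) (h : C ⟶ F) :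
    mOp b (mOp b f g) h ≫ asFr b D E F = asFr b A B C ≫ mOp b f (mOp b g h) := by
  have : asFr b A B C ≫ (asTo b A B C ≫ mOp b (mOp b f g) h) ≫ asFr b D E F =
    mOp b (mOp b f g) h ≫ asFr b D E F := by
    rw [Category.assoc, ← Category.assoc, asFr_asTo, Category.id_comp]
  rw [← this, as_nat, Category.assoc, asTo_asFr, Category.comp_id]

theorem up_nat {b : Bool} {A B A' B' : Form ℕ} {f : A ⟶ A'} {g : B ⟶ B'}
    {X : Option (PR b A)} {Y : Option (PR b A')} (h : Rel f X Y) (hf : IsAC f) (hg : IsAC g) :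
    Rel1 (mOp b f g) (up b A B X) (up b A' B' Y) := by
  rcases X with _ | X <;> rcases Y with _ | Y <;> simp only [Rel] at h
  · exact ⟨f, g, hf, hg, by simp [up]⟩
  · obtain ⟨k, r, hk, hr, e⟩ := h
    refine ⟨k, mOp b r g, hk, .op b hr hg, ?_⟩
    simp only [up]
    rw [Category.assoc, ← asFr_nat, ← Category.assoc, ← Category.assoc, ← mOp_comp, ← mOp_comp, e,
      Category.comp_id, Category.id_comp]

/-- Naturality of pulling. -/
def NatP (b : Bool) (p : ℕ) {A B : Form ℕ} (f : A ⟶ B) : Prop :=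
  Div A → p ∈ lets A → Rel f (pull b p A) (pull b p B)

variable {b : Bool} {p : ℕ} {A B C D : Form ℕ}

theorem NatP.comp {f : A ⟶ B} {g : B ⟶ C} (h1 : NatP b p f) (h2 : NatP b p g) :
    NatP b p (f ≫ g) := fun hd hp =>
  (h1 hd hp).comp (h2 ((pres f).2.1 hd) ((pres f).1 ▸ hp))

theorem NatP.inv {f : A ⟶ B} {g : B ⟶ A} (h1 : NatP b p f) (e2 : g ≫ f = 𝟙 B) :
    NatP b p g := fun hd hp =>
  (h1 ((pres g).2.1 hd) ((pres g).1 ▸ hp)).inv e2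

theorem NatP.cm (c : Bool) : NatP b p (cm c A B) := by
  intro hd hp
  by_cases hb : b = c
  · subst hb
    rw [Div_op] at hd
    rw [lets_op] at hp
    by_cases hA : p ∈ lets A
    · rw [pull_l _ hA, pull_r _ (fun h => hd.2.2 p hA h)]
      refine ⟨𝟙 _, 𝟙 _, .id _, .id _, ?_⟩
      simp only [upR]
      rw [← Category.assoc, cm_cm, mOp_id, Category.id_comp, Category.comp_id]
    · have hB : p ∈ lets B := hp.resolve_left hA
      rw [pull_l _ hB, pull_r _ hA]
      refine ⟨𝟙 _, 𝟙 _, .id _, .id _, ?_⟩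
      simp only [upR]
      rw [mOp_id, Category.comp_id]
  · rw [pull_n _ _ hb, pull_n _ _ hb]
    trivial

theorem NatP.opl (c : Bool) {f : A ⟶ C} {g : B ⟶ D} (hf : IsAC f) (hg : IsAC g)
    (h : NatP b p f) (hA : p ∈ lets A) : NatP b p (mOp c f g) := by
  intro hd hp
  by_cases hb : b = c
  · subst hb
    rw [pull_l _ hA, pull_l _ ((pres f).1 ▸ hA)]
    exact up_nat (h ((Div_op _ _ _).1 hd).1 hA) hf hg
  · rw [pull_n _ _ hb, pull_n _ _ hb]
    trivial

theorem NatP.op (c : Bool) {f : A ⟶ C} {g : B ⟶ D} (hf : IsAC f) (hg : IsAC g)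
    (h : NatP b p f) (h' : NatP b p g) : NatP b p (mOp c f g) := by
  intro hd hp
  rcases (lets_op c A B ▸ hp : p ∈ lets A ∪ lets B) with hA | hB
  · exact NatP.opl c hf hg h hA hd hp
  · have : mOp c f g = DSC.cm c A B ≫ mOp c g f ≫ DSC.cm c D C := by
      rw [← cm_nat, ← Category.assoc, cm_cm, Category.id_comp]
    rw [this]
    exact (NatP.cm c).comp ((NatP.opl c hg hf h' hB).comp (NatP.cm c)) hd hp

theorem NatP.id : NatP b p (𝟙 A) := fun _ _ => Rel.id _

theorem NatP.as1 (c : Bool) (hA : p ∈ lets A) : NatP b p (asFr c A B C) := by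
  intro hd hp
  by_cases hb : b = c
  · subst hb
    rw [pull_l _ hA, pull_l _ (by rw [lets_op]; exact Or.inl hA), pull_l _ hA]
    generalize pull b p A = X
    rcases X with _ | X
    · refine ⟨𝟙 _, 𝟙 _, .id _, .id _, ?_⟩
      simp [up]
    · refine ⟨𝟙 _, asFr b _ _ _, .id _, .asFr _ _ _ _, ?_⟩
      simp only [up]
      have := pent b X.K X.R B C
      have e1 : mOp b (mOp b X.e (𝟙 B) ≫ asFr b X.K X.R B) (𝟙 C) =
        mOp b (mOp b X.e (𝟙 B)) (𝟙 C) ≫ mOp b (asFr b X.K X.R B) (𝟙 C) := by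
        rw [← mOp_comp, Category.comp_id]
      rw [e1, Category.assoc, Category.assoc, ← pent, ← Category.assoc, ← Category.assoc, asFr_nat,
        mOp_id]
  · rw [pull_n _ _ hb, pull_n _ _ hb]
    trivial

theorem NatP.as2 (c : Bool) (hB : p ∈ lets B) : NatP b p (asFr c A B C) := by
  have e : asFr c A B C = mOp c (DSC.cm c A B) (𝟙 C) ≫ asFr c B A C ≫ mOp c (𝟙 B) (DSC.cm c A C) ≫
      asTo c B C A ≫ DSC.cm c (opF c B C) A := by
    rw [← hexa c A B C]
    have h1 := mOp_comp c (DSC.cm c A B) (DSC.cm c B A) (𝟙 C) (𝟙 C)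
    have h2 := mOp_comp c (𝟙 B) (𝟙 B) (DSC.cm c C A) (DSC.cm c A C)
    simp only [Category.assoc]
    rw [← Category.assoc (mOp c (𝟙 B) (DSC.cm c C A)), ← h2, cm_cm, Category.comp_id, mOp_id,
      Category.id_comp, ← Category.assoc (asFr c B C A), asFr_asTo, Category.id_comp, cm_cm,
      Category.comp_id, ← Category.assoc, ← h1, cm_cm, Category.comp_id, mOp_id, Category.id_comp]
  rw [e]
  exact (NatP.op c (.cm _ _ _) (.id _) (.cm c) .id).comp ((NatP.as1 c hB).comp
    ((NatP.op c (.id _) (.cm _ _ _) .id (.cm c)).comp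
      (((NatP.as1 c hB).inv (asTo_asFr _ _ _ _)).comp (.cm c))))

theorem NatP.as3 (c : Bool) (hA : p ∈ lets A) : NatP b p (asFr c B C A) := by
  have e : asFr c B C A = DSC.cm c (opF c B C) A ≫ asTo c A B C ≫ mOp c (DSC.cm c A B) (𝟙 C) ≫
      asFr c B A C ≫ mOp c (𝟙 B) (DSC.cm c A C) := by
    rw [← hexa c A B C]
    have h1 := mOp_comp c (DSC.cm c A B) (DSC.cm c B A) (𝟙 C) (𝟙 C)
    have h2 := mOp_comp c (𝟙 B) (𝟙 B) (DSC.cm c C A) (DSC.cm c A C)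
    simp only [Category.assoc]
    rw [← h2, cm_cm, Category.comp_id, mOp_id, Category.comp_id,
      ← Category.assoc (mOp c (DSC.cm c A B) (𝟙 C)), ← h1, cm_cm, Category.comp_id, mOp_id,
      Category.id_comp, ← Category.assoc (asTo c A B C), asTo_asFr, Category.id_comp,
      ← Category.assoc, cm_cm, Category.id_comp]
  rw [e]
  exact (NatP.cm c).comp (((NatP.as1 c hA).inv (asTo_asFr _ _ _ _)).comp
    ((NatP.op c (.cm _ _ _) (.id _) (.cm c) .id).comp ((NatP.as2 c hA).comp
    (NatP.op c (.id _) (.cm _ _ _) .id (.cm c)))))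

theorem NatP.as (c : Bool) : NatP b p (asFr c A B C) := by
  intro hd hp
  have hp' := hp
  rw [lets_op, lets_op] at hp'
  rcases hp' with (h | h) | h
  · exact NatP.as1 c h hd hp
  · exact NatP.as2 c h hd hp
  · exact NatP.as3 c h hd hp

theorem IsAC.nat {f : A ⟶ B} (h : IsAC f) : NatP b p f := by
  induction h with
  | id A => exact NatP.id
  | comp _ _ h1 h2 => exact h1.comp h2
  | op c h h' h1 h2 => exact NatP.op c h h' h1 h2
  | asTo c A B C => exact (NatP.as c).inv (asTo_asFr _ _ _ _)
  | asFr c A B C => exact NatP.as c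
  | cm c A B => exact NatP.cm c

theorem IsAC.letter {f : A ⟶ B} (h : IsAC f) : ∀ n, A = .letter n → ∃ e : A = B, f = eqToHom e := by
  induction h with
  | id A => exact fun _ _ => ⟨rfl, rfl⟩
  | comp _ _ h1 h2 =>
    intro n hn
    obtain ⟨rfl, rfl⟩ := h1 n hn
    obtain ⟨rfl, rfl⟩ := h2 n hn
    exact ⟨rfl, by simp⟩
  | op c h h' h1 h2 => intro n hn; cases c <;> cases hn
  | asTo c A B C => intro n hn; cases c <;> cases hn
  | asFr c A B C => intro n hn; cases c <;> cases hn
  | cm c A B => intro n hn; cases c <;> cases hn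

theorem size_op (b : Bool) (A B : Form ℕ) : (opF b A B).size = A.size + B.size := by
  cases b <;> rfl

theorem size_pos (A : Form ℕ) : 0 < A.size := by
  induction A <;> simp only [Form.size] <;> omega

theorem pres_size {A B : Form ℕ} (f : A ⟶ B) : A.size = B.size := by
  induction f using hom_ind with
  | hid A => rfl
  | hcomp f g h1 h2 => omega
  | hop b f g h1 h2 => simp only [size_op]; omega
  | hto b A B C => simp only [size_op]; omega
  | hfr b A B C => simp only [size_op]; omega
  | hc b A B => simp only [size_op]; omega
  | hd A B C => simp only [Form.size]; omega

theorem up_ac (X : Option (PR b A)) (hX : ∀ Y ∈ X, IsAC Y.e) : IsAC (up b A B X).e := by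
  rcases X with _ | X
  · exact .id _
  · exact .comp (.op _ (hX X rfl) (.id _)) (.asFr _ _ _ _)

theorem pull_ac (A : Form ℕ) : ∀ Y ∈ pull b p A, IsAC Y.e := by
  have key : ∀ A B : Form ℕ, (∀ Y ∈ pull b p A, IsAC Y.e) → (∀ Y ∈ pull b p B, IsAC Y.e) →
      ∀ c, ∀ Y ∈ pull b p (opF c A B), IsAC Y.e := by
    intro A B h1 h2 c Y hY
    by_cases hb : b = c
    · subst hb
      by_cases h : p ∈ lets A
      · rw [pull_l _ h] at hY
        cases hY
        exact up_ac _ h1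
      · rw [pull_r _ h] at hY
        cases hY
        exact .comp (.cm _ _ _) (up_ac _ h2)
    · rw [pull_n _ _ hb] at hY
      cases hY
  induction A with
  | letter n => intro Y hY; cases hY
  | conj A B h1 h2 => exact key A B h1 h2 true
  | disj A B h1 h2 => exact key A B h1 h2 false

theorem exists_op (A : Form ℕ) : (∃ n, A = .letter n) ∨ ∃ c B C, A = opF c B C := by
  cases A with
  | letter n => exact Or.inl ⟨n, rfl⟩
  | conj A B => exact Or.inr ⟨true, A, B, rfl⟩
  | disj A B => exact Or.inr ⟨false, A, B, rfl⟩

/-- Coherence for associativity and commutativity. -/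
theorem ac_coh : ∀ (n : ℕ) {A B : Form ℕ} {f g : A ⟶ B}, A.size ≤ n → Div A → IsAC f → IsAC g →
    f = g := by
  intro n
  induction n with
  | zero => intro A B f g h; have := size_pos A; omega
  | succ n ih =>
    intro A B f g hn hd hf hg
    rcases exists_op A with ⟨m, hm⟩ | ⟨c, A1, A2, rfl⟩
    · obtain ⟨e, h1⟩ := hf.letter m hm
      obtain ⟨e', h2⟩ := hg.letter m hm
      rw [h1, h2]
    · obtain ⟨p, hp⟩ := lets_ne A1
      have hp' : p ∈ lets (opF c A1 A2) := by rw [lets_op]; exact Or.inl hp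
      have h1 := hf.nat (b := c) (p := p) hd hp'
      have h2 := hg.nat (b := c) (p := p) hd hp'
      have a1 := @pull_ac c p (opF c A1 A2)
      have a2 := @pull_ac c p B
      rw [pull_l _ hp] at h1 h2 a1
      generalize up c A1 A2 (pull c p A1) = X at *
      generalize pull c p B = Y at *
      rcases Y with _ | Y <;> simp only [Rel] at h1 h2
      obtain ⟨k, r, hk, hr, e⟩ := h1
      obtain ⟨k', r', hk', hr', e'⟩ := h2
      have s1 := pres_size X.e
      simp only [size_op] at s1 hn
      have s2 := size_pos X.K
      have s3 := size_pos X.R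
      have d1 := (Div_op _ _ _).1 ((pres X.e).2.1 hd)
      rw [ih (by omega) d1.1 hk hk', ih (by omega) d1.2.1 hr hr', ← e'] at e
      obtain ⟨i, _, i1, i2⟩ := (a2 Y rfl).inv
      have := congrArg (· ≫ i) e
      simpa [i1] using this

theorem IsAC.coh {f g : A ⟶ B} (hf : IsAC f) (hg : IsAC g) (hd : Div A) : f = g :=
  ac_coh _ le_rfl hd hf hg

end DSC

open CategoryTheory

namespace DSC
open Obj

/-! ### Part 3: graphs of formulae -/

def sing (n : ℕ) : Obj := ⟨{n}, fun _ _ => False, fun h => h.elim, fun h => h.elim, fun h => h⟩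

/-- The cograph of a formula. -/
def gr : Form ℕ → Obj
  | .letter n => sing n
  | .conj A B => (gr A).conj (gr B)
  | .disj A B => (gr A).disj (gr B)

def opO (c : Bool) (x y : Obj) : Obj :=
  match c with
  | true => x.conj y
  | false => x.disj y

theorem gr_op (c : Bool) (A B : Form ℕ) : gr (opF c A B) = opO c (gr A) (gr B) := by
  cases c <;> rfl

theorem gr_V (A : Form ℕ) : (gr A).V = lets A := by
  induction A with
  | letter n => rfl
  | conj A B h1 h2 => change (gr A).V ∪ (gr B).V = _; rw [h1, h2]; rfl
  | disj A B h1 h2 => change (gr A).V ∪ (gr B).V = _; rw [h1, h2]; rfl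

theorem opO_comm (c : Bool) (x y : Obj) : opO c x y = opO c y x := by
  cases c
  · exact disj_comm _ _
  · exact conj_comm _ _

theorem opO_assoc (c : Bool) (x y z : Obj) : opO c (opO c x y) z = opO c x (opO c y z) := by
  cases c
  · exact disj_assoc _ _ _
  · exact conj_assoc _ _ _

theorem IsAC.gr {A B : Form ℕ} {f : A ⟶ B} (h : IsAC f) : gr A = gr B := by
  induction h with
  | id A => rfl
  | comp _ _ h1 h2 => exact h1.trans h2
  | op b _ _ h1 h2 => rw [gr_op, gr_op, h1, h2]
  | asTo b A B C => simp only [gr_op, opO_assoc]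
  | asFr b A B C => simp only [gr_op, opO_assoc]
  | cm b A B => simp only [gr_op]; exact opO_comm _ _ _

theorem Div.dj {c : Bool} {A B : Form ℕ} (h : Div (opF c A B)) : dj (gr A) (gr B) := by
  rw [Div_op] at h
  intro p
  rw [gr_V, gr_V]
  exact h.2.2 p

theorem Div.mk {c : Bool} {A B : Form ℕ} (h1 : Div A) (h2 : Div B) (h : Obj.dj (gr A) (gr B)) :
    Div (opF c A B) := by
  rw [Div_op]
  simp only [Obj.dj, gr_V] at h
  exact ⟨h1, h2, h⟩

theorem Cog.opO {c : Bool} {x y : Obj} (h1 : Cog x) (h2 : Cog y) (h : dj x y) : Cog (opO c x y) := by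
  cases c
  · exact .disj h1 h2 h
  · exact .conj h1 h2 h

theorem Div.cog {A : Form ℕ} (h : Div A) : Cog (gr A) := by
  induction A with
  | letter n => exact Cog.single _ n rfl
  | conj A B h1 h2 => exact .conj (h1 h.1) (h2 h.2.1) (Div.dj (c := true) h)
  | disj A B h1 h2 => exact .disj (h1 h.1) (h2 h.2.1) (Div.dj (c := false) h)

theorem Cog.ex {x : Obj} (h : Cog x) : x = emp ∨ ∃ A, Div A ∧ gr A = x := by
  induction h with
  | emp => exact Or.inl rfl
  | single x p h =>
    refine Or.inr ⟨.letter p, trivial, ?_⟩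
    apply ext'
    · intro q; rw [h]; rfl
    · intro q r h1 h2 h3
      have h1 : q = p := h1
      have h2 : r = p := h2
      omega
  | @conj x y _ _ d h1 h2 =>
    rcases h1 with rfl | ⟨A, hA, rfl⟩
    · rwa [emp_conj]
    rcases h2 with rfl | ⟨B, hB, rfl⟩
    · rw [conj_emp]; exact Or.inr ⟨A, hA, rfl⟩
    exact Or.inr ⟨A ⋏ B, Div.mk (c := true) hA hB d, rfl⟩
  | @disj x y _ _ d h1 h2 =>
    rcases h1 with rfl | ⟨A, hA, rfl⟩
    · rwa [emp_disj]
    rcases h2 with rfl | ⟨B, hB, rfl⟩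
    · rw [disj_emp]; exact Or.inr ⟨A, hA, rfl⟩
    exact Or.inr ⟨A ⋎ B, Div.mk (c := false) hA hB d, rfl⟩

theorem opO_E {c : Bool} {x y : Obj} (h : dj x y) (p q : ℕ) : (opO c x y).E p q ↔
    x.E p q ∨ y.E p q ∨ (c = true ∧ (p ∈ x.V ∧ q ∈ y.V ∨ p ∈ y.V ∧ q ∈ x.V)) := by
  cases c
  · simp [opO]
  · simp only [opO, conj_E, true_and]
    unfold dj at h
    grind

theorem opO_V {c : Bool} {x y : Obj} (p : ℕ) : p ∈ (opO c x y).V ↔ p ∈ x.V ∨ p ∈ y.V := by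
  cases c <;> rfl

theorem opO_r {c : Bool} {x y : Obj} (S : Set ℕ) : (opO c x y).r S = opO c (x.r S) (y.r S) := by
  cases c
  · exact r_disj S
  · exact r_conj S

theorem opO_emp {c : Bool} {x : Obj} : opO c x emp = x := by
  cases c
  · exact disj_emp x
  · exact conj_emp x

theorem emp_opO {c : Bool} {x : Obj} : opO c emp x = x := by
  rw [opO_comm, opO_emp]

/-- Existence of an associativity-commutativity arrow. -/
def Ac (A B : Form ℕ) : Prop := ∃ f : A ⟶ B, IsAC f

theorem Ac.refl (A : Form ℕ) : Ac A A := ⟨_, .id A⟩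
theorem Ac.trans {A B C : Form ℕ} : Ac A B → Ac B C → Ac A C :=
  fun ⟨_, h⟩ ⟨_, k⟩ => ⟨_, h.comp k⟩
theorem Ac.symm {A B : Form ℕ} : Ac A B → Ac B A :=
  fun ⟨_, h⟩ => ⟨_, h.inv.choose_spec.1⟩
theorem Ac.op (c : Bool) {A B C D : Form ℕ} : Ac A B → Ac C D → Ac (opF c A C) (opF c B D) :=
  fun ⟨_, h⟩ ⟨_, k⟩ => ⟨_, .op c h k⟩
theorem Ac.as (c : Bool) (A B C : Form ℕ) : Ac (opF c (opF c A B) C) (opF c A (opF c B C)) :=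
  ⟨_, .asFr c A B C⟩
theorem Ac.cm (c : Bool) (A B : Form ℕ) : Ac (opF c A B) (opF c B A) :=
  ⟨_, .cm c A B⟩

def fl (c : Bool) (x : Obj) (S : Set ℕ) : Prop :=
  ∀ p ∈ x.V, ∀ q ∈ x.V, p ∈ S → q ∉ S → (x.E p q ↔ c = true)

theorem flat_ex (c : Bool) (S : Set ℕ) (A : Form ℕ) (hd : Div A) (h : fl c (gr A) S) :
    (∀ p ∈ lets A, p ∈ S) ∨ (∀ p ∈ lets A, p ∉ S) ∨
    ∃ A1 A2, Ac A (opF c A1 A2) ∧ (∀ p ∈ lets A1, p ∈ S) ∧ (∀ p ∈ lets A2, p ∉ S) := by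
  have key : ∀ (c' : Bool) (X Y : Form ℕ),
      (Div X → fl c (gr X) S → (∀ p ∈ lets X, p ∈ S) ∨ (∀ p ∈ lets X, p ∉ S) ∨
    ∃ A1 A2, Ac X (opF c A1 A2) ∧ (∀ p ∈ lets A1, p ∈ S) ∧ (∀ p ∈ lets A2, p ∉ S)) →
      (Div Y → fl c (gr Y) S → (∀ p ∈ lets Y, p ∈ S) ∨ (∀ p ∈ lets Y, p ∉ S) ∨
    ∃ A1 A2, Ac Y (opF c A1 A2) ∧ (∀ p ∈ lets A1, p ∈ S) ∧ (∀ p ∈ lets A2, p ∉ S)) →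
      Div (opF c' X Y) → fl c (gr (opF c' X Y)) S →
      (∀ p ∈ lets (opF c' X Y), p ∈ S) ∨ (∀ p ∈ lets (opF c' X Y), p ∉ S) ∨
    ∃ A1 A2, Ac (opF c' X Y) (opF c A1 A2) ∧ (∀ p ∈ lets A1, p ∈ S) ∧
      (∀ p ∈ lets A2, p ∉ S) := by
    intro c' X Y hX hY hd hf
    have hdj := hd.dj
    rw [Div_op] at hd
    rw [gr_op] at hf
    unfold fl at hf
    simp only [opO_E hdj, opO_V] at hf
    have m1 := @(gr X).mem
    have m2 := @(gr X).mem'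
    have m3 := @(gr Y).mem
    have m4 := @(gr Y).mem'
    simp only [gr_V] at hf m1 m2 m3 m4
    obtain ⟨d1, d2, d3⟩ := hd
    by_cases hc : c' = c
    · subst hc
      replace hX := hX d1 (by unfold fl; simp only [gr_V]; grind)
      replace hY := hY d2 (by unfold fl; simp only [gr_V]; grind)
      clear hf m1 m2 m3 m4
      simp only [lets_op, Set.mem_union]
      rcases hX with hX | hX | ⟨X1, X2, aX, hX1, hX2⟩
      · rcases hY with hY | hY | ⟨Y1, Y2, aY, hY1, hY2⟩
        · left; grind
        · exact Or.inr (Or.inr ⟨X, Y, .refl _, hX, hY⟩)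
        · refine Or.inr (Or.inr ⟨opF c' X Y1, Y2, ?_, ?_, hY2⟩)
          · exact (Ac.op c' (.refl X) aY).trans (Ac.as _ _ _ _).symm
          · simp only [lets_op, Set.mem_union]; grind
      · rcases hY with hY | hY | ⟨Y1, Y2, aY, hY1, hY2⟩
        · exact Or.inr (Or.inr ⟨Y, X, .cm _ _ _, hY, hX⟩)
        · right; left; grind
        · refine Or.inr (Or.inr ⟨Y1, opF c' Y2 X, ?_, hY1, ?_⟩)
          · exact (Ac.op c' (.refl X) aY).trans ((Ac.cm _ _ _).trans (Ac.as _ _ _ _))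
          · simp only [lets_op, Set.mem_union]; grind
      · rcases hY with hY | hY | ⟨Y1, Y2, aY, hY1, hY2⟩
        · refine Or.inr (Or.inr ⟨opF c' Y X1, X2, ?_, ?_, hX2⟩)
          · exact (Ac.op c' aX (.refl Y)).trans ((Ac.cm _ _ _).trans (Ac.as _ _ _ _).symm)
          · simp only [lets_op, Set.mem_union]; grind
        · refine Or.inr (Or.inr ⟨X1, opF c' X2 Y, ?_, hX1, ?_⟩)
          · exact (Ac.op c' aX (.refl Y)).trans (Ac.as _ _ _ _)
          · simp only [lets_op, Set.mem_union]; grind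
        · refine Or.inr (Or.inr ⟨opF c' X1 Y1, opF c' X2 Y2, ?_, ?_, ?_⟩)
          · refine (Ac.op c' aX aY).trans ((Ac.as _ _ _ _).trans (Ac.trans ?_ (Ac.as _ _ _ _).symm))
            refine Ac.op c' (.refl _) ((Ac.as _ _ _ _).symm.trans
              ((Ac.op c' (.cm _ _ _) (.refl _)).trans (.as _ _ _ _)))
          · simp only [lets_op, Set.mem_union]; grind
          · simp only [lets_op, Set.mem_union]; grind
    · simp only [lets_op, Set.mem_union]
      obtain ⟨u, hu⟩ := lets_ne X
      obtain ⟨v, hv⟩ := lets_ne Y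
      have k1 : ∀ p ∈ lets X, ∀ q ∈ lets Y, p ∈ S ↔ q ∈ S := by
        intro p hp q hq
        by_contra hne
        have n1 : ¬ (gr X).E p q := fun h => d3 q (m2 h) hq
        have n2 : ¬ (gr Y).E p q := fun h => d3 p hp (m3 h)
        have n3 : ¬ (gr X).E q p := fun h => d3 q (m1 h) hq
        have n4 : ¬ (gr Y).E q p := fun h => d3 p hp (m4 h)
        have e1 := hf p (.inl hp) q (.inr hq)
        have e2 := hf q (.inr hq) p (.inl hp)
        simp only [n1, n2, n3, n4, hp, hq, false_or, and_self, true_or, or_true, and_true] at e1 e2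
        cases c <;> cases c' <;> grind
      by_cases hS : u ∈ S
      · left; grind
      · right; left; grind
  induction A with
  | letter n =>
    by_cases hn : n ∈ S
    · exact Or.inl fun p hp => by have : p = n := hp; rwa [this]
    · exact Or.inr (Or.inl fun p hp => by have : p = n := hp; rwa [this])
  | conj A B h1 h2 => exact key true A B h1 h2 hd h
  | disj A B h1 h2 => exact key false A B h1 h2 hd h

theorem ac_ex : ∀ (n : ℕ) {A B : Form ℕ}, B.size ≤ n → Div A → Div B → gr A = gr B → Ac A B := by
  intro n
  induction n with
  | zero => intro A B h; have := size_pos B; omega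
  | succ n ih =>
    intro A B hn hA hB e
    have eV : lets A = lets B := by rw [← gr_V, e, gr_V]
    rcases exists_op B with ⟨m, rfl⟩ | ⟨c, B1, B2, rfl⟩
    · rcases exists_op A with ⟨k, rfl⟩ | ⟨c, A1, A2, rfl⟩
      · have : k ∈ lets (.letter m) := eV ▸ (rfl : k ∈ lets (.letter k))
        have : k = m := this
        rw [this]
        exact .refl _
      · exfalso
        rw [Div_op] at hA
        obtain ⟨u, hu⟩ := lets_ne A1
        obtain ⟨v, hv⟩ := lets_ne A2
        rw [lets_op] at eV
        have h1 : u ∈ lets (.letter m) := eV ▸ Or.inl hu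
        have h2 : v ∈ lets (.letter m) := eV ▸ Or.inr hv
        have h1 : u = m := h1
        have h2 : v = m := h2
        exact hA.2.2 u hu (by rw [h1, ← h2]; exact hv)
    · have hdj := hB.dj
      have hB' := (Div_op _ _ _).1 hB
      have hfl : fl c (gr A) (lets B1) := by
        rw [e, gr_op]
        unfold fl
        have m2 := @(gr B1).mem'
        have m3 := @(gr B2).mem
        simp only [opO_E hdj, opO_V, gr_V] at *
        grind
      obtain ⟨u, hu⟩ := lets_ne B1
      obtain ⟨v, hv⟩ := lets_ne B2
      rw [lets_op] at eV
      rcases flat_ex c (lets B1) A hA hfl with h | h | ⟨A1, A2, a, h1, h2⟩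
      · exact (hB'.2.2 v (h v (eV ▸ Or.inr hv)) hv).elim
      · exact (h u (eV ▸ Or.inl hu) hu).elim
      · obtain ⟨f, hf⟩ := id a
        have hA' := (Div_op _ _ _).1 ((pres f).2.1 hA)
        have e' := hf.gr.symm.trans e
        rw [gr_op, gr_op] at e'
        have z1 : (gr B2).r (lets B1) = emp :=
          r_none fun p hp hq => hB'.2.2 p hq (by rwa [gr_V] at hp)
        have z2 : (gr B1).r (lets B1) = gr B1 := r_self fun p hp => by rwa [gr_V] at hp
        have z3 : (gr A2).r (lets B1) = emp := r_none fun p hp => h2 p (by rwa [gr_V] at hp)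
        have z4 : (gr A1).r (lets B1) = gr A1 := r_self fun p hp => h1 p (by rwa [gr_V] at hp)
        have w1 : (gr B2).r (lets B1)ᶜ = gr B2 :=
          r_self fun p hp hq => hB'.2.2 p hq (by rwa [gr_V] at hp)
        have w2 : (gr B1).r (lets B1)ᶜ = emp := r_none fun p hp h => h (by rwa [gr_V] at hp)
        have w3 : (gr A2).r (lets B1)ᶜ = gr A2 := r_self fun p hp => h2 p (by rwa [gr_V] at hp)
        have w4 : (gr A1).r (lets B1)ᶜ = emp :=
          r_none fun p hp h => h (h1 p (by rwa [gr_V] at hp))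
        have g1 := congrArg (fun x => x.r (lets B1)) e'
        have g2 := congrArg (fun x => x.r (lets B1)ᶜ) e'
        simp only [opO_r, z1, z2, z3, z4, w1, w2, w3, w4, opO_emp, emp_opO] at g1 g2
        rw [size_op] at hn
        have s1 := size_pos B1
        have s2 := size_pos B2
        exact a.trans (Ac.op c (ih (by omega) hA'.1 hB'.1 g1) (ih (by omega) hA'.2.1 hB'.2.1 g2))

theorem ac_of_gr {A B : Form ℕ} (hA : Div A) (hB : Div B) (h : gr A = gr B) :
    ∃ f : A ⟶ B, IsAC f := ac_ex _ le_rfl hA hB h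

end DSC

open CategoryTheory

namespace DSC
open Obj

/-! ### Part 6: the net of DS -/

structure Pre where
  A : Form ℕ
  B : Form ℕ
  f : A ⟶ B
  h : Div A

theorem Pre.hB (X : Pre) : Div X.B := (pres X.f).2.1 X.h

def PreR (X Y : Pre) : Prop :=
  ∃ (a : X.A ⟶ Y.A) (b : X.B ⟶ Y.B), IsAC a ∧ IsAC b ∧ a ≫ Y.f = X.f ≫ b

def preS : Setoid Pre where
  r := PreR
  iseqv := by
    refine ⟨fun X => ⟨𝟙 _, 𝟙 _, .id _, .id _, by simp⟩, ?_, ?_⟩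
    · rintro X Y ⟨a, b, ha, hb, e⟩
      obtain ⟨a', ha', a1, a2⟩ := ha.inv
      obtain ⟨b', hb', b1, b2⟩ := hb.inv
      refine ⟨a', b', ha', hb', ?_⟩
      have : a' ≫ (a ≫ Y.f) ≫ b' = Y.f ≫ b' := by
        rw [Category.assoc, ← Category.assoc, a2, Category.id_comp]
      rw [← this, e, Category.assoc, b1, Category.comp_id]
    · rintro X Y Z ⟨a, b, ha, hb, e⟩ ⟨a', b', ha', hb', e'⟩
      refine ⟨a ≫ a', b ≫ b', ha.comp ha', hb.comp hb', ?_⟩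
      rw [Category.assoc, e', ← Category.assoc, e, Category.assoc]

/-- Arrows of DS between diversified formulae, up to associativity and commutativity. -/
inductive QQ
  | bot : QQ
  | emp : QQ
  | ar : Quotient preS → QQ

namespace QQ

def mk {A B : Form ℕ} (f : A ⟶ B) (h : Div A) : QQ := .ar (Quotient.mk _ ⟨A, B, f, h⟩)

theorem mk_eq {A B A' B' : Form ℕ} {f : A ⟶ B} {f' : A' ⟶ B'} {h : Div A} {h' : Div A'}
    (a : A ⟶ A') (b : B ⟶ B') (ha : IsAC a) (hb : IsAC b) (e : a ≫ f' = f ≫ b) :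
    mk f h = mk f' h' :=
  congrArg ar (Quotient.sound ⟨a, b, ha, hb, e⟩)

theorem mk_inj {A B A' B' : Form ℕ} {f : A ⟶ B} {f' : A' ⟶ B'} {h : Div A} {h' : Div A'}
    (e : mk f h = mk f' h') :
    ∃ (a : A ⟶ A') (b : B ⟶ B'), IsAC a ∧ IsAC b ∧ a ≫ f' = f ≫ b := by
  have := QQ.ar.inj e
  exact Quotient.exact this

theorem mk_same {A B : Form ℕ} {f f' : A ⟶ B} {h h' : Div A}
    (e : mk f h = mk f' h') : f = f' := by
  obtain ⟨a, b, ha, hb, e⟩ := mk_inj e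
  rw [ha.coh (.id _) h, hb.coh (.id _) ((pres f).2.1 h)] at e
  simpa using e.symm

theorem cs (q : QQ) : q = bot ∨ q = emp ∨ ∃ (A B : Form ℕ) (f : A ⟶ B) (h : Div A), q = mk f h := by
  rcases q with _ | _ | q
  · exact Or.inl rfl
  · exact Or.inr (Or.inl rfl)
  · induction q using Quotient.ind with
    | _ X => exact Or.inr (Or.inr ⟨X.A, X.B, X.f, X.h, rfl⟩)

theorem mk_ne {A B : Form ℕ} {f : A ⟶ B} {h : Div A} : mk f h ≠ bot := by
  intro h; cases h

def src : QQ → Obj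
  | bot => .emp
  | emp => .emp
  | ar q => Quotient.lift (fun X : Pre => gr X.A) (by rintro _ _ ⟨_, _, ha, _, _⟩; exact ha.gr) q

def tgt : QQ → Obj
  | bot => .emp
  | emp => .emp
  | ar q => Quotient.lift (fun X : Pre => gr X.B) (by rintro _ _ ⟨_, _, _, hb, _⟩; exact hb.gr) q

theorem src_mk {A B : Form ℕ} (f : A ⟶ B) (h : Div A) : src (mk f h) = gr A := rfl
theorem tgt_mk {A B : Form ℕ} (f : A ⟶ B) (h : Div A) : tgt (mk f h) = gr B := rfl

theorem out_spec {A B : Form ℕ} (f : A ⟶ B) (h : Div A) :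
    PreR (Quotient.out (Quotient.mk preS ⟨A, B, f, h⟩)) ⟨A, B, f, h⟩ :=
  Quotient.exact (Quotient.out_eq (Quotient.mk preS ⟨A, B, f, h⟩))

open Classical in
noncomputable def op (c : Bool) : QQ → QQ → QQ
  | bot, _ => bot
  | _, bot => bot
  | emp, g => g
  | f, emp => f
  | ar f, ar g => if h : dj (gr f.out.A) (gr g.out.A) then
      mk (mOp c f.out.f g.out.f) (Div.mk f.out.h g.out.h h) else bot

open Classical in
noncomputable def comp : QQ → QQ → QQ
  | ar g, ar f => if h : gr f.out.B = gr g.out.A then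
      mk (f.out.f ≫ (ac_of_gr f.out.hB g.out.h h).choose ≫ g.out.f) f.out.h else bot
  | emp, emp => emp
  | _, _ => bot

open Classical in
noncomputable def id (x : Obj) : QQ :=
  if x = .emp then emp else if h : ∃ A, Div A ∧ gr A = x then mk (𝟙 h.choose) h.choose_spec.1
  else bot

@[simp] theorem bot_op (c : Bool) (g : QQ) : op c bot g = bot := by cases g <;> rfl
@[simp] theorem op_bot (c : Bool) (g : QQ) : op c g bot = bot := by cases g <;> rfl
@[simp] theorem emp_op (c : Bool) (g : QQ) : op c emp g = g := by cases g <;> rfl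
@[simp] theorem op_emp (c : Bool) (g : QQ) : op c g emp = g := by cases g <;> rfl
@[simp] theorem bot_comp (g : QQ) : comp bot g = bot := by cases g <;> rfl
@[simp] theorem comp_bot (g : QQ) : comp g bot = bot := by cases g <;> rfl
@[simp] theorem emp_comp_emp : comp emp emp = emp := rfl
@[simp] theorem emp_comp_mk {A B : Form ℕ} (f : A ⟶ B) (h : Div A) : comp emp (mk f h) = bot := rfl
@[simp] theorem mk_comp_emp {A B : Form ℕ} (f : A ⟶ B) (h : Div A) : comp (mk f h) emp = bot := rfl

variable {A B C D A' B' C' : Form ℕ}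

theorem op_mk (c : Bool) {f : A ⟶ B} {g : C ⟶ D} (hA : Div A) (hC : Div C)
    (h : dj (gr A) (gr C)) : op c (mk f hA) (mk g hC) = mk (mOp c f g) (Div.mk hA hC h) := by
  obtain ⟨a, b, ha, hb, e⟩ := out_spec f hA
  obtain ⟨a', b', ha', hb', e'⟩ := out_spec g hC
  simp only at a b a' b' e e'
  have h' := h
  rw [← ha.gr, ← ha'.gr] at h'
  refine (dif_pos h').trans ?_
  refine mk_eq (mOp c a a') (mOp c b b') (.op c ha ha') (.op c hb hb') ?_
  rw [← mOp_comp, ← mOp_comp, e, e']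

theorem op_mk_bot (c : Bool) {f : A ⟶ B} {g : C ⟶ D} (hA : Div A) (hC : Div C)
    (h : ¬ dj (gr A) (gr C)) : op c (mk f hA) (mk g hC) = bot := by
  obtain ⟨a, b, ha, hb, e⟩ := out_spec f hA
  obtain ⟨a', b', ha', hb', e'⟩ := out_spec g hC
  have h' := h
  rw [← ha.gr, ← ha'.gr] at h'
  exact dif_neg h'

theorem comp_mk {f : A ⟶ B} {g : B ⟶ C} (hA : Div A) (hB : Div B) :
    comp (mk g hB) (mk f hA) = mk (f ≫ g) hA := by
  obtain ⟨a, b, ha, hb, e⟩ := out_spec f hA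
  obtain ⟨a', b', ha', hb', e'⟩ := out_spec g hB
  have h' := hb.gr.trans ha'.gr.symm
  refine (dif_pos h').trans ?_
  have hk := (ac_of_gr (Pre.hB _) (Pre.h _) h').choose_spec
  refine mk_eq a b' ha hb' ?_
  have : _ ≫ a' = b := (hk.comp ha').coh hb (Pre.hB _)
  simp only [Category.assoc]
  rw [← e', ← Category.assoc _ a', this, ← Category.assoc, e, Category.assoc]

theorem comp_mk_bot {f : A ⟶ B} {g : C ⟶ D} (hA : Div A) (hC : Div C) (h : gr B ≠ gr C) :
    comp (mk g hC) (mk f hA) = bot := by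
  obtain ⟨a, b, ha, hb, e⟩ := out_spec f hA
  obtain ⟨a', b', ha', hb', e'⟩ := out_spec g hC
  have h' := h
  rw [← hb.gr, ← ha'.gr] at h'
  exact dif_neg h'

theorem re (f : A ⟶ B) (hA : Div A) (hA' : Div A') (hB' : Div B') (e : gr A = gr A')
    (e' : gr B = gr B') : ∃ f' : A' ⟶ B', mk f hA = mk f' hA' := by
  obtain ⟨a, ha⟩ := ac_of_gr hA' hA e.symm
  obtain ⟨b, hb⟩ := ac_of_gr ((pres f).2.1 hA) hB' e'
  obtain ⟨a', ha', a1, a2⟩ := ha.inv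
  refine ⟨a ≫ f ≫ b, mk_eq a' b ha' hb ?_⟩
  rw [← Category.assoc, a2, Category.id_comp]

theorem gr_ne (A : Form ℕ) : gr A ≠ .emp := by
  obtain ⟨p, hp⟩ := lets_ne A
  intro h
  rw [← gr_V, h] at hp
  exact hp

theorem id_emp : id .emp = emp := by simp [id]

theorem id_gr (hA : Div A) : id (gr A) = mk (𝟙 A) hA := by
  have h : ∃ B, Div B ∧ gr B = gr A := ⟨A, hA, rfl⟩
  rw [id, if_neg (gr_ne A), dif_pos h]
  obtain ⟨a, ha⟩ := ac_of_gr h.choose_spec.1 hA h.choose_spec.2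
  exact mk_eq a a ha ha (by simp)

theorem mk_ac {f : A ⟶ B} (hf : IsAC f) (hA : Div A) : mk f hA = mk (𝟙 A) hA := by
  obtain ⟨g, hg, a1, a2⟩ := hf.inv
  exact mk_eq (𝟙 A) g (.id _) hg (by rw [a1, Category.comp_id])

open Classical in
noncomputable def d (x y z : Obj) : QQ :=
  if x = .emp then (if dj y z ∧ (∃ p, p ∈ y.V) ∧ Cog y ∧ Cog z then id (y.disj z) else bot)
  else if z = .emp then (if dj x y ∧ (∃ p, p ∈ y.V) ∧ Cog x ∧ Cog y then id (x.conj y) else bot)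
  else if h : ∃ A B C, Div A ∧ Div B ∧ Div C ∧ gr A = x ∧ gr B = y ∧ gr C = z ∧
      Div (A ⋏ (B ⋎ C)) then
    mk (md h.choose h.choose_spec.choose h.choose_spec.choose_spec.choose)
      h.choose_spec.choose_spec.choose_spec.2.2.2.2.2.2
  else bot

theorem d_mk (hd : Div (A ⋏ (B ⋎ C))) : d (gr A) (gr B) (gr C) = mk (md A B C) hd := by
  have h : ∃ A' B' C', Div A' ∧ Div B' ∧ Div C' ∧ gr A' = gr A ∧ gr B' = gr B ∧ gr C' = gr C ∧
      Div (A' ⋏ (B' ⋎ C')) := ⟨A, B, C, hd.1, hd.2.1.1, hd.2.1.2.1, rfl, rfl, rfl, hd⟩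
  rw [d, if_neg (gr_ne A), if_neg (gr_ne C), dif_pos h]
  obtain ⟨a1, a2, a3, a4, a5, a6, a7⟩ := h.choose_spec.choose_spec.choose_spec
  obtain ⟨a, ha⟩ := ac_of_gr a1 hd.1 a4
  obtain ⟨b, hb⟩ := ac_of_gr a2 hd.2.1.1 a5
  obtain ⟨c, hc⟩ := ac_of_gr a3 hd.2.1.2.1 a6
  exact mk_eq (mOp true a (mOp false b c)) (mOp false (mOp true a b) c)
    (.op true ha (.op false hb hc)) (.op false (.op true ha hb) hc) (md_nat a b c).symm

theorem cog_cases {x : Obj} (h : Cog x) : x = .emp ∨ ∃ A, Div A ∧ gr A = x   := DSC.Cog.ex h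

theorem ne_gr {x : Obj} (h : Cog x) (hx : ∃ p, p ∈ x.V) : ∃ A, Div A ∧ gr A = x := by
  rcases DSC.Cog.ex h with rfl | h
  · obtain ⟨p, hp⟩ := hx; exact hp.elim
  · exact h

theorem gr_nonempty (A : Form ℕ) : ∃ p, p ∈ (gr A).V := by
  rw [gr_V]; exact lets_ne A

theorem Ok3.div (h : Ok3 (gr A) (gr B) (gr C)) (hA : Div A) (hB : Div B) (hC : Div C) :
    Div (A ⋏ (B ⋎ C)) := by
  refine Div.mk (c := true) hA (Div.mk (c := false) hB hC h.h23) ?_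
  exact dj_disj_right.2 ⟨h.h12, h.h13⟩

theorem d_bot {x y z : Obj} (h : ¬ (Ok3 x y z ∧ ∃ p, p ∈ y.V)) : d x y z = bot := by
  have de : ∀ w, dj w .emp := fun _ _ _ h => h
  have ed : ∀ w, dj .emp w := fun _ _ h => h.elim
  by_cases hx : x = .emp
  · rw [d, if_pos hx, if_neg]
    rintro ⟨h1, h2, h3, h4⟩
    subst hx
    exact h ⟨⟨.emp, h3, h4, ed _, ed _, h1⟩, h2⟩
  · by_cases hz : z = .emp
    · rw [d, if_neg hx, if_pos hz, if_neg]
      rintro ⟨h1, h2, h3, h4⟩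
      subst hz
      exact h ⟨⟨h3, h4, .emp, h1, de _, de _⟩, h2⟩
    · rw [d, if_neg hx, if_neg hz, dif_neg]
      rintro ⟨A, B, C, hA, hB, hC, rfl, rfl, rfl, hd⟩
      have h1 := Div.dj (c := true) hd
      have h2 := Div.dj (c := false) hd.2.1
      have h3 := dj_disj_right.1 h1
      exact h ⟨⟨hA.cog, hB.cog, hC.cog, h3.1, h3.2, h2⟩, gr_nonempty B⟩

theorem d_emp_l {y z : Obj} (hy : Cog y) (hz : Cog z) (h : dj y z) (k : ∃ p, p ∈ y.V) :
    d .emp y z = id (y.disj z) := by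
  rw [d, if_pos rfl, if_pos ⟨h, k, hy, hz⟩]

theorem d_emp_r {y z : Obj} (hy : Cog y) (hz : Cog z) (h : dj y z) (k : ∃ p, p ∈ z.V) :
    d y z .emp = id (y.conj z) := by
  by_cases hy' : y = .emp
  · subst hy'
    rw [d_emp_l hz .emp (fun _ _ h => h) k, disj_emp, emp_conj]
  · rw [d, if_neg hy', if_pos rfl, if_pos ⟨h, k, hy, hz⟩]

end QQ
end DSC

open CategoryTheory

namespace DSC
open Obj

namespace QQ

noncomputable def dsD : NData where
  Q := QQ
  bot := bot
  src := src
  tgt := tgt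
  id := id
  comp := comp
  conj := op true
  disj := op false
  d := d

/-- Typing. -/
def T (q : QQ) (x y : Obj) : Prop := q ≠ bot ∧ src q = x ∧ tgt q = y

variable {A B C D E A' B' C' : Form ℕ} {x y z x' y' z' w : Obj}

theorem T_mk {f : A ⟶ B} (h : Div A) : T (mk f h) (gr A) (gr B) := ⟨mk_ne, rfl, rfl⟩

theorem T_emp : T emp .emp .emp := ⟨(by intro h; cases h), rfl, rfl⟩

theorem T_cases {q : QQ} (h : T q x y) : (q = emp ∧ x = .emp ∧ y = .emp) ∨
    ∃ (A B : Form ℕ) (f : A ⟶ B) (h : Div A), q = mk f h ∧ x = gr A ∧ y = gr B := by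
  obtain ⟨h, rfl, rfl⟩ := h
  rcases cs q with rfl | rfl | ⟨A, B, f, hA, rfl⟩
  · exact (h rfl).elim
  · exact Or.inl ⟨rfl, rfl, rfl⟩
  · exact Or.inr ⟨A, B, f, hA, rfl, rfl, rfl⟩

theorem T_gr {q : QQ} (h : T q (gr A) (gr B)) (hA : Div A) (hB : Div B) :
    ∃ f : A ⟶ B, q = mk f hA := by
  rcases T_cases h with ⟨_, h, _⟩ | ⟨A', B', f, hA', rfl, e, e'⟩
  · exact (gr_ne _ h).elim
  · exact re f hA' hA hB e.symm e'.symm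

theorem div_tgt (f : A ⟶ B) (h : Div A) : Div B := (pres f).2.1 h

theorem gr_V_eq (f : A ⟶ B) : (gr A).V = (gr B).V := by
  rw [gr_V, gr_V]; exact (pres f).1

theorem id_T (h : Cog x) : T (id x) x x := by
  rcases cog_cases h with rfl | ⟨A, hA, rfl⟩
  · rw [id_emp]; exact T_emp
  · rw [id_gr hA]; exact T_mk hA

theorem V_T {q : QQ} (h : T q x y) : x.V = y.V := by
  rcases T_cases h with ⟨_, rfl, rfl⟩ | ⟨A, B, f, hA, rfl, rfl, rfl⟩
  · rfl
  · exact gr_V_eq f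

theorem src_T {q : QQ} (h : T q x y) : Cog x := by
  rcases T_cases h with ⟨_, rfl, rfl⟩ | ⟨A, B, f, hA, rfl, rfl, rfl⟩
  · exact .emp
  · exact hA.cog

theorem tgt_T {q : QQ} (h : T q x y) : Cog y := by
  rcases T_cases h with ⟨_, rfl, rfl⟩ | ⟨A, B, f, hA, rfl, rfl, rfl⟩
  · exact .emp
  · exact (div_tgt f hA).cog

theorem comp_T {g f : QQ} (hg : T g y z) (hf : T f x y) : T (comp g f) x z := by
  rcases T_cases hg with ⟨rfl, rfl, rfl⟩ | ⟨B, C, g, hB, rfl, rfl, rfl⟩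
  · rcases T_cases hf with ⟨rfl, rfl, _⟩ | ⟨A, B, f, hA, rfl, rfl, h⟩
    · exact T_emp
    · exact (gr_ne _ h.symm).elim
  · rcases T_cases hf with ⟨rfl, rfl, h⟩ | ⟨A, B', f, hA, rfl, rfl, h⟩
    · exact (gr_ne _ h).elim
    · obtain ⟨f', hf'⟩ := T_gr hf hA hB
      rw [hf', comp_mk]
      exact T_mk hA

theorem op_T (c : Bool) {f g : QQ} (hf : T f x y) (hg : T g z w) (h : dj x z) :
    T (op c f g) (opO c x z) (opO c y w) := by
  rcases T_cases hf with ⟨rfl, rfl, rfl⟩ | ⟨A, B, f, hA, rfl, rfl, rfl⟩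
  · rw [emp_op, emp_opO, emp_opO]; exact hg
  · rcases T_cases hg with ⟨rfl, rfl, rfl⟩ | ⟨C, D, g, hC, rfl, rfl, rfl⟩
    · rw [op_emp, opO_emp, opO_emp]; exact hf
    · rw [op_mk c hA hC h, ← gr_op, ← gr_op]
      exact T_mk _

theorem id_comp {f : QQ} (h : T f x y) : comp (id y) f = f := by
  rcases T_cases h with ⟨rfl, rfl, rfl⟩ | ⟨A, B, f, hA, rfl, rfl, rfl⟩
  · rw [id_emp]; rfl
  · rw [id_gr (div_tgt f hA), comp_mk, Category.comp_id]

theorem comp_id {f : QQ} (h : T f x y) : comp f (id x) = f := by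
  rcases T_cases h with ⟨rfl, rfl, rfl⟩ | ⟨A, B, f, hA, rfl, rfl, rfl⟩
  · rw [id_emp]; rfl
  · rw [id_gr hA, comp_mk, Category.id_comp]

/-- Composable pairs. -/
theorem comp_cases (f : A ⟶ B) (g : C ⟶ D) (hA : Div A) (hC : Div C) :
    (comp (mk g hC) (mk f hA) = bot ∧ gr B ≠ gr C) ∨
    (gr B = gr C ∧ ∃ k : A ⟶ D, comp (mk g hC) (mk f hA) = mk k hA) := by
  by_cases h : gr B = gr C
  · right
    obtain ⟨f', hf'⟩ := re f hA hA hC rfl h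
    exact ⟨h, f' ≫ g, by rw [hf', comp_mk]⟩
  · exact Or.inl ⟨comp_mk_bot hA hC h, h⟩

theorem assoc (h g f : QQ) : comp h (comp g f) = comp (comp h g) f := by
  rcases cs h with rfl | rfl | ⟨A3, B3, h, d3, rfl⟩
  · simp
  · rcases cs g with rfl | rfl | ⟨A2, B2, g, d2, rfl⟩
    · simp
    · rcases cs f with rfl | rfl | ⟨A1, B1, f, d1, rfl⟩ <;> simp
    · rcases cs f with rfl | rfl | ⟨A1, B1, f, d1, rfl⟩
      · simp
      · simp
      · rcases comp_cases f g d1 d2 with ⟨h, _⟩ | ⟨_, k, h⟩ <;> simp [h]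
  · rcases cs g with rfl | rfl | ⟨A2, B2, g, d2, rfl⟩
    · simp
    · rcases cs f with rfl | rfl | ⟨A1, B1, f, d1, rfl⟩ <;> simp
    · rcases cs f with rfl | rfl | ⟨A1, B1, f, d1, rfl⟩
      · simp
      · rcases comp_cases g h d2 d3 with ⟨h, _⟩ | ⟨_, k, h⟩ <;> simp [h]
      · by_cases e1 : gr B1 = gr A2
        · obtain ⟨f', hf'⟩ := re f d1 d1 d2 rfl e1
          rw [hf', comp_mk]
          by_cases e2 : gr B2 = gr A3
          · obtain ⟨g', hg'⟩ := re g d2 d2 d3 rfl e2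
            have : mk (f' ≫ g) d1 = mk (f' ≫ g') d1 := by
              rw [← comp_mk d1 d2, hg', comp_mk]
            rw [this, hg', comp_mk, comp_mk, comp_mk, Category.assoc]
          · rw [comp_mk_bot _ _ e2, comp_mk_bot _ _ e2, bot_comp]
        · rw [comp_mk_bot _ _ e1, comp_bot]
          rcases comp_cases g h d2 d3 with ⟨h, _⟩ | ⟨_, k, h⟩
          · rw [h, bot_comp]
          · rw [h, comp_mk_bot _ _ e1]

theorem op_comm (c : Bool) (f g : QQ) : op c f g = op c g f := by
  rcases cs f with rfl | rfl | ⟨A, B, f, d1, rfl⟩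
  · simp
  · simp
  rcases cs g with rfl | rfl | ⟨C, D, g, d2, rfl⟩
  · simp
  · simp
  by_cases h : dj (gr A) (gr C)
  · rw [op_mk c d1 d2 h, op_mk c d2 d1 h.symm]
    exact mk_eq (cm c _ _) (cm c _ _) (.cm _ _ _) (.cm _ _ _) (cm_nat _ _ _)
  · rw [op_mk_bot c d1 d2 h, op_mk_bot c d2 d1 (fun k => h k.symm)]

theorem dj_opO_left {c : Bool} : dj (opO c x y) z ↔ dj x z ∧ dj y z := by
  cases c
  · exact dj_disj_left
  · exact dj_conj_left

theorem dj_opO_right {c : Bool} : dj z (opO c x y) ↔ dj z x ∧ dj z y := by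
  cases c
  · exact dj_disj_right
  · exact dj_conj_right

theorem op_assoc (c : Bool) (f g h : QQ) : op c (op c f g) h = op c f (op c g h) := by
  rcases cs f with rfl | rfl | ⟨A1, B1, f, d1, rfl⟩
  · simp
  · simp
  rcases cs g with rfl | rfl | ⟨A2, B2, g, d2, rfl⟩
  · simp
  · simp
  rcases cs h with rfl | rfl | ⟨A3, B3, h, d3, rfl⟩
  · simp
  · simp
  by_cases h12 : dj (gr A1) (gr A2)
  · rw [op_mk c d1 d2 h12]
    by_cases h23 : dj (gr A2) (gr A3)
    · rw [op_mk c d2 d3 h23]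
      by_cases h13 : dj (gr A1) (gr A3)
      · rw [op_mk c _ d3 (by rw [gr_op]; exact dj_opO_left.2 ⟨h13, h23⟩),
          op_mk c d1 _ (by rw [gr_op]; exact dj_opO_right.2 ⟨h12, h13⟩)]
        exact mk_eq (asFr c _ _ _) (asFr c _ _ _) (.asFr _ _ _ _) (.asFr _ _ _ _)
          (asFr_nat _ _ _ _).symm
      · rw [op_mk_bot c _ d3 (by rw [gr_op]; exact fun k => h13 (dj_opO_left.1 k).1),
          op_mk_bot c d1 _ (by rw [gr_op]; exact fun k => h13 (dj_opO_right.1 k).2)]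
    · rw [op_mk_bot c d2 d3 h23, op_bot,
        op_mk_bot c _ d3 (by rw [gr_op]; exact fun k => h23 (dj_opO_left.1 k).2)]
  · rw [op_mk_bot c d1 d2 h12, bot_op]
    by_cases h23 : dj (gr A2) (gr A3)
    · rw [op_mk c d2 d3 h23,
        op_mk_bot c d1 _ (by rw [gr_op]; exact fun k => h12 (dj_opO_right.1 k).1)]
    · rw [op_mk_bot c d2 d3 h23, op_bot]

theorem op_id (c : Bool) (hx : Cog x) (hy : Cog y) (h : dj x y) :
    op c (id x) (id y) = id (opO c x y) := by
  rcases cog_cases hx with rfl | ⟨A, hA, rfl⟩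
  · rw [id_emp, emp_op, emp_opO]
  rcases cog_cases hy with rfl | ⟨B, hB, rfl⟩
  · rw [id_emp, op_emp, opO_emp]
  rw [id_gr hA, id_gr hB, op_mk c hA hB h, mOp_id, ← gr_op, id_gr]

theorem dj_congr (h1 : x.V = x'.V) (h2 : y.V = y'.V) : dj x y ↔ dj x' y' := by
  unfold dj; rw [h1, h2]

theorem op_comp (c : Bool) {g₁ f₁ g₂ f₂ : QQ} (h1 : src g₁ = tgt f₁) (h2 : src g₂ = tgt f₂) :
    comp (op c g₁ g₂) (op c f₁ f₂) = op c (comp g₁ f₁) (comp g₂ f₂) := by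
  rcases cs g₁ with rfl | rfl | ⟨A1, B1, g₁, d1, rfl⟩
  · simp
  · rcases cs f₁ with rfl | rfl | ⟨A2, B2, f₁, d2, rfl⟩
    · simp
    · simp
    · exact (gr_ne _ h1.symm).elim
  rcases cs f₁ with rfl | rfl | ⟨A2, B2, f₁, d2, rfl⟩
  · simp
  · exact (gr_ne _ h1).elim
  rw [src_mk, tgt_mk] at h1
  obtain ⟨f1', hf1⟩ := re f₁ d2 d2 d1 rfl h1.symm
  rw [hf1, comp_mk]
  rcases cs g₂ with rfl | rfl | ⟨A3, B3, g₂, d3, rfl⟩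
  · simp
  · rcases cs f₂ with rfl | rfl | ⟨A4, B4, f₂, d4, rfl⟩
    · simp
    · simp [comp_mk]
    · exact (gr_ne _ h2.symm).elim
  rcases cs f₂ with rfl | rfl | ⟨A4, B4, f₂, d4, rfl⟩
  · simp
  · exact (gr_ne _ h2).elim
  rw [src_mk, tgt_mk] at h2
  obtain ⟨f2', hf2⟩ := re f₂ d4 d4 d3 rfl h2.symm
  rw [hf2, comp_mk]
  by_cases h : dj (gr A2) (gr A4)
  · rw [op_mk c d2 d4 h, op_mk c d2 d4 h,
      op_mk c d1 d3 ((dj_congr (gr_V_eq f1') (gr_V_eq f2')).1 h), comp_mk, mOp_comp]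
  · rw [op_mk_bot c d2 d4 h, op_mk_bot c d2 d4 h, comp_bot]

theorem d_T (h : Ok3 x y z) (hy : ∃ p, p ∈ y.V) :
    T (d x y z) (x.conj (y.disj z)) ((x.conj y).disj z) := by
  obtain ⟨B, hB, rfl⟩ := ne_gr h.c2 hy
  rcases cog_cases h.c1 with rfl | ⟨A, hA, rfl⟩
  · rw [d_emp_l h.c2 h.c3 h.h23 hy, emp_conj, emp_conj]
    exact id_T (.disj h.c2 h.c3 h.h23)
  rcases cog_cases h.c3 with rfl | ⟨C, hC, rfl⟩
  · rw [d_emp_r h.c1 h.c2 h.h12 hy, disj_emp, disj_emp]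
    exact id_T (.conj h.c1 h.c2 h.h12)
  rw [d_mk (Ok3.div h hA hB hC)]
  exact T_mk _

theorem Ok3.congr (h : Ok3 x y z) (h1 : x.V = x'.V) (h2 : y.V = y'.V) (h3 : z.V = z'.V)
    (c1 : Cog x') (c2 : Cog y') (c3 : Cog z') : Ok3 x' y' z' :=
  ⟨c1, c2, c3, (dj_congr h1 h2).1 h.h12, (dj_congr h1 h3).1 h.h13, (dj_congr h2 h3).1 h.h23⟩

theorem V_emp (h : Obj.emp.V = x.V) : x = .emp := eq_emp fun p hp => by rw [← h] at hp; exact hp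

theorem d_nat {f g h : QQ} (hf : T f x x') (hg : T g y y') (hh : T h z z') :
    comp (op false (op true f g) h) (d x y z) = comp (d x' y' z') (op true f (op false g h)) := by
  have v1 := V_T hf
  have v2 := V_T hg
  have v3 := V_T hh
  by_cases ok : Ok3 x y z ∧ ∃ p, p ∈ y.V
  swap
  · rw [d_bot ok, d_bot, comp_bot, bot_comp]
    rintro ⟨k, hy⟩
    exact ok ⟨Ok3.congr k v1.symm v2.symm v3.symm (src_T hf) (src_T hg) (src_T hh), v2 ▸ hy⟩
  obtain ⟨ok, hy⟩ := ok
  have ok' := Ok3.congr ok v1 v2 v3 (tgt_T hf) (tgt_T hg) (tgt_T hh)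
  have hy' : ∃ p, p ∈ y'.V := v2 ▸ hy
  rcases T_cases hf with ⟨rfl, rfl, rfl⟩ | ⟨A, A', f, hA, rfl, rfl, rfl⟩
  · rw [d_emp_l ok.c2 ok.c3 ok.h23 hy, d_emp_l ok'.c2 ok'.c3 ok'.h23 hy', emp_op, emp_op]
    have := op_T false hg hh ok.h23
    exact (comp_id this).trans (id_comp this).symm
  rcases T_cases hh with ⟨rfl, rfl, rfl⟩ | ⟨C, C', h, hC, rfl, rfl, rfl⟩
  · rw [d_emp_r ok.c1 ok.c2 ok.h12 hy, d_emp_r ok'.c1 ok'.c2 ok'.h12 hy', op_emp, op_emp]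
    have := op_T true hf hg ok.h12
    exact (comp_id this).trans (id_comp this).symm
  rcases T_cases hg with ⟨rfl, rfl, rfl⟩ | ⟨B, B', g, hB, rfl, rfl, rfl⟩
  · obtain ⟨p, hp⟩ := hy; exact hp.elim
  have hd := Ok3.div ok hA hB hC
  have hd' := Ok3.div ok' (div_tgt f hA) (div_tgt g hB) (div_tgt h hC)
  rw [op_mk true hA hB ok.h12, op_mk false hB hC ok.h23,
    op_mk false (A := A ⋏ B) _ hC (dj_conj_left.2 ⟨ok.h13, ok.h23⟩),
    op_mk true (C := B ⋎ C) hA _ (dj_disj_right.2 ⟨ok.h12, ok.h13⟩), d_mk hd, d_mk hd', comp_mk, comp_mk, md_nat]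

theorem dConj (h : Ok4 x x' y z) (hy : ∃ p, p ∈ y.V) :
    d (x.conj x') y z = comp (d x (x'.conj y) z) (op true (id x) (d x' y z)) := by
  have k2 : Ok3 x' y z := ⟨h.c2, h.c3, h.c4, h.h23, h.h24, h.h34⟩
  have hy2 : ∃ p, p ∈ (x'.conj y).V := hy.imp fun p hp => Or.inr hp
  have c2 : Cog (x'.conj y) := .conj h.c2 h.c3 h.h23
  rcases cog_cases h.c1 with rfl | ⟨A, hA, rfl⟩
  · rw [emp_conj, d_emp_l c2 h.c4 (dj_conj_left.2 ⟨h.h24, h.h34⟩) hy2, id_emp, emp_op,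
      id_comp (d_T k2 hy)]
  rcases cog_cases h.c2 with rfl | ⟨A', hA', rfl⟩
  · rw [conj_emp, emp_conj, d_emp_l h.c3 h.c4 h.h34 hy,
      op_id true h.c1 (.disj h.c3 h.c4 h.h34) (dj_disj_right.2 ⟨h.h13, h.h14⟩)]
    exact (comp_id (d_T ⟨h.c1, h.c3, h.c4, h.h13, h.h14, h.h34⟩ hy)).symm
  obtain ⟨B, hB, rfl⟩ := ne_gr h.c3 hy
  rcases cog_cases h.c4 with rfl | ⟨C, hC, rfl⟩
  · rw [d_emp_r (.conj h.c1 h.c2 h.h12) h.c3 (dj_conj_left.2 ⟨h.h13, h.h23⟩) hy,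
      d_emp_r h.c1 c2 (dj_conj_right.2 ⟨h.h12, h.h13⟩) hy2, d_emp_r h.c2 h.c3 h.h23 hy,
      op_id true h.c1 c2 (dj_conj_right.2 ⟨h.h12, h.h13⟩), conj_assoc]
    exact (id_comp (id_T (.conj h.c1 c2 (dj_conj_right.2 ⟨h.h12, h.h13⟩)))).symm
  have d1 : Div (A' ⋏ (B ⋎ C)) := Ok3.div k2 hA' hB hC
  have d2 : Div (A ⋏ ((A' ⋏ B) ⋎ C)) := by
    obtain ⟨_, _, _, _, h12, h13, h14, h23, h24, h34⟩ := h
    simp only [Obj.dj, gr_V] at *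
    simp only [Div, lets, Set.mem_union]; grind
  have d3 : Div ((A ⋏ A') ⋏ (B ⋎ C)) := by
    obtain ⟨_, _, _, _, h12, h13, h14, h23, h24, h34⟩ := h
    simp only [Obj.dj, gr_V] at *
    simp only [Div, lets, Set.mem_union]; grind
  have e1 : d ((gr A).conj (gr A')) (gr B) (gr C) = mk (md (A ⋏ A') B C) d3 := d_mk d3
  have e2 : d (gr A) ((gr A').conj (gr B)) (gr C) = mk (md A (A' ⋏ B) C) d2 := d_mk d2
  rw [e1, e2, d_mk d1, id_gr hA, op_mk true hA d1 (Div.dj (c := true) (B := A' ⋏ (B ⋎ C)) (by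
    obtain ⟨_, _, _, _, h12, h13, h14, h23, h24, h34⟩ := h
    simp only [Obj.dj, gr_V] at *
    simp only [Div, lets, Set.mem_union]; grind)), comp_mk]
  exact mk_eq (asFr true _ _ _) (mOp false (asFr true _ _ _) (𝟙 _)) (.asFr _ _ _ _)
    (.op _ (.asFr _ _ _ _) (.id _)) (by rw [e_dConj, Category.assoc])

end QQ
end DSC

open CategoryTheory

namespace DSC
open Obj

namespace QQ

variable {A B C D E A' B' C' : Form ℕ} {x y z x' y' z' w : Obj}

theorem mk_mdR (h : Div ((C ⋎ B) ⋏ A)) : mk (mdR C B A) h = d (gr A) (gr B) (gr C) := by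
  have h' : Div (A ⋏ (B ⋎ C)) := by
    simp only [Div, lets, Set.mem_union] at *; grind
  rw [d_mk h']
  refine mk_eq (cm true (C ⋎ B) A ≫ mOp true (𝟙 A) (cm false C B))
    (cm false C (B ⋏ A) ≫ mOp false (cm true B A) (𝟙 C))
    (.comp (.cm _ _ _) (.op _ (.id _) (.cm _ _ _)))
    (.comp (.cm _ _ _) (.op _ (.cm _ _ _) (.id _))) ?_
  have k : mOp false (cm true A B) (𝟙 C) ≫ cm false (B ⋏ A) C ≫ cm false C (B ⋏ A) ≫
      mOp false (cm true B A) (𝟙 C) = 𝟙 _ := by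
    rw [← Category.assoc (cm false (B ⋏ A) C), cm_cm, Category.id_comp, ← mOp_comp, cm_cm,
      Category.comp_id, mOp_id]
  simp only [mdR, Category.assoc]
  rw [k, Category.comp_id]

theorem T_comp_id {f g : QQ} (h : T f x y) (e : g = id x) : comp f g = f := by
  rw [e]; exact comp_id h

theorem T_id_comp {f g : QQ} (h : T f x y) (e : g = id y) : comp g f = f := by
  rw [e]; exact id_comp h

theorem dDisj (h : Ok4 x y z z') (hy : ∃ p, p ∈ y.V) :
    d x y (z.disj z') = comp (op false (d x y z) (id z')) (d x (y.disj z) z') := by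
  have k3 : Ok3 x y z := ⟨h.c1, h.c2, h.c3, h.h12, h.h13, h.h23⟩
  have hy2 : ∃ p, p ∈ (y.disj z).V := hy.imp fun p hp => Or.inl hp
  have c2 : Cog (y.disj z) := .disj h.c2 h.c3 h.h23
  have c3 : Cog (z.disj z') := .disj h.c3 h.c4 h.h34
  have j1 : dj (y.disj z) z' := dj_disj_left.2 ⟨h.h24, h.h34⟩
  rcases cog_cases h.c4 with rfl | ⟨C', hC', rfl⟩
  · rw [disj_emp, id_emp, op_emp, d_emp_r h.c1 c2 (dj_disj_right.2 ⟨h.h12, h.h13⟩) hy2,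
      comp_id (d_T k3 hy)]
  rcases cog_cases h.c3 with rfl | ⟨C, hC, rfl⟩
  · have k : Ok3 x y (gr C') := ⟨h.c1, h.c2, h.c4, h.h12, h.h14, h.h24⟩
    rw [emp_disj, disj_emp, d_emp_r h.c1 h.c2 h.h12 hy]
    refine (T_id_comp (d_T k hy) ?_).symm
    exact op_id false (.conj h.c1 h.c2 h.h12) h.c4 (dj_conj_left.2 ⟨h.h14, h.h24⟩)
  obtain ⟨B, hB, rfl⟩ := ne_gr h.c2 hy
  rcases cog_cases h.c1 with rfl | ⟨A, hA, rfl⟩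
  · rw [d_emp_l h.c2 c3 (dj_disj_right.2 ⟨h.h23, h.h24⟩) hy, d_emp_l h.c2 h.c3 h.h23 hy,
      d_emp_l c2 h.c4 j1 hy2, op_id false c2 h.c4 j1, ← disj_assoc]
    exact (id_comp (id_T (.disj c2 h.c4 j1))).symm
  obtain ⟨_, _, _, _, h12, h13, h14, h23, h24, h34⟩ := h
  simp only [Obj.dj, gr_V] at *
  have d1 : Div (A ⋏ (B ⋎ C)) := by
    simp only [Div, lets, Set.mem_union]; grind
  have d2 : Div (A ⋏ ((B ⋎ C) ⋎ C')) := by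
    simp only [Div, lets, Set.mem_union]; grind
  have d3 : Div (A ⋏ (B ⋎ (C ⋎ C'))) := by
    simp only [Div, lets, Set.mem_union]; grind
  have d4 : Div (((A ⋏ B) ⋎ C) ⋎ C') := by
    simp only [Div, lets, Set.mem_union]; grind
  have d5 : Div ((A ⋏ (B ⋎ C)) ⋎ C') := by
    simp only [Div, lets, Set.mem_union]; grind
  have e1 : d (gr A) (gr B) ((gr C).disj (gr C')) = mk (md A B (C ⋎ C')) d3 := d_mk d3
  have e2 : d (gr A) ((gr B).disj (gr C)) (gr C') = mk (md A (B ⋎ C) C') d2 := d_mk d2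
  rw [e1, e2, d_mk d1, id_gr hC', op_mk false d1 hC' (Div.dj (c := false) d5), comp_mk]
  exact (mk_eq (mOp true (𝟙 _) (asFr false _ _ _)) (asFr false _ _ _)
    (.op _ (.id _) (.asFr _ _ _ _)) (.asFr _ _ _ _) (e_dDisj _ _ _ _)).symm

theorem dBConj {a b c e : Obj} (h : Ok4 a b c e) (hb : ∃ p, p ∈ b.V) (hc : ∃ p, p ∈ c.V) :
    comp (d e c (a.conj b)) (op true (d a b c) (id e)) =
      comp (d a b (c.conj e)) (op true (id a) (d e c b)) := by
  have h' := h
  obtain ⟨c1, c2, c3, c4, h12, h13, h14, h23, h24, h34⟩ := h'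
  have k1 : Ok3 e c b := ⟨c4, c3, c2, h34.symm, h24.symm, h23.symm⟩
  have k2 : Ok3 a b c := ⟨c1, c2, c3, h12, h13, h23⟩
  have cbc := Cog.disj c2 c3 h23
  have cab := Cog.conj c1 c2 h12
  have cce := Cog.conj c3 c4 h34
  rcases cog_cases c1 with rfl | ⟨A, hA, rfl⟩
  · rw [emp_conj, id_emp, emp_op, d_emp_l c2 c3 h23 hb,
      d_emp_l c2 cce (dj_conj_right.2 ⟨h23, h24⟩) hb,
      op_id true cbc c4 (dj_disj_left.2 ⟨h24, h34⟩)]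
    rw [T_comp_id (d_T k1 hc), T_id_comp (d_T k1 hc)]
    · rw [Obj.disj_comm, Obj.conj_comm c]
    · rw [Obj.conj_comm, Obj.disj_comm b]; rfl
  rcases cog_cases c4 with rfl | ⟨E, hE, rfl⟩
  · rw [conj_emp, id_emp, op_emp, d_emp_l c3 c2 h23.symm hc,
      d_emp_l c3 cab (dj_conj_right.2 ⟨h13.symm, h23.symm⟩) hc,
      op_id true c1 (Cog.disj c3 c2 h23.symm) (dj_disj_right.2 ⟨h13, h12⟩)]
    rw [T_comp_id (d_T k2 hb), T_id_comp (d_T k2 hb)]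
    · rw [Obj.disj_comm]
    · rw [Obj.disj_comm c]; rfl
  obtain ⟨B, hB, rfl⟩ := ne_gr c2 hb
  obtain ⟨C, hC, rfl⟩ := ne_gr c3 hc
  simp only [Obj.dj, gr_V] at *
  have d1 : Div (A ⋏ (B ⋎ C)) := by
    simp only [Div, lets, Set.mem_union]; grind
  have d2 : Div ((B ⋎ C) ⋏ E) := by
    simp only [Div, lets, Set.mem_union]; grind
  have d3 : Div (((A ⋏ B) ⋎ C) ⋏ E) := by
    simp only [Div, lets, Set.mem_union]; grind
  have d4 : Div (A ⋏ (B ⋎ (C ⋏ E))) := by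
    simp only [Div, lets, Set.mem_union]; grind
  have d5 : Div ((A ⋏ (B ⋎ C)) ⋏ E) := by
    simp only [Div, lets, Set.mem_union]; grind
  have d6 : Div (A ⋏ ((B ⋎ C) ⋏ E)) := by
    simp only [Div, lets, Set.mem_union]; grind
  have e1 : d (gr E) (gr C) ((gr A).conj (gr B)) = mk (mdR (A ⋏ B) C E) d3 := (mk_mdR d3).symm
  have e2 : d (gr A) (gr B) ((gr C).conj (gr E)) = mk (md A B (C ⋏ E)) d4 := d_mk d4
  rw [e1, e2, d_mk d1, id_gr hA, id_gr hE, ← mk_mdR d2, op_mk true d1 hE (Div.dj (c := true) d5),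
    op_mk true hA d2 (Div.dj (c := true) d6), comp_mk, comp_mk]
  refine mk_eq (asFr true _ _ _) (𝟙 _) (.asFr _ _ _ _) (.id _) ?_
  rw [e_dBConj, Category.comp_id, Category.assoc]

theorem dBDisj {a b c e : Obj} (h : Ok4 a b c e) (hb : ∃ p, p ∈ b.V) (hc : ∃ p, p ∈ c.V) :
    comp (op false (id e) (d c b a)) (d (b.disj a) c e) =
      comp (op false (d b c e) (id a)) (d (e.disj c) b a) := by
  have h' := h
  obtain ⟨c1, c2, c3, c4, h12, h13, h14, h23, h24, h34⟩ := h'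
  have k1 : Ok3 b c e := ⟨c2, c3, c4, h23, h24, h34⟩
  have k2 : Ok3 c b a := ⟨c3, c2, c1, h23.symm, h13.symm, h12.symm⟩
  have cbc := Cog.conj c2 c3 h23
  have ccb := Cog.conj c3 c2 h23.symm
  have cba := Cog.disj c2 c1 h12.symm
  have cec := Cog.disj c4 c3 h34.symm
  rcases cog_cases c1 with rfl | ⟨A, hA, rfl⟩
  · rw [disj_emp, id_emp, op_emp, d_emp_r c3 c2 h23.symm hb,
      d_emp_r cec c2 (dj_disj_left.2 ⟨h24.symm, h23.symm⟩) hb,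
      op_id false c4 ccb (dj_conj_right.2 ⟨h34.symm, h24.symm⟩)]
    rw [T_comp_id (d_T k1 hc), T_id_comp (d_T k1 hc)]
    · change id (e.disj (c.conj b)) = _
      rw [Obj.disj_comm, Obj.conj_comm c]
    · rw [Obj.conj_comm, Obj.disj_comm e]
  rcases cog_cases c4 with rfl | ⟨E, hE, rfl⟩
  · rw [emp_disj, id_emp, emp_op, d_emp_r c2 c3 h23 hc,
      d_emp_r cba c3 (dj_disj_left.2 ⟨h23, h13⟩) hc,
      op_id false cbc c1 (dj_conj_left.2 ⟨h12.symm, h13.symm⟩)]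
    rw [T_comp_id (d_T k2 hb), T_id_comp (d_T k2 hb)]
    · change id ((b.conj c).disj _) = _
      rw [Obj.conj_comm b]
    · rw [Obj.conj_comm]
  obtain ⟨B, hB, rfl⟩ := ne_gr c2 hb
  obtain ⟨C, hC, rfl⟩ := ne_gr c3 hc
  simp only [Obj.dj, gr_V] at *
  have d1 : Div (C ⋏ (B ⋎ A)) := by
    simp only [Div, lets, Set.mem_union]; grind
  have d2 : Div ((E ⋎ C) ⋏ (B ⋎ A)) := by
    simp only [Div, lets, Set.mem_union]; grind
  have d3 : Div ((E ⋎ C) ⋏ B) := by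
    simp only [Div, lets, Set.mem_union]; grind
  have d5 : Div (E ⋎ (C ⋏ (B ⋎ A))) := by
    simp only [Div, lets, Set.mem_union]; grind
  have d6 : Div (((E ⋎ C) ⋏ B) ⋎ A) := by
    simp only [Div, lets, Set.mem_union]; grind
  have e1 : d ((gr B).disj (gr A)) (gr C) (gr E) = mk (mdR E C (B ⋎ A)) d2 := (mk_mdR d2).symm
  have e2 : d ((gr E).disj (gr C)) (gr B) (gr A) = mk (md (E ⋎ C) B A) d2 := d_mk d2
  rw [e1, e2, d_mk d1, id_gr hA, id_gr hE, ← mk_mdR d3, op_mk false hE d1 (Div.dj (c := false) d5),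
    op_mk false d3 hA (Div.dj (c := false) d6), comp_mk, comp_mk]
  refine (mk_eq (𝟙 _) (asFr false _ _ _) (.id _) (.asFr _ _ _ _) ?_).symm
  rw [e_dBDisj, Category.id_comp]

theorem gen (M : QQ → Prop) (h1 : ∀ x, Cog x → M (id x))
    (h2 : ∀ x y z, Ok3 x y z → (∃ p, p ∈ y.V) → M (d x y z))
    (h3 : ∀ g f x y z, T g y z → T f x y → M g → M f → M (comp g f))
    (h4 : ∀ c f g x y z w, T f x y → T g z w → dj x z → M f → M g → M (op c f g))
    (f : QQ) (x y : Obj) (hf : T f x y) : M f := by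
  have key : ∀ {A B : Form ℕ} (f : A ⟶ B) (h : Div A), M (mk f h) := by
    intro A B f
    have ac : ∀ {A B : Form ℕ} {f : A ⟶ B} (hf : IsAC f) (h : Div A), M (mk f h) := by
      intro A B f hf h
      rw [mk_ac hf, ← id_gr h]
      exact h1 _ h.cog
    refine hom_ind (fun {A B} f => ∀ h : Div A, M (mk f h)) ?_ ?_ ?_ ?_ ?_ ?_ ?_ f
    · intro A h; exact ac (.id _) h
    · intro A B C f g hf hg h
      rw [← comp_mk h (div_tgt f h)]
      exact h3 _ _ _ _ _ (T_mk _) (T_mk _) (hg _) (hf _)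
    · intro c A B D E f g hf hg h
      have hA : Div A := by cases c <;> exact h.1
      have hB : Div B := by cases c <;> exact h.2.1
      have hj : dj (gr A) (gr B) := Div.dj h
      rw [← op_mk c hA hB hj]
      exact h4 _ _ _ _ _ _ _ (T_mk _) (T_mk _) hj (hf _) (hg _)
    · intro c A B C h; exact ac (.asTo _ _ _ _) h
    · intro c A B C h; exact ac (.asFr _ _ _ _) h
    · intro c A B h; exact ac (.cm _ _ _) h
    · intro A B C h
      rw [← d_mk h]
      have j1 := Div.dj (c := true) h
      have j2 := dj_disj_right.1 j1
      exact h2 _ _ _ ⟨h.1.cog, h.2.1.1.cog, h.2.1.2.1.cog, j2.1, j2.2, Div.dj (c := false) h.2.1⟩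
        (gr_nonempty B)
  rcases T_cases hf with ⟨rfl, _, _⟩ | ⟨A, B, f, h, rfl, _, _⟩
  · rw [← id_emp]; exact h1 _ .emp
  · exact key f h

/-- DS as an abstract net. -/
noncomputable def dsNet : Net where
  toNData := dsD
  id_T h := id_T h
  comp_T hg hf := comp_T hg hf
  conj_T hf hg h := op_T true hf hg h
  disj_T hf hg h := op_T false hf hg h
  d_T h k := d_T h k
  V_T h := V_T h
  src_T h := src_T h
  tgt_T h := tgt_T h
  id_comp h := id_comp h
  comp_id h := comp_id h
  assoc := assoc
  conj_comm := op_comm true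
  disj_comm := op_comm false
  conj_assoc := op_assoc true
  disj_assoc := op_assoc false
  conj_unit f := (congrArg (op true f) id_emp).trans (op_emp true f)
  disj_unit f := (congrArg (op false f) id_emp).trans (op_emp false f)
  conj_id hx hy h := op_id true hx hy h
  disj_id hx hy h := op_id false hx hy h
  conj_comp h1 h2 := op_comp true h1 h2
  disj_comp h1 h2 := op_comp false h1 h2
  d_nat hf hg hh := d_nat hf hg hh
  d_emp_l := d_emp_l
  d_emp_r := d_emp_r
  dConj h k := dConj h k
  dDisj h k := dDisj h k
  dBConj h k l := dBConj h k l
  dBDisj h k l := dBDisj h k l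
  gen M h1 h2 h3 h4 h5 f x y hf := gen M h1 h2 h3
    (fun c => match c with | true => h4 | false => h5) f x y hf

end QQ

/-- Thinness of DS on diversified formulae. -/
theorem thin_div {A B : Form ℕ} (h : Div A) (f g : A ⟶ B) : f = g :=
  QQ.mk_same (h := h) (h' := h) (Net.thin (N := QQ.dsNet) (QQ.T_mk h) (QQ.T_mk h))

end DSC

open CategoryTheory

namespace DSC

/-! ### Part 7: reduction to diversified formulae -/

section Ren
variable {Q P : Type}

/-- Renaming of formulae. -/
def mapF (σ : Q → P) : Form Q → Form P
  | .letter p => .letter (σ p)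
  | .conj A B => mapF σ A ⋏ mapF σ B
  | .disj A B => mapF σ A ⋎ mapF σ B

/-- Renaming of arrow terms. -/
def mapT (σ : Q → P) : ∀ {A B : Form Q}, Term Q A B → Term P (mapF σ A) (mapF σ B)
  | _, _, .id A => .id (mapF σ A)
  | _, _, .comp g f => .comp (mapT σ g) (mapT σ f)
  | _, _, .conj f g => .conj (mapT σ f) (mapT σ g)
  | _, _, .disj f g => .disj (mapT σ f) (mapT σ g)
  | _, _, .bConjTo A B C => .bConjTo (mapF σ A) (mapF σ B) (mapF σ C)
  | _, _, .bConjFrom A B C => .bConjFrom (mapF σ A) (mapF σ B) (mapF σ C)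
  | _, _, .bDisjTo A B C => .bDisjTo (mapF σ A) (mapF σ B) (mapF σ C)
  | _, _, .bDisjFrom A B C => .bDisjFrom (mapF σ A) (mapF σ B) (mapF σ C)
  | _, _, .cConj A B => .cConj (mapF σ A) (mapF σ B)
  | _, _, .cDisj A B => .cDisj (mapF σ A) (mapF σ B)
  | _, _, .d A B C => .d (mapF σ A) (mapF σ B) (mapF σ C)

theorem mapT_eqv (σ : Q → P) {A B : Form Q} {f g : Term Q A B} (h : Eqv f g) :
    Eqv (mapT σ f) (mapT σ g) := by
  induction h with
  | refl f => exact .refl _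
  | symm _ ih => exact .symm ih
  | trans _ _ ih1 ih2 => exact .trans ih1 ih2
  | congComp _ _ ih1 ih2 => exact .congComp ih1 ih2
  | congConj _ _ ih1 ih2 => exact .congConj ih1 ih2
  | congDisj _ _ ih1 ih2 => exact .congDisj ih1 ih2
  | catIdR => exact .catIdR _
  | catIdL => exact .catIdL _
  | catAssoc => exact .catAssoc _ _ _
  | conjOne => exact .conjOne _ _
  | disjOne => exact .disjOne _ _
  | conjTwo => exact .conjTwo _ _ _ _
  | disjTwo => exact .disjTwo _ _ _ _
  | bConjNat => exact .bConjNat _ _ _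
  | bDisjNat => exact .bDisjNat _ _ _
  | cConjNat => exact .cConjNat _ _
  | cDisjNat => exact .cDisjNat _ _
  | dNat => exact .dNat _ _ _
  | bConjIso₁ => exact .bConjIso₁ _ _ _
  | bConjIso₂ => exact .bConjIso₂ _ _ _
  | bDisjIso₁ => exact .bDisjIso₁ _ _ _
  | bDisjIso₂ => exact .bDisjIso₂ _ _ _
  | bConjPent => exact .bConjPent _ _ _ _
  | bDisjPent => exact .bDisjPent _ _ _ _
  | cConjIso => exact .cConjIso _ _
  | cDisjIso => exact .cDisjIso _ _
  | bcConj => exact .bcConj _ _ _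
  | bcDisj => exact .bcDisj _ _ _
  | dConj => exact .dConj _ _ _ _
  | dDisj => exact .dDisj _ _ _ _
  | dBConj => exact .dBConj _ _ _ _
  | dBDisj => exact .dBDisj _ _ _ _

theorem mapF_size (σ : Q → P) (A : Form Q) : (mapF σ A).size = A.size := by
  induction A with
  | letter => rfl
  | conj A B h1 h2 => simp only [mapF, Form.size, h1, h2]
  | disj A B h1 h2 => simp only [mapF, Form.size, h1, h2]

theorem mapT_G (σ : Q → P) {A B : Form Q} (f : Term Q A B) : (mapT σ f).G = f.G := by
  induction f <;> simp only [mapT, Term.G, mapF_size, *]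

theorem mapF_conj (σ : Q → P) {A' : Form Q} {A B : Form P} (h : mapF σ A' = A ⋏ B) :
    ∃ A₁ B₁, A' = A₁ ⋏ B₁ ∧ mapF σ A₁ = A ∧ mapF σ B₁ = B := by
  cases A' with
  | letter => cases h
  | disj => cases h
  | conj X Y => simp only [mapF, Form.conj.injEq] at h; exact ⟨X, Y, rfl, h.1, h.2⟩

theorem mapF_disj (σ : Q → P) {A' : Form Q} {A B : Form P} (h : mapF σ A' = A ⋎ B) :
    ∃ A₁ B₁, A' = A₁ ⋎ B₁ ∧ mapF σ A₁ = A ∧ mapF σ B₁ = B := by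
  cases A' with
  | letter => cases h
  | conj => cases h
  | disj X Y => simp only [mapF, Form.disj.injEq] at h; exact ⟨X, Y, rfl, h.1, h.2⟩

theorem lift_term (σ : Q → P) {A B : Form P} (f : Term P A B) : ∀ A' : Form Q, mapF σ A' = A →
    ∃ (B' : Form Q) (f' : Term Q A' B'), mapF σ B' = B ∧ HEq (mapT σ f') f := by
  induction f with
  | id A => rintro A' rfl; exact ⟨A', .id _, rfl, HEq.rfl⟩
  | comp g f ihg ihf =>
    rintro A' rfl
    obtain ⟨B', f', rfl, hf⟩ := ihf A' rfl
    obtain ⟨C', g', rfl, hg⟩ := ihg B' rfl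
    obtain rfl := eq_of_heq hf
    obtain rfl := eq_of_heq hg
    exact ⟨C', .comp g' f', rfl, HEq.rfl⟩
  | conj f g ihf ihg =>
    intro A' h
    obtain ⟨A₁, B₁, rfl, rfl, rfl⟩ := mapF_conj σ h
    obtain ⟨B', f', rfl, hf⟩ := ihf A₁ rfl
    obtain ⟨C', g', rfl, hg⟩ := ihg B₁ rfl
    obtain rfl := eq_of_heq hf
    obtain rfl := eq_of_heq hg
    exact ⟨_, .conj f' g', rfl, HEq.rfl⟩
  | disj f g ihf ihg =>
    intro A' h
    obtain ⟨A₁, B₁, rfl, rfl, rfl⟩ := mapF_disj σ h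
    obtain ⟨B', f', rfl, hf⟩ := ihf A₁ rfl
    obtain ⟨C', g', rfl, hg⟩ := ihg B₁ rfl
    obtain rfl := eq_of_heq hf
    obtain rfl := eq_of_heq hg
    exact ⟨_, .disj f' g', rfl, HEq.rfl⟩
  | bConjTo A B C =>
    intro A' h
    obtain ⟨A₁, X, rfl, rfl, h'⟩ := mapF_conj σ h
    obtain ⟨B₁, C₁, rfl, rfl, rfl⟩ := mapF_conj σ h'
    exact ⟨_, .bConjTo _ _ _, rfl, HEq.rfl⟩
  | bConjFrom A B C =>
    intro A' h
    obtain ⟨X, C₁, rfl, h', rfl⟩ := mapF_conj σ h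
    obtain ⟨A₁, B₁, rfl, rfl, rfl⟩ := mapF_conj σ h'
    exact ⟨_, .bConjFrom _ _ _, rfl, HEq.rfl⟩
  | bDisjTo A B C =>
    intro A' h
    obtain ⟨A₁, X, rfl, rfl, h'⟩ := mapF_disj σ h
    obtain ⟨B₁, C₁, rfl, rfl, rfl⟩ := mapF_disj σ h'
    exact ⟨_, .bDisjTo _ _ _, rfl, HEq.rfl⟩
  | bDisjFrom A B C =>
    intro A' h
    obtain ⟨X, C₁, rfl, h', rfl⟩ := mapF_disj σ h
    obtain ⟨A₁, B₁, rfl, rfl, rfl⟩ := mapF_disj σ h'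
    exact ⟨_, .bDisjFrom _ _ _, rfl, HEq.rfl⟩
  | cConj A B =>
    intro A' h
    obtain ⟨X, Y, rfl, rfl, rfl⟩ := mapF_conj σ h
    exact ⟨_, .cConj _ _, rfl, HEq.rfl⟩
  | cDisj A B =>
    intro A' h
    obtain ⟨X, Y, rfl, rfl, rfl⟩ := mapF_disj σ h
    exact ⟨_, .cDisj _ _, rfl, HEq.rfl⟩
  | d A B C =>
    intro A' h
    obtain ⟨A₁, X, rfl, rfl, h'⟩ := mapF_conj σ h
    obtain ⟨B₁, C₁, rfl, rfl, rfl⟩ := mapF_disj σ h'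
    exact ⟨_, .d _ _ _, rfl, HEq.rfl⟩

/-- The list of letters. -/
def lst : Form Q → List Q
  | .letter p => [p]
  | .conj A B => lst A ++ lst B
  | .disj A B => lst A ++ lst B

theorem lst_length (A : Form Q) : (lst A).length = A.size := by
  induction A with
  | letter => rfl
  | conj A B h1 h2 => simp only [lst, Form.size, List.length_append, h1, h2]
  | disj A B h1 h2 => simp only [lst, Form.size, List.length_append, h1, h2]

theorem lst_inj (σ : Q → P) : ∀ {A B : Form Q}, mapF σ A = mapF σ B → lst A = lst B → A = B := by
  intro A
  induction A with
  | letter p =>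
    intro B h h'
    cases B with
    | letter => simp only [lst, List.cons.injEq] at h'; rw [h'.1]
    | conj => cases h
    | disj => cases h
  | conj A B h1 h2 =>
    intro C h h'
    cases C with
    | letter => cases h
    | conj X Y =>
      simp only [mapF, Form.conj.injEq] at h
      obtain ⟨k1, k2⟩ := List.append_inj h' (by
        rw [lst_length, lst_length, ← mapF_size σ, h.1, mapF_size])
      rw [h1 h.1 k1, h2 h.2 k2]
    | disj => cases h
  | disj A B h1 h2 =>
    intro C h h'
    cases C with
    | letter => cases h
    | disj X Y =>
      simp only [mapF, Form.disj.injEq] at h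
      obtain ⟨k1, k2⟩ := List.append_inj h' (by
        rw [lst_length, lst_length, ← mapF_size σ, h.1, mapF_size])
      rw [h1 h.1 k1, h2 h.2 k2]
    | conj => cases h

/-- Labels of points. -/
def lb (A B : List Q) : ℕ ⊕ ℕ → Option Q
  | .inl i => A[i]?
  | .inr j => B[j]?

/-- A split relation compatible with labels. -/
def Sound (A B : List Q) (R : GRel) : Prop :=
  (∀ u v, R u v → ∃ n, lb A B u = some n ∧ lb A B v = some n) ∧
  ∀ j, j < B.length → ∃ i, R (.inl i) (.inr j)

theorem sound_id (A : List Q) (n : ℕ) (h : n = A.length) : Sound A A (gId n) := by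
  subst h
  constructor
  · rintro u v ⟨i, hi, hu, hv⟩
    refine ⟨A[i], ?_, ?_⟩
    · rcases hu with rfl | rfl <;> simp [lb, hi]
    · rcases hv with rfl | rfl <;> simp [lb, hi]
  · intro j hj
    exact ⟨j, j, hj, Or.inl rfl, Or.inr rfl⟩

theorem sound_swap (A B : List Q) (a b : ℕ) (ha : a = A.length) (hb : b = B.length) :
    Sound (A ++ B) (B ++ A) (gSwap a b) := by
  subst ha hb
  constructor
  · rintro u v ⟨i, hi, hu, hv⟩
    have key : (B ++ A)[if i < A.length then i + B.length else i - A.length]? = (A ++ B)[i]? := by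
      split_ifs with h
      · rw [List.getElem?_append_right (by omega), List.getElem?_append_left h]
        congr 1; omega
      · rw [List.getElem?_append_left (by omega), List.getElem?_append_right (by omega)]
    have hi' : i < (A ++ B).length := by rw [List.length_append]; exact hi
    have e : (A ++ B)[i]? = some (A ++ B)[i] := List.getElem?_eq_getElem hi'
    refine ⟨(A ++ B)[i], ?_, ?_⟩
    · rcases hu with rfl | rfl
      · exact e
      · exact key.trans e
    · rcases hv with rfl | rfl
      · exact e
      · exact key.trans e
  · intro j hj
    rw [List.length_append] at hj
    by_cases h : j < B.length
    · refine ⟨j + A.length, j + A.length, by omega, Or.inl rfl, Or.inr ?_⟩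
      beta_reduce; rw [if_neg (by omega)]; congr 1; omega
    · refine ⟨j - B.length, j - B.length, by omega, Or.inl rfl, Or.inr ?_⟩
      beta_reduce; rw [if_pos (by omega)]; congr 1; omega

theorem sound_comp {A B C : List Q} {R S : GRel} (hR : Sound A B R) (hS : Sound B C S) :
    Sound A C (gComp S R) := by
  constructor
  · intro u v h
    let l : ℕ ⊕ ℕ ⊕ ℕ → Option Q
      | .inl i => A[i]?
      | .inr (.inl i) => B[i]?
      | .inr (.inr i) => C[i]?
    have l1 : ∀ x, l (Sum.map id Sum.inl x) = lb A B x := by rintro (x | x) <;> rfl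
    have l2 : ∀ x, l (Sum.inr x) = lb B C x := by rintro (x | x) <;> rfl
    have l3 : ∀ x, l (Sum.map id Sum.inr x) = lb A C x := by rintro (x | x) <;> rfl
    have step : ∀ x y, ((∃ x' y', Sum.map id Sum.inl x' = x ∧ Sum.map id Sum.inl y' = y ∧ R x' y') ∨
        (∃ x' y', Sum.inr x' = x ∧ Sum.inr y' = y ∧ S x' y')) →
        ∃ n, l x = some n ∧ l y = some n := by
      rintro x y (⟨x', y', rfl, rfl, h⟩ | ⟨x', y', rfl, rfl, h⟩)
      · rw [l1, l1]; exact hR.1 _ _ h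
      · rw [l2, l2]; exact hS.1 _ _ h
    have : ∃ n, l (Sum.map id Sum.inr u) = some n ∧ l (Sum.map id Sum.inr v) = some n := by
      unfold gComp at h
      generalize Sum.map id Sum.inr u = a at h
      generalize Sum.map id Sum.inr v = b at h
      induction h with
      | single h => exact step _ _ h
      | tail _ h ih =>
        obtain ⟨n, h1, h2⟩ := ih
        obtain ⟨m, h3, h4⟩ := step _ _ h
        rw [h2] at h3
        exact ⟨n, h1, by rw [h4, h3]⟩
    rwa [l3, l3] at this
  · intro j hj
    obtain ⟨k, hk⟩ := hS.2 j hj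
    obtain ⟨n, h1, _⟩ := hS.1 _ _ hk
    have hk' : k < B.length := by
      by_contra h
      have : B[k]? = none := List.getElem?_eq_none (by omega)
      have h1 : B[k]? = some n := h1
      simp [this] at h1
    obtain ⟨i, hi⟩ := hR.2 k hk'
    refine ⟨i, .tail (.single (b := Sum.inr (Sum.inl k)) (Or.inl ⟨.inl i, .inr k, rfl, rfl, hi⟩))
      (Or.inr ⟨.inl k, .inr j, rfl, rfl, hk⟩)⟩

theorem get_left {A B : List Q} {i : ℕ} {n : Q} (h : A[i]? = some n) : (A ++ B)[i]? = some n := by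
  rw [List.getElem?_append_left, h]
  by_contra hh
  rw [List.getElem?_eq_none (by omega)] at h
  cases h

theorem get_right {A B : List Q} {i : ℕ} {n : Q} (h : B[i]? = some n) :
    (A ++ B)[i + A.length]? = some n := by
  rw [List.getElem?_append_right (by omega), Nat.add_sub_cancel, h]

theorem sound_par {A B D E : List Q} {R S : GRel} (hR : Sound A D R) (hS : Sound B E S) (a d : ℕ)
    (ha : a = A.length) (hd : d = D.length) : Sound (A ++ B) (D ++ E) (gPar a d R S) := by
  subst ha hd
  have k1 : ∀ u n, lb A D u = some n → lb (A ++ B) (D ++ E) u = some n := by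
    rintro (u | u) n h
    · exact get_left h
    · exact get_left h
  have k2 : ∀ u n, lb B E u = some n →
      lb (A ++ B) (D ++ E) (Sum.map (· + A.length) (· + D.length) u) = some n := by
    rintro (u | u) n h
    · exact get_right h
    · exact get_right h
  constructor
  · rintro u v (h | ⟨u, v, h, rfl, rfl⟩)
    · obtain ⟨n, h1, h2⟩ := hR.1 _ _ h
      exact ⟨n, k1 _ _ h1, k1 _ _ h2⟩
    · obtain ⟨n, h1, h2⟩ := hS.1 _ _ h
      exact ⟨n, k2 _ _ h1, k2 _ _ h2⟩
  · intro j hj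
    rw [List.length_append] at hj
    by_cases h : j < D.length
    · obtain ⟨i, hi⟩ := hR.2 j h
      exact ⟨i, Or.inl hi⟩
    · obtain ⟨i, hi⟩ := hS.2 (j - D.length) (by omega)
      refine ⟨i + A.length, Or.inr ⟨_, _, hi, rfl, ?_⟩⟩
      simp only [Sum.map_inr]; congr 1; omega

theorem sound_G {A B : Form Q} (f : Term Q A B) : Sound (lst A) (lst B) f.G := by
  induction f with
  | id A => exact sound_id _ _ (lst_length A).symm
  | comp g f ihg ihf => exact sound_comp ihf ihg
  | conj f g ihf ihg => exact sound_par ihf ihg _ _ (lst_length _).symm (lst_length _).symm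
  | disj f g ihf ihg => exact sound_par ihf ihg _ _ (lst_length _).symm (lst_length _).symm
  | bConjTo A B C =>
    have := sound_id (lst (A ⋏ (B ⋏ C))) _ (lst_length _).symm
    simpa only [lst, List.append_assoc, Term.G, Form.size] using this
  | bConjFrom A B C =>
    have := sound_id (lst ((A ⋏ B) ⋏ C)) _ (lst_length _).symm
    simpa only [lst, List.append_assoc, Term.G, Form.size] using this
  | bDisjTo A B C =>
    have := sound_id (lst (A ⋎ (B ⋎ C))) _ (lst_length _).symm
    simpa only [lst, List.append_assoc, Term.G, Form.size] using this
  | bDisjFrom A B C =>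
    have := sound_id (lst ((A ⋎ B) ⋎ C)) _ (lst_length _).symm
    simpa only [lst, List.append_assoc, Term.G, Form.size] using this
  | cConj A B => exact sound_swap _ _ _ _ (lst_length _).symm (lst_length _).symm
  | cDisj A B => exact sound_swap _ _ _ _ (lst_length _).symm (lst_length _).symm
  | d A B C =>
    have := sound_id (lst (A ⋏ (B ⋎ C))) _ (lst_length _).symm
    simpa only [lst, List.append_assoc, Term.G, Form.size] using this

end Ren

variable {P : Type}

theorem mapF_congr {σ τ : ℕ → P} (A : Form ℕ) (h : ∀ n ∈ lets A, σ n = τ n) :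
    mapF σ A = mapF τ A := by
  induction A with
  | letter n => simp only [mapF, h n (Set.mem_singleton n)]
  | conj A B h1 h2 =>
    simp only [mapF, h1 fun n hn => h n (Or.inl hn), h2 fun n hn => h n (Or.inr hn)]
  | disj A B h1 h2 =>
    simp only [mapF, h1 fun n hn => h n (Or.inl hn), h2 fun n hn => h n (Or.inr hn)]

theorem exists_div_op (c : Bool) {A B : Form P} {k : ℕ} {A' B' : Form ℕ} {σ τ : ℕ → P}
    (hA : Div A') (hB : Div B') (eA : mapF σ A' = A) (eB : mapF τ B' = B)
    (bA : ∀ n ∈ lets A', k ≤ n ∧ n < k + A.size)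
    (bB : ∀ n ∈ lets B', k + A.size ≤ n ∧ n < k + A.size + B.size) :
    ∃ (C' : Form ℕ) (σ : ℕ → P), Div C' ∧ mapF σ C' = opF c A B ∧
      ∀ n ∈ lets C', k ≤ n ∧ n < k + (A.size + B.size) := by
  let ρ : ℕ → P := fun n => if n < k + A.size then σ n else τ n
  have e1 : mapF ρ A' = A := by
    rw [← eA]; exact mapF_congr A' fun n hn => if_pos (bA n hn).2
  have e2 : mapF ρ B' = B := by
    rw [← eB]; exact mapF_congr B' fun n hn => if_neg (by have := bB n hn; omega)
  have hj : ∀ p, p ∈ lets A' → p ∈ lets B' → False := fun p h1 h2 => by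
    have := bA p h1; have := bB p h2; omega
  have hb : ∀ n, n ∈ lets A' ∨ n ∈ lets B' → k ≤ n ∧ n < k + (A.size + B.size) := by
    rintro n (h | h)
    · have := bA n h; omega
    · have := bB n h; omega
  cases c
  · exact ⟨A' ⋎ B', ρ, ⟨hA, hB, hj⟩, by simp only [mapF, e1, e2], hb⟩
  · exact ⟨A' ⋏ B', ρ, ⟨hA, hB, hj⟩, by simp only [mapF, e1, e2], hb⟩

theorem exists_div (A : Form P) : ∀ k : ℕ, ∃ (A' : Form ℕ) (σ : ℕ → P), Div A' ∧ mapF σ A' = A ∧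
    ∀ n ∈ lets A', k ≤ n ∧ n < k + A.size := by
  induction A with
  | letter p =>
    intro k
    refine ⟨.letter k, fun _ => p, trivial, rfl, ?_⟩
    rintro n rfl
    simp [Form.size]
  | conj A B h1 h2 =>
    intro k
    obtain ⟨A', σ, hA, eA, bA⟩ := h1 k
    obtain ⟨B', τ, hB, eB, bB⟩ := h2 (k + A.size)
    exact exists_div_op true hA hB eA eB bA bB
  | disj A B h1 h2 =>
    intro k
    obtain ⟨A', σ, hA, eA, bA⟩ := h1 k
    obtain ⟨B', τ, hB, eB, bB⟩ := h2 (k + A.size)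
    exact exists_div_op false hA hB eA eB bA bB

theorem coherence {A B : Form P} (f g : Term P A B) (h : f.G = g.G) : Eqv f g := by
  obtain ⟨A', σ, hA, rfl, _⟩ := exists_div A 0
  obtain ⟨B₁, f', rfl, hf⟩ := lift_term σ f A' rfl
  obtain rfl := eq_of_heq hf
  obtain ⟨B₂, g', e, hg⟩ := lift_term σ g A' rfl
  have hG : f'.G = g'.G := by
    rw [← mapT_G σ f', h, ← mapT_G σ g']
    clear h
    revert g
    rw [← e]
    intro g hg
    rw [eq_of_heq hg]
  have sf := sound_G f'
  have sg := sound_G g'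
  rw [← hG] at sg
  have hlen : (lst B₁).length = (lst B₂).length := by
    rw [lst_length, lst_length, ← mapF_size σ, ← e, mapF_size]
  have hB : B₂ = B₁ := by
    refine (lst_inj σ e.symm ?_).symm
    refine List.ext_getElem? fun j => ?_
    by_cases hj : j < (lst B₁).length
    · obtain ⟨i, hi⟩ := sf.2 j hj
      obtain ⟨n, n1, n2⟩ := sf.1 _ _ hi
      obtain ⟨m, m1, m2⟩ := sg.1 _ _ hi
      have : some n = some m := n1.symm.trans m1
      exact n2.trans (this.trans m2.symm)
    · rw [List.getElem?_eq_none (by omega), List.getElem?_eq_none (by omega)]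
  subst hB
  obtain rfl := eq_of_heq hg
  exact mapT_eqv σ (qm_eq.1 (thin_div hA (qm f') (qm g')))

end DSC

/-- **DS Coherence**: the functor `G` from DS to Br is faithful; that is, for all
arrow terms `f, g : A ⊢ B` of DS, if `Gf = Gg` in Br then `f = g` in DS. -/
theorem DS_coherence {P : Type} {A B : Form P} (f g : Term P A B) :
    Term.G f = Term.G g → Eqv f g := by
  exact DSC.coherence f g
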